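/- For any two skew shapes λ/μ and ν/ρ (partitions with at most k parts, μ ⊆ λ and ρ ⊆ ν), the symmetric function s_{sort₁(λ,ν)/sort₁(μ,ρ)}·s_{sort₂(λ,ν)/sort₂(μ,ρ)} − s_{λ/μ}·s_{ν/ρ} is Schur nonnegative. -/

import Mathlib

/-- The complete homogeneous symmetric function `h_m` in `N` variables,
with `h_m = 0` for `m < 0`. -/
noncomputable def homog (N : ℕ) (m : ℤ) : MvPolynomial (Fin N) ℤ :=
  if 0 ≤ m then MvPolynomial.hsymm (Fin N) ℤ m.toNat else 0

/-- The skew Schur polynomial `s_{λ/μ}` in `N` variables, given by the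
Jacobi–Trudi determinant `det (h_{λ_i - μ_j - i + j})_{i,j=1}^k`, where the
partitions `lam`, `mu` are recorded 0-indexed (`lam 0 = λ_1`). -/
noncomputable def skewSchur (N k : ℕ) (lam mu : ℕ → ℕ) : MvPolynomial (Fin N) ℤ :=
  Matrix.det (Matrix.of fun i j : Fin k =>
    homog N ((lam i : ℤ) - (mu j : ℤ) - (i : ℤ) + (j : ℤ)))

/-- A symmetric polynomial is Schur nonnegative if it is a linear combination
with nonnegative coefficients of Schur polynomials `s_λ`. -/
def IsSchurNonneg (N : ℕ) (f : MvPolynomial (Fin N) ℤ) : Prop :=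
  ∃ (m : ℕ) (c : Fin m → ℕ) (k : Fin m → ℕ) (lam : Fin m → ℕ → ℕ),
    (∀ i, Antitone (lam i)) ∧ (∀ i j, k i ≤ j → lam i j = 0) ∧
    f = ∑ i, (c i : ℤ) • skewSchur N (k i) (lam i) (fun _ => 0)


/-- One step move of a particle. -/
def ev (M : Finset ℤ) (z : ℤ) : ℤ := if z ∈ M then z + 2 else z

/-- The states of the particle system. -/
def st (Z0 : Finset ℤ) (M : ℕ → Finset ℤ) : ℕ → Finset ℤ
  | 0 => Z0
  | t + 1 => (st Z0 M t).image (ev (M t))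

/-- Prepend a move set. -/
def consM (A : Finset ℤ) (M : ℕ → Finset ℤ) : ℕ → Finset ℤ
  | 0 => A
  | t + 1 => M t

/-- Valid configurations. -/
structure Valid (n : ℕ) (Z0 : Finset ℤ) (M : ℕ → Finset ℤ) : Prop where
  sub : ∀ t, M t ⊆ st Z0 M t
  inj : ∀ t, Set.InjOn (ev (M t)) (st Z0 M t : Set ℤ)
  triv : ∀ t, n ≤ t → M t = ∅

open Classical in
/-- Admissible first moves. -/
noncomputable def mvs (Z : Finset ℤ) : Finset (Finset ℤ) :=
  Z.powerset.filter fun A => Set.InjOn (ev A) (Z : Set ℤ)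

theorem mem_mvs {Z A : Finset ℤ} : A ∈ mvs Z ↔ A ⊆ Z ∧ Set.InjOn (ev A) (Z : Set ℤ) := by
  simp [mvs]

open Classical in
/-- The finite set of configurations. -/
noncomputable def cfg : ℕ → Finset ℤ → Finset ℤ → Finset (ℕ → Finset ℤ)
  | 0, Z0, Zn => if Z0 = Zn then {fun _ => ∅} else ∅
  | n + 1, Z0, Zn => (mvs Z0).biUnion fun A => (cfg n (Z0.image (ev A)) Zn).image (consM A)

theorem ev_empty (z : ℤ) : ev ∅ z = z := by simp [ev]

theorem image_ev_empty (Z : Finset ℤ) : Z.image (ev ∅) = Z := by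
  have : ev ∅ = id := by funext z; simp [ev]
  rw [this, Finset.image_id]

theorem st_consM (Z0 A : Finset ℤ) (M : ℕ → Finset ℤ) (t : ℕ) :
    st Z0 (consM A M) (t + 1) = st (Z0.image (ev A)) M t := by
  induction t with
  | zero => rfl
  | succ t ih =>
    rw [st, ih]; rfl

theorem consM_eta (M : ℕ → Finset ℤ) : consM (M 0) (fun t => M (t + 1)) = M := by
  funext t; cases t <;> rfl

theorem st_empty (Z0 : Finset ℤ) (t : ℕ) : st Z0 (fun _ => ∅) t = Z0 := by
  induction t with
  | zero => rfl
  | succ t ih => rw [st, ih, image_ev_empty]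

theorem consM_inj {A : Finset ℤ} : Function.Injective (consM A) := by
  intro M M' h
  funext t
  exact congrFun h (t + 1)

theorem valid_succ {n : ℕ} {Z0 : Finset ℤ} {A : Finset ℤ} {M : ℕ → Finset ℤ} :
    Valid (n + 1) Z0 (consM A M) ↔ A ∈ mvs Z0 ∧ Valid n (Z0.image (ev A)) M := by
  rw [mem_mvs]
  constructor
  · intro h
    refine ⟨⟨h.sub 0, h.inj 0⟩, ⟨fun t => ?_, fun t => ?_, fun t ht => ?_⟩⟩
    · have := h.sub (t + 1); rwa [st_consM] at this
    · have := h.inj (t + 1); rwa [st_consM] at this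
    · exact h.triv (t + 1) (by omega)
  · rintro ⟨⟨h1, h2⟩, h⟩
    refine ⟨fun t => ?_, fun t => ?_, fun t ht => ?_⟩
    · cases t with
      | zero => exact h1
      | succ t => rw [st_consM]; exact h.sub t
    · cases t with
      | zero => exact h2
      | succ t => rw [st_consM]; exact h.inj t
    · cases t with
      | zero => omega
      | succ t => exact h.triv t (by omega)

theorem mem_cfg {n : ℕ} {Z0 Zn : Finset ℤ} {M : ℕ → Finset ℤ} :
    M ∈ cfg n Z0 Zn ↔ Valid n Z0 M ∧ st Z0 M n = Zn := by
  induction n generalizing Z0 M with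
  | zero =>
    constructor
    · intro h
      by_cases e : Z0 = Zn
      · simp only [cfg, e, if_true, Finset.mem_singleton] at h
        subst h
        refine ⟨⟨fun t => by simp, fun t => ?_, fun _ _ => rfl⟩, e⟩
        intro x _ y _ hxy
        simpa [ev_empty] using hxy
      · simp [cfg, e] at h
    · rintro ⟨h, e⟩
      have e' : Z0 = Zn := e
      simp only [cfg, e', if_true, Finset.mem_singleton]
      funext t
      exact h.triv t (Nat.zero_le _)
  | succ n ih =>
    simp only [cfg, Finset.mem_biUnion, Finset.mem_image]
    constructor
    · rintro ⟨A, hA, M', hM', rfl⟩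
      rw [ih] at hM'
      exact ⟨valid_succ.2 ⟨hA, hM'.1⟩, by rw [st_consM]; exact hM'.2⟩
    · rintro ⟨h, e⟩
      rw [← consM_eta M] at h e
      rw [valid_succ] at h
      rw [st_consM] at e
      exact ⟨M 0, h.1, _, ih.2 ⟨h.2, e⟩, consM_eta M⟩

/-- Generating function of configurations. -/
noncomputable def CF {R : Type*} [CommRing R] (n : ℕ) (X : ℕ → R) (Z0 Zn : Finset ℤ) : R :=
  ∑ M ∈ cfg n Z0 Zn, ∏ t ∈ Finset.range n, X t ^ (M t).card

section
variable {R : Type*} [CommRing R]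

theorem CF_zero (X : ℕ → R) (Z0 Zn : Finset ℤ) : CF 0 X Z0 Zn = if Z0 = Zn then 1 else 0 := by
  unfold CF cfg
  split_ifs <;> simp

theorem sum_cfg_succ {n : ℕ} {Z0 Zn : Finset ℤ} (f : (ℕ → Finset ℤ) → R) :
    ∑ M ∈ cfg (n + 1) Z0 Zn, f M
      = ∑ A ∈ mvs Z0, ∑ M ∈ cfg n (Z0.image (ev A)) Zn, f (consM A M) := by
  classical
  rw [cfg, Finset.sum_biUnion]
  · refine Finset.sum_congr rfl fun A _ => ?_
    rw [Finset.sum_image]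
    intro a _ b _ h
    exact consM_inj h
  · intro A _ B _ hAB
    rw [Function.onFun, Finset.disjoint_left]
    intro M h1 h2
    simp only [Finset.mem_image] at h1 h2
    obtain ⟨a, _, rfl⟩ := h1
    obtain ⟨b, _, h⟩ := h2
    exact hAB (congrFun h 0).symm

theorem CF_succ (n : ℕ) (X : ℕ → R) (Z0 Zn : Finset ℤ) :
    CF (n + 1) X Z0 Zn = ∑ A ∈ mvs Z0, X 0 ^ A.card *
      CF n (fun t => X (t + 1)) (Z0.image (ev A)) Zn := by
  unfold CF
  rw [sum_cfg_succ]
  refine Finset.sum_congr rfl fun A _ => ?_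
  rw [Finset.mul_sum]
  refine Finset.sum_congr rfl fun M _ => ?_
  rw [Finset.prod_range_succ']
  simp only [consM]
  ring

theorem ev_add (A : Finset ℤ) (c z : ℤ) : ev (A.image (· + c)) (z + c) = ev A z + c := by
  unfold ev
  simp only [Finset.mem_image, add_left_inj, exists_eq_right]
  split_ifs <;> ring

theorem CF_shift (n : ℕ) (X : ℕ → R) (c : ℤ) (Z0 Zn : Finset ℤ) :
    CF n X (Z0.image (· + c)) (Zn.image (· + c)) = CF n X Z0 Zn := by
  have hinj : Function.Injective (fun z : ℤ => z + c) := add_left_injective c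
  have hi := Finset.image_injective hinj
  induction n generalizing X Z0 with
  | zero =>
    rw [CF_zero, CF_zero]
    simp only [hi.eq_iff]
  | succ n ih =>
    rw [CF_succ, CF_succ]
    symm
    have himg : ∀ A : Finset ℤ, (Z0.image (· + c)).image (ev (A.image (· + c)))
        = (Z0.image (ev A)).image (· + c) := by
      intro A
      rw [Finset.image_image, Finset.image_image]
      refine Finset.image_congr fun z _ => ?_
      exact ev_add A c z
    refine Finset.sum_bij (fun A _ => A.image (· + c)) ?_ ?_ ?_ ?_
    · intro A hA
      rw [mem_mvs] at hA ⊢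
      refine ⟨Finset.image_subset_image hA.1, ?_⟩
      intro x hx y hy hxy
      simp only [Finset.coe_image, Set.mem_image] at hx hy
      obtain ⟨x, hx, rfl⟩ := hx
      obtain ⟨y, hy, rfl⟩ := hy
      simp only [ev_add, add_left_inj] at hxy ⊢
      exact hA.2 hx hy hxy
    · intro A _ B _ h
      exact hi h
    · intro B hB
      rw [mem_mvs] at hB
      obtain ⟨A, hA, rfl⟩ := Finset.subset_image_iff.1 hB.1
      refine ⟨A, ?_, rfl⟩
      rw [mem_mvs]
      refine ⟨hA, fun x hx y hy hxy => ?_⟩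
      have := hB.2 (show x + c ∈ _ by simpa using hx) (show y + c ∈ _ by simpa using hy)
        (by rw [ev_add, ev_add, hxy])
      simpa using this
    · intro A _
      rw [himg, ih, Finset.card_image_of_injective _ hinj]

theorem ev_le {A : Finset ℤ} {z : ℤ} : z ≤ ev A z := by unfold ev; split_ifs <;> omega

theorem CF_bound (n : ℕ) (X : ℕ → R) (Z0 Zn : Finset ℤ) (B : ℤ) (hB : ∀ z ∈ Zn, z ≤ B)
    (z : ℤ) (hz : z ∈ Z0) (hzB : B < z) : CF n X Z0 Zn = 0 := by
  induction n generalizing X Z0 z with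
  | zero =>
    rw [CF_zero, if_neg]
    rintro rfl
    have := hB z hz
    omega
  | succ n ih =>
    rw [CF_succ]
    refine Finset.sum_eq_zero fun A _ => ?_
    rw [ih _ _ (ev A z) (Finset.mem_image_of_mem _ hz) (lt_of_lt_of_le hzB ev_le), mul_zero]

theorem ev_parity (A : Finset ℤ) (z : ℤ) : ev A z % 2 = z % 2 := by
  unfold ev; split_ifs <;> omega

theorem CF_mul (n : ℕ) (X : ℕ → R) (A B A' B' : Finset ℤ)
    (hA : ∀ z ∈ A, z % 2 = 0) (hB : ∀ z ∈ B, z % 2 = 1)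
    (hA' : ∀ z ∈ A', z % 2 = 0) (hB' : ∀ z ∈ B', z % 2 = 1) :
    CF n X (A ∪ B) (A' ∪ B') = CF n X A A' * CF n X B B' := by
  induction n generalizing X A B with
  | zero =>
    rw [CF_zero, CF_zero, CF_zero]
    have : A ∪ B = A' ∪ B' ↔ A = A' ∧ B = B' := by
      constructor
      · intro h
        have h' : ∀ z, (z ∈ A ∨ z ∈ B) ↔ (z ∈ A' ∨ z ∈ B') := by
          intro z; simpa using Finset.ext_iff.1 h z
        constructor
        · ext z
          have := h' z; have := hA z; have := hB z; have := hA' z; have := hB' z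
          grind
        · ext z
          have := h' z; have := hA z; have := hB z; have := hA' z; have := hB' z
          grind
      · rintro ⟨rfl, rfl⟩; rfl
    simp only [this]
    split_ifs with h1 h2 h3 h4 h5 <;> simp_all
  | succ n ih =>
    rw [CF_succ, CF_succ, CF_succ, Finset.sum_mul_sum, ← Finset.sum_product']
    symm
    have key1 : ∀ P Q : Finset ℤ, P ⊆ A → Q ⊆ B → ∀ z ∈ A, ev (P ∪ Q) z = ev P z := by
      intro P Q hP hQ z hz
      have : z ∉ Q := fun h => by have := hA z hz; have := hB z (hQ h); omega
      simp [ev, this]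
    have key2 : ∀ P Q : Finset ℤ, P ⊆ A → Q ⊆ B → ∀ z ∈ B, ev (P ∪ Q) z = ev Q z := by
      intro P Q hP hQ z hz
      have : z ∉ P := fun h => by have := hA z (hP h); have := hB z hz; omega
      simp [ev, this]
    have dj : ∀ P Q : Finset ℤ, P ⊆ A → Q ⊆ B → Disjoint P Q := by
      intro P Q hP hQ
      rw [Finset.disjoint_left]
      intro z h1 h2
      have := hA z (hP h1); have := hB z (hQ h2); omega
    refine Finset.sum_bij (fun p _ => p.1 ∪ p.2) ?_ ?_ ?_ ?_
    · rintro ⟨P, Q⟩ h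
      simp only [Finset.mem_product, mem_mvs] at h
      obtain ⟨⟨hP, iP⟩, ⟨hQ, iQ⟩⟩ := h
      rw [mem_mvs]
      refine ⟨Finset.union_subset_union hP hQ, ?_⟩
      intro x hx y hy hxy
      simp only at hxy
      simp only [Finset.coe_union, Set.mem_union, Finset.mem_coe] at hx hy
      have pe := ev_parity (P ∪ Q) x
      have pe' := ev_parity (P ∪ Q) y
      rw [hxy] at pe
      rcases hx with hx | hx <;> rcases hy with hy | hy
      · rw [key1 P Q hP hQ x hx, key1 P Q hP hQ y hy] at hxy
        exact iP hx hy hxy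
      · have := hA x hx; have := hB y hy; omega
      · have := hB x hx; have := hA y hy; omega
      · rw [key2 P Q hP hQ x hx, key2 P Q hP hQ y hy] at hxy
        exact iQ hx hy hxy
    · rintro ⟨P, Q⟩ h ⟨P', Q'⟩ h' e
      simp only [Finset.mem_product, mem_mvs] at h h'
      have e' : ∀ z, (z ∈ P ∨ z ∈ Q) ↔ (z ∈ P' ∨ z ∈ Q') := by
        intro z; simpa using Finset.ext_iff.1 e z
      have a1 : ∀ z, z ∈ P → z % 2 = 0 := fun z hz => hA z (h.1.1 hz)
      have a2 : ∀ z, z ∈ Q → z % 2 = 1 := fun z hz => hB z (h.2.1 hz)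
      have a3 : ∀ z, z ∈ P' → z % 2 = 0 := fun z hz => hA z (h'.1.1 hz)
      have a4 : ∀ z, z ∈ Q' → z % 2 = 1 := fun z hz => hB z (h'.2.1 hz)
      have : P = P' := by
        ext z
        have := e' z; have := a1 z; have := a2 z; have := a3 z; have := a4 z
        grind
      have : Q = Q' := by
        ext z
        have := e' z; have := a1 z; have := a2 z; have := a3 z; have := a4 z
        grind
      simp_all
    · intro M hM
      rw [mem_mvs] at hM
      have e : (A ∩ M) ∪ (B ∩ M) = M := by
        rw [← Finset.union_inter_distrib_right]
        exact Finset.inter_eq_right.2 hM.1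
      refine ⟨(A ∩ M, B ∩ M), ?_, e⟩
      have k1 := key1 (A ∩ M) (B ∩ M) Finset.inter_subset_left Finset.inter_subset_left
      have k2 := key2 (A ∩ M) (B ∩ M) Finset.inter_subset_left Finset.inter_subset_left
      rw [e] at k1 k2
      simp only [Finset.mem_product, mem_mvs]
      refine ⟨⟨Finset.inter_subset_left, fun x hx y hy hxy => ?_⟩,
        ⟨Finset.inter_subset_left, fun x hx y hy hxy => ?_⟩⟩
      · rw [← k1 x hx, ← k1 y hy] at hxy
        exact hM.2 (by simp at hx ⊢; tauto) (by simp at hy ⊢; tauto) hxy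
      · rw [← k2 x hx, ← k2 y hy] at hxy
        exact hM.2 (by simp at hx ⊢; tauto) (by simp at hy ⊢; tauto) hxy
    · rintro ⟨P, Q⟩ h
      simp only [Finset.mem_product, mem_mvs] at h
      obtain ⟨⟨hP, iP⟩, ⟨hQ, iQ⟩⟩ := h
      have e : (A ∪ B).image (ev (P ∪ Q)) = A.image (ev P) ∪ B.image (ev Q) := by
        rw [Finset.image_union]
        congr 1
        · exact Finset.image_congr fun z hz => key1 P Q hP hQ z hz
        · exact Finset.image_congr fun z hz => key2 P Q hP hQ z hz
      simp only
      rw [e, ih, Finset.card_union_of_disjoint (dj P Q hP hQ), pow_add]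
      · ring
      · intro z hz
        simp only [Finset.mem_image] at hz
        obtain ⟨w, hw, rfl⟩ := hz
        rw [ev_parity]; exact hA w hw
      · intro z hz
        simp only [Finset.mem_image] at hz
        obtain ⟨w, hw, rfl⟩ := hz
        rw [ev_parity]; exact hB w hw

end


theorem exists_up (S : Finset ℤ) (z : ℤ) : ∃ k : ℕ, z + 2 * (k : ℤ) ∉ S := by
  by_contra h
  push Not at h
  have : Set.Infinite (S : Set ℤ) := by
    refine Set.infinite_of_injective_forall_mem (f := fun k : ℕ => z + 2 * (k : ℤ)) ?_ h
    intro a b hab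
    simp only at hab
    omega
  exact this S.finite_toSet

theorem exists_dn (S : Finset ℤ) (z : ℤ) : ∃ k : ℕ, z - 2 * (k : ℤ) ∉ S := by
  by_contra h
  push Not at h
  have : Set.Infinite (S : Set ℤ) := by
    refine Set.infinite_of_injective_forall_mem (f := fun k : ℕ => z - 2 * (k : ℤ)) ?_ h
    intro a b hab
    simp only at hab
    omega
  exact this S.finite_toSet

theorem exists_refl (S : Finset ℤ) : ∃ ρ : ℤ → ℤ, (∀ z ∈ S, ρ z ∈ S) ∧ (∀ z ∈ S, ρ (ρ z) = z) ∧
    (∀ z ∈ S, z + 2 ∈ S → ρ (z + 2) = ρ z - 2) := by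
  classical
  let u : ℤ → ℕ := fun z => Nat.find (exists_up S z)
  let d : ℤ → ℕ := fun z => Nat.find (exists_dn S z)
  have u1 : ∀ z, z + 2 * (u z : ℤ) ∉ S := fun z => Nat.find_spec (exists_up S z)
  have d1 : ∀ z, z - 2 * (d z : ℤ) ∉ S := fun z => Nat.find_spec (exists_dn S z)
  have u2 : ∀ z (k : ℕ), k < u z → z + 2 * (k : ℤ) ∈ S := fun z k hk => by
    simpa using Nat.find_min (exists_up S z) hk
  have d2 : ∀ z (k : ℕ), k < d z → z - 2 * (k : ℤ) ∈ S := fun z k hk => by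
    simpa using Nat.find_min (exists_dn S z) hk
  have ue : ∀ z (m : ℕ), z + 2 * (m : ℤ) ∉ S → (∀ k < m, z + 2 * (k : ℤ) ∈ S) → u z = m := by
    intro z m h1 h2
    rcases lt_trichotomy (u z) m with h | h | h
    · exact absurd (h2 _ h) (u1 z)
    · exact h
    · exact absurd (u2 _ _ h) h1
  have de : ∀ z (m : ℕ), z - 2 * (m : ℤ) ∉ S → (∀ k < m, z - 2 * (k : ℤ) ∈ S) → d z = m := by
    intro z m h1 h2
    rcases lt_trichotomy (d z) m with h | h | h
    · exact absurd (h2 _ h) (d1 z)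
    · exact h
    · exact absurd (d2 _ _ h) h1
  have pos : ∀ z ∈ S, 0 < u z ∧ 0 < d z := by
    intro z hz
    refine ⟨Nat.pos_of_ne_zero fun h => u1 z ?_, Nat.pos_of_ne_zero fun h => d1 z ?_⟩
    · rw [h]; simpa using hz
    · rw [h]; simpa using hz
  -- elements of the run
  have run : ∀ z ∈ S, ∀ j : ℤ, -(d z : ℤ) < j → j < u z → z + 2 * j ∈ S := by
    intro z hz j h1 h2
    rcases le_total 0 j with h | h
    · have := u2 z j.toNat (by omega)
      rwa [Int.toNat_of_nonneg h] at this
    · have := d2 z (-j).toNat (by omega)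
      rw [Int.toNat_of_nonneg (by omega)] at this
      convert this using 1; ring
  have uj : ∀ z ∈ S, ∀ j : ℤ, -(d z : ℤ) < j → j < u z → (u (z + 2 * j) : ℤ) = u z - j := by
    intro z hz j h1 h2
    have := ue (z + 2 * j) (u z - j).toNat (by
      rw [Int.toNat_of_nonneg (by omega)]
      convert u1 z using 2; ring) (by
      intro k hk
      have := run z hz (j + k) (by omega) (by omega)
      convert this using 1; ring)
    rw [this]; omega
  have dj : ∀ z ∈ S, ∀ j : ℤ, -(d z : ℤ) < j → j < u z → (d (z + 2 * j) : ℤ) = d z + j := by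
    intro z hz j h1 h2
    have := de (z + 2 * j) (d z + j).toNat (by
      rw [Int.toNat_of_nonneg (by omega)]
      convert d1 z using 2; ring) (by
      intro k hk
      have := run z hz (j - k) (by omega) (by omega)
      convert this using 1; ring)
    rw [this]; omega
  refine ⟨fun z => z + 2 * ((u z : ℤ) - d z), ?_, ?_, ?_⟩
  · intro z hz
    have := pos z hz
    exact run z hz _ (by omega) (by omega)
  · intro z hz
    have := pos z hz
    simp only
    rw [uj z hz _ (by omega) (by omega), dj z hz _ (by omega) (by omega)]
    ring
  · intro z hz hz2
    have := pos z hz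
    have h2 := pos _ hz2
    have hu : 1 < u z := by
      by_contra h
      have : u z = 1 := by omega
      have h3 := u1 z
      rw [this] at h3
      exact h3 (by simpa using hz2)
    have a := uj z hz 1 (by omega) (by omega)
    have b := dj z hz 1 (by omega) (by omega)
    simp only [mul_one] at a b ⊢
    omega

/-- reflection of runs -/
noncomputable def rfl2 (S : Finset ℤ) : ℤ → ℤ := Classical.choose (exists_refl S)

theorem rfl2_mem {S : Finset ℤ} {z : ℤ} (h : z ∈ S) : rfl2 S z ∈ S :=
  (Classical.choose_spec (exists_refl S)).1 z h
theorem rfl2_rfl2 {S : Finset ℤ} {z : ℤ} (h : z ∈ S) : rfl2 S (rfl2 S z) = z :=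
  (Classical.choose_spec (exists_refl S)).2.1 z h
theorem rfl2_add {S : Finset ℤ} {z : ℤ} (h : z ∈ S) (h' : z + 2 ∈ S) :
    rfl2 S (z + 2) = rfl2 S z - 2 :=
  (Classical.choose_spec (exists_refl S)).2.2 z h h'

/-- free particles -/
def Fr (Q M1 M2 : Finset ℤ) (θ : ℤ) : Finset ℤ :=
  Q.filter fun z => θ < z ∧ ev M2 (ev M1 z) = z + 2

open Classical in
/-- new first move set -/
noncomputable def bk1 (Q M1 M2 : Finset ℤ) (θ : ℤ) : Finset ℤ :=
  Q.filter fun z => if z ∈ Fr Q M1 M2 θ then rfl2 (Fr Q M1 M2 θ) z ∉ M1 else z ∈ M1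

open Classical in
/-- new second movers, in original positions -/
noncomputable def bkB (Q M1 M2 : Finset ℤ) (θ : ℤ) : Finset ℤ :=
  Q.filter fun z => if z ∈ Fr Q M1 M2 θ then rfl2 (Fr Q M1 M2 θ) z ∈ M1 else ev M1 z ∈ M2

/-- new second move set -/
noncomputable def bk2 (Q M1 M2 : Finset ℤ) (θ : ℤ) : Finset ℤ :=
  (bkB Q M1 M2 θ).image (ev (bk1 Q M1 M2 θ))

/-- Hypotheses for the Bender-Knuth move. -/
structure BKH (Q M1 M2 : Finset ℤ) (θ : ℤ) : Prop where
  s1 : M1 ⊆ Q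
  i1 : Set.InjOn (ev M1) (Q : Set ℤ)
  s2 : M2 ⊆ Q.image (ev M1)
  i2 : Set.InjOn (ev M2) (Q.image (ev M1) : Finset ℤ)
  hc : ∀ y ∈ M1, y ≤ θ → y + 2 ∈ Q → θ < y + 2 → ev M2 (ev M1 (y + 2)) ≠ y + 4

section
variable {Q M1 M2 : Finset ℤ} {θ : ℤ}

theorem mem_Fr {z : ℤ} : z ∈ Fr Q M1 M2 θ ↔ z ∈ Q ∧ θ < z ∧ ev M2 (ev M1 z) = z + 2 := by
  simp [Fr]

theorem BKH.ginj (h : BKH Q M1 M2 θ) {x y : ℤ} (hx : x ∈ Q) (hy : y ∈ Q)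
    (e : ev M2 (ev M1 x) = ev M2 (ev M1 y)) : x = y := by
  refine h.i1 hx hy (h.i2 ?_ ?_ e)
  · exact Finset.mem_coe.2 (Finset.mem_image_of_mem _ hx)
  · exact Finset.mem_coe.2 (Finset.mem_image_of_mem _ hy)

theorem mem_bk1_fr {z : ℤ} (hz : z ∈ Fr Q M1 M2 θ) :
    z ∈ bk1 Q M1 M2 θ ↔ rfl2 (Fr Q M1 M2 θ) z ∉ M1 := by
  simp [bk1, hz, (mem_Fr.1 hz).1]
theorem BKH.mem_bk1_nfr (h : BKH Q M1 M2 θ) {z : ℤ} (hz : z ∉ Fr Q M1 M2 θ) :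
    z ∈ bk1 Q M1 M2 θ ↔ z ∈ M1 := by
  simp only [bk1, hz, if_false, Finset.mem_filter, and_iff_right_iff_imp]
  exact fun h' => h.s1 h'
theorem mem_bkB_fr {z : ℤ} (hz : z ∈ Fr Q M1 M2 θ) :
    z ∈ bkB Q M1 M2 θ ↔ rfl2 (Fr Q M1 M2 θ) z ∈ M1 := by
  simp [bkB, hz, (mem_Fr.1 hz).1]
theorem mem_bkB_nfr {z : ℤ} (hQ : z ∈ Q) (hz : z ∉ Fr Q M1 M2 θ) :
    z ∈ bkB Q M1 M2 θ ↔ ev M1 z ∈ M2 := by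
  simp [bkB, hz, hQ]

theorem ev_ev_eq {A B : Finset ℤ} {z : ℤ} :
    ev B (ev A z) = z + (if z ∈ A then 2 else 0) + (if ev A z ∈ B then 2 else 0) := by
  unfold ev; split_ifs <;> ring

theorem fr_iff {z : ℤ} (hz : z ∈ Fr Q M1 M2 θ) : z ∈ M1 ↔ ev M1 z ∉ M2 := by
  have := (mem_Fr.1 hz).2.2
  rw [ev_ev_eq] at this
  by_cases h1 : z ∈ M1 <;> by_cases h2 : ev M1 z ∈ M2 <;> simp only [h1, h2, if_true, if_false] at this ⊢ <;>
    first | omega | simp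

theorem nfr_iff {z : ℤ} (hQ : z ∈ Q) (hz : z ∉ Fr Q M1 M2 θ) (hθ : θ < z) :
    z ∈ M1 ↔ ev M1 z ∈ M2 := by
  rw [mem_Fr] at hz
  have : ev M2 (ev M1 z) ≠ z + 2 := fun h => hz ⟨hQ, hθ, h⟩
  rw [ev_ev_eq] at this
  by_cases h1 : z ∈ M1 <;> by_cases h2 : ev M1 z ∈ M2 <;> simp only [h1, h2, if_true, if_false] at this ⊢ <;>
    first | omega | simp

theorem BKH.inj1 (h : BKH Q M1 M2 θ) : Set.InjOn (ev (bk1 Q M1 M2 θ)) (Q : Set ℤ) := by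
  have key : ∀ z ∈ Q, z + 2 ∈ Q → z ∈ bk1 Q M1 M2 θ → z + 2 ∈ bk1 Q M1 M2 θ := by
    intro z hz hz2 hm
    by_contra hm2
    by_cases f1 : z ∈ Fr Q M1 M2 θ
    · rw [mem_bk1_fr f1] at hm
      by_cases f2 : z + 2 ∈ Fr Q M1 M2 θ
      · rw [mem_bk1_fr f2, rfl2_add f1 f2, not_not] at hm2
        have a := (mem_Fr.1 (rfl2_mem f1)).1
        have b := (mem_Fr.1 (rfl2_mem f2)).1
        rw [rfl2_add f1 f2] at b
        have := h.i1 (Finset.mem_coe.2 a) (Finset.mem_coe.2 b) (by simp [ev, hm, hm2])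
        omega
      · rw [h.mem_bk1_nfr f2] at hm2
        have g1 := (mem_Fr.1 f1).2.2
        have g2 : ev M1 (z + 2) = z + 2 := by simp [ev, hm2]
        have g3 : ev M2 (ev M1 (z + 2)) = z + 2 := by
          rw [g2]
          unfold ev
          split_ifs with hh
          · exfalso; apply f2
            rw [mem_Fr]
            refine ⟨hz2, by have := (mem_Fr.1 f1).2.1; omega, ?_⟩
            rw [g2]; simp [ev, hh]
          · rfl
        have := h.ginj hz hz2 (by rw [g1, g3])
        omega
    · rw [h.mem_bk1_nfr f1] at hm
      have hm3 : z + 2 ∈ M1 := by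
        by_contra hh
        have := h.i1 (Finset.mem_coe.2 hz) (Finset.mem_coe.2 hz2) (by simp [ev, hm, hh])
        omega
      have f2 : z + 2 ∈ Fr Q M1 M2 θ := by
        by_contra f2
        rw [h.mem_bk1_nfr f2] at hm2
        exact hm2 hm3
      obtain ⟨_, t2, g2⟩ := mem_Fr.1 f2
      have hθ : z ≤ θ := by
        by_contra hθ
        push Not at hθ
        have e1 : ev M1 z = z + 2 := by simp [ev, hm]
        apply f1
        rw [mem_Fr]
        refine ⟨hz, hθ, ?_⟩
        rw [e1]
        unfold ev
        split_ifs with hh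
        · exfalso
          have : ev M2 (ev M1 z) = z + 4 := by rw [e1]; simp only [ev, hh, if_true]; ring
          have := h.ginj hz hz2 (by rw [g2, this]; ring)
          omega
        · rfl
      exact h.hc z hm hθ hz2 t2 (by rw [g2]; ring)
  intro x hx y hy hxy
  unfold ev at hxy
  split_ifs at hxy with h1 h2 h2
  · omega
  · subst hxy; exact absurd (key x hx hy h1) h2
  · subst hxy; exact absurd (key y hy hx h2) h1
  · exact hxy

theorem bkB_sub : bkB Q M1 M2 θ ⊆ Q := Finset.filter_subset _ _
theorem bk1_sub : bk1 Q M1 M2 θ ⊆ Q := Finset.filter_subset _ _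
theorem bk2_sub : bk2 Q M1 M2 θ ⊆ Q.image (ev (bk1 Q M1 M2 θ)) :=
  Finset.image_subset_image bkB_sub

theorem BKH.mem_bk2 (h : BKH Q M1 M2 θ) {z : ℤ} (hz : z ∈ Q) :
    ev (bk1 Q M1 M2 θ) z ∈ bk2 Q M1 M2 θ ↔ z ∈ bkB Q M1 M2 θ := by
  unfold bk2
  constructor
  · intro hh
    obtain ⟨w, hw, e⟩ := Finset.mem_image.1 hh
    have := h.inj1 (Finset.mem_coe.2 (bkB_sub hw)) (Finset.mem_coe.2 hz) e
    rwa [← this]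
  · exact fun hh => Finset.mem_image_of_mem _ hh

theorem BKH.g_eq (h : BKH Q M1 M2 θ) {z : ℤ} (hz : z ∈ Q) :
    ev (bk2 Q M1 M2 θ) (ev (bk1 Q M1 M2 θ) z) = ev M2 (ev M1 z) := by
  by_cases f : z ∈ Fr Q M1 M2 θ
  · rw [(mem_Fr.1 f).2.2, ev_ev_eq]
    simp only [h.mem_bk2 hz, mem_bkB_fr f, mem_bk1_fr f]
    split_ifs <;> first | contradiction | ring
  · rw [ev_ev_eq, ev_ev_eq]
    simp only [h.mem_bk2 hz, mem_bkB_nfr hz f, h.mem_bk1_nfr f]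

theorem BKH.img_eq (h : BKH Q M1 M2 θ) :
    (Q.image (ev (bk1 Q M1 M2 θ))).image (ev (bk2 Q M1 M2 θ)) = (Q.image (ev M1)).image (ev M2) := by
  rw [Finset.image_image, Finset.image_image]
  exact Finset.image_congr fun z hz => h.g_eq hz

theorem BKH.inj2 (h : BKH Q M1 M2 θ) :
    Set.InjOn (ev (bk2 Q M1 M2 θ)) (Q.image (ev (bk1 Q M1 M2 θ)) : Finset ℤ) := by
  intro x hx y hy hxy
  obtain ⟨x, hx', rfl⟩ := Finset.mem_image.1 (Finset.mem_coe.1 hx)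
  obtain ⟨y, hy', rfl⟩ := Finset.mem_image.1 (Finset.mem_coe.1 hy)
  rw [h.g_eq hx', h.g_eq hy'] at hxy
  rw [h.ginj hx' hy' hxy]

theorem BKH.fr_eq (h : BKH Q M1 M2 θ) :
    Fr Q (bk1 Q M1 M2 θ) (bk2 Q M1 M2 θ) θ = Fr Q M1 M2 θ := by
  ext z
  rw [mem_Fr, mem_Fr]
  constructor
  · rintro ⟨a, b, c⟩; rw [h.g_eq a] at c; exact ⟨a, b, c⟩
  · rintro ⟨a, b, c⟩; rw [← h.g_eq a] at c; exact ⟨a, b, c⟩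

theorem BKH.inv1 (h : BKH Q M1 M2 θ) :
    bk1 Q (bk1 Q M1 M2 θ) (bk2 Q M1 M2 θ) θ = M1 := by
  ext z
  by_cases hz : z ∈ Q
  · by_cases f : z ∈ Fr Q M1 M2 θ
    · rw [mem_bk1_fr (by rw [h.fr_eq]; exact f), h.fr_eq, mem_bk1_fr (rfl2_mem f), not_not,
        rfl2_rfl2 f]
    · have f' : z ∉ Fr Q (bk1 Q M1 M2 θ) (bk2 Q M1 M2 θ) θ := by rw [h.fr_eq]; exact f
      rw [bk1]
      simp only [f', if_false, Finset.mem_filter, hz, true_and]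
      exact h.mem_bk1_nfr f
  · exact ⟨fun h' => absurd (bk1_sub h') hz, fun h' => absurd (h.s1 h') hz⟩

theorem BKH.inv2 (h : BKH Q M1 M2 θ) :
    bk2 Q (bk1 Q M1 M2 θ) (bk2 Q M1 M2 θ) θ = M2 := by
  have hB : ∀ z ∈ Q, (z ∈ bkB Q (bk1 Q M1 M2 θ) (bk2 Q M1 M2 θ) θ ↔ ev M1 z ∈ M2) := by
    intro z hz
    by_cases f : z ∈ Fr Q M1 M2 θ
    · rw [mem_bkB_fr (by rw [h.fr_eq]; exact f), h.fr_eq, mem_bk1_fr (rfl2_mem f),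
        rfl2_rfl2 f, fr_iff f, not_not]
    · have f' : z ∉ Fr Q (bk1 Q M1 M2 θ) (bk2 Q M1 M2 θ) θ := by rw [h.fr_eq]; exact f
      rw [mem_bkB_nfr hz f', h.mem_bk2 hz, mem_bkB_nfr hz f]
  rw [bk2, h.inv1]
  ext w
  rw [Finset.mem_image]
  constructor
  · rintro ⟨z, hz, rfl⟩
    exact (hB z (bkB_sub hz)).1 hz
  · intro hw
    obtain ⟨z, hz, rfl⟩ := Finset.mem_image.1 (h.s2 hw)
    exact ⟨z, (hB z hz).2 hw, rfl⟩

theorem BKH.low1 (h : BKH Q M1 M2 θ) {z : ℤ} (hz : z ≤ θ) : z ∈ bk1 Q M1 M2 θ ↔ z ∈ M1 :=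
  h.mem_bk1_nfr (by rw [mem_Fr]; omega)

theorem BKH.low1e (h : BKH Q M1 M2 θ) {z : ℤ} (hz : z ≤ θ) :
    ev (bk1 Q M1 M2 θ) z = ev M1 z := by
  unfold ev; simp only [h.low1 hz]

theorem BKH.low2 (h : BKH Q M1 M2 θ) {z : ℤ} (hQ : z ∈ Q) (hz : z ≤ θ) :
    ev (bk1 Q M1 M2 θ) z ∈ bk2 Q M1 M2 θ ↔ ev M1 z ∈ M2 := by
  rw [h.mem_bk2 hQ, mem_bkB_nfr hQ (by rw [mem_Fr]; omega)]

theorem card_fr_refl {S : Finset ℤ} (p : ℤ → Prop) [DecidablePred p] :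
    (S.filter fun z => p (rfl2 S z)).card = (S.filter fun z => p z).card := by
  refine Finset.card_bij (fun z _ => rfl2 S z) ?_ ?_ ?_
  · intro z hz
    rw [Finset.mem_filter] at hz ⊢
    exact ⟨rfl2_mem hz.1, hz.2⟩
  · intro x hx y hy e
    rw [Finset.mem_filter] at hx hy
    rw [← rfl2_rfl2 hx.1, e, rfl2_rfl2 hy.1]
  · intro z hz
    rw [Finset.mem_filter] at hz
    exact ⟨rfl2 S z, by rw [Finset.mem_filter, rfl2_rfl2 hz.1]; exact ⟨rfl2_mem hz.1, hz.2⟩,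
      rfl2_rfl2 hz.1⟩

theorem BKH.card_M2 (h : BKH Q M1 M2 θ) : M2.card = (Q.filter fun z => ev M1 z ∈ M2).card := by
  symm
  refine Finset.card_bij (fun z _ => ev M1 z) ?_ ?_ ?_
  · intro z hz; exact (Finset.mem_filter.1 hz).2
  · intro x hx y hy e
    exact h.i1 (Finset.mem_filter.1 hx).1 (Finset.mem_filter.1 hy).1 e
  · intro w hw
    obtain ⟨z, hz, rfl⟩ := Finset.mem_image.1 (h.s2 hw)
    exact ⟨z, Finset.mem_filter.2 ⟨hz, hw⟩, rfl⟩

theorem split_card (Q F : Finset ℤ) (hF : F ⊆ Q) (θ : ℤ) (hθ : ∀ z ∈ F, θ < z) (p : ℤ → Prop)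
    [DecidablePred p] : (Q.filter p).card = (F.filter p).card +
      ((Q.filter fun z => z ∉ F ∧ θ < z ∧ p z).card + (Q.filter fun z => z ≤ θ ∧ p z).card) := by
  rw [← Finset.card_union_of_disjoint, ← Finset.card_union_of_disjoint]
  · congr 1
    ext z
    have := hθ z
    have := @hF z
    simp only [Finset.mem_union, Finset.mem_filter]
    by_cases h1 : z ∈ F
    · simp_all
    · rcases le_or_gt z θ with h2 | h2
      · have : ¬ θ < z := by omega
        simp_all
      · have : ¬ z ≤ θ := by omega
        simp_all
  · rw [Finset.disjoint_left]
    intro z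
    have := hθ z
    simp only [Finset.mem_union, Finset.mem_filter]
    rintro ⟨a, b⟩ (c | c)
    · exact c.2.1 a
    · have := this a; omega
  · rw [Finset.disjoint_left]
    intro z
    simp only [Finset.mem_filter]
    rintro ⟨a, b⟩ c
    omega

theorem BKH.counts (h : BKH Q M1 M2 θ) :
    (bk1 Q M1 M2 θ).card + (Q.filter fun z => z ≤ θ ∧ ev M1 z ∈ M2).card
      = M2.card + (Q.filter fun z => z ≤ θ ∧ z ∈ M1).card ∧
    (bk2 Q M1 M2 θ).card + (Q.filter fun z => z ≤ θ ∧ z ∈ M1).card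
      = M1.card + (Q.filter fun z => z ≤ θ ∧ ev M1 z ∈ M2).card := by
  classical
  have hF : Fr Q M1 M2 θ ⊆ Q := Finset.filter_subset _ _
  have hθ : ∀ z ∈ Fr Q M1 M2 θ, θ < z := fun z hz => (mem_Fr.1 hz).2.1
  have c1 : M1.card = (Q.filter fun z => z ∈ M1).card := by
    congr 1; ext z; simp only [Finset.mem_filter]; exact ⟨fun a => ⟨h.s1 a, a⟩, fun a => a.2⟩
  have c1' : (bk1 Q M1 M2 θ).card = (Q.filter fun z => z ∈ bk1 Q M1 M2 θ).card := by
    congr 1; ext z; simp only [Finset.mem_filter]; exact ⟨fun a => ⟨bk1_sub a, a⟩, fun a => a.2⟩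
  have c2' : (bk2 Q M1 M2 θ).card = (Q.filter fun z => z ∈ bkB Q M1 M2 θ).card := by
    rw [bk2, Finset.card_image_of_injOn]
    · congr 1; ext z; simp only [Finset.mem_filter]; exact ⟨fun a => ⟨bkB_sub a, a⟩, fun a => a.2⟩
    · exact h.inj1.mono (by exact_mod_cast bkB_sub)
  rw [h.card_M2, c1, c1', c2', split_card Q _ hF θ hθ, split_card Q _ hF θ hθ (fun z => z ∈ M1),
    split_card Q _ hF θ hθ (fun z => ev M1 z ∈ M2),
    split_card Q _ hF θ hθ (fun z => z ∈ bkB Q M1 M2 θ)]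
  have a1 : ((Fr Q M1 M2 θ).filter fun z => z ∈ bk1 Q M1 M2 θ).card
      = ((Fr Q M1 M2 θ).filter fun z => ev M1 z ∈ M2).card := by
    rw [Finset.filter_congr (fun z hz => mem_bk1_fr hz), card_fr_refl (fun z => z ∉ M1)]
    congr 1
    exact Finset.filter_congr fun z hz => by rw [fr_iff hz, not_not]
  have a2 : ((Fr Q M1 M2 θ).filter fun z => z ∈ bkB Q M1 M2 θ).card
      = ((Fr Q M1 M2 θ).filter fun z => z ∈ M1).card := by
    rw [Finset.filter_congr (fun z hz => mem_bkB_fr hz), card_fr_refl (fun z => z ∈ M1)]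
  have b1 : (Q.filter fun z => z ∉ Fr Q M1 M2 θ ∧ θ < z ∧ z ∈ bk1 Q M1 M2 θ).card
      = (Q.filter fun z => z ∉ Fr Q M1 M2 θ ∧ θ < z ∧ z ∈ M1).card := by
    congr 1
    exact Finset.filter_congr fun z hz => and_congr_right fun f => and_congr_right fun _ =>
      h.mem_bk1_nfr f
  have b2 : (Q.filter fun z => z ∉ Fr Q M1 M2 θ ∧ θ < z ∧ ev M1 z ∈ M2).card
      = (Q.filter fun z => z ∉ Fr Q M1 M2 θ ∧ θ < z ∧ z ∈ M1).card := by
    congr 1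
    exact Finset.filter_congr fun z hz => and_congr_right fun f => and_congr_right fun t =>
      (nfr_iff hz f t).symm
  have b3 : (Q.filter fun z => z ∉ Fr Q M1 M2 θ ∧ θ < z ∧ z ∈ bkB Q M1 M2 θ).card
      = (Q.filter fun z => z ∉ Fr Q M1 M2 θ ∧ θ < z ∧ z ∈ M1).card := by
    congr 1
    exact Finset.filter_congr fun z hz => and_congr_right fun f => and_congr_right fun t =>
      by rw [mem_bkB_nfr hz f, nfr_iff hz f t]
  have d1 : (Q.filter fun z => z ≤ θ ∧ z ∈ bk1 Q M1 M2 θ).card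
      = (Q.filter fun z => z ≤ θ ∧ z ∈ M1).card := by
    congr 1
    exact Finset.filter_congr fun z hz => and_congr_right fun t => h.low1 t
  have d3 : (Q.filter fun z => z ≤ θ ∧ z ∈ bkB Q M1 M2 θ).card
      = (Q.filter fun z => z ≤ θ ∧ ev M1 z ∈ M2).card := by
    congr 1
    exact Finset.filter_congr fun z hz => and_congr_right fun t => by
      rw [← h.low2 hz t, h.mem_bk2 hz]
  rw [a1, a2, b1, b2, b3, d1, d3]
  omega

end


/-- rank from the right -/
def rk (Z : Finset ℤ) (z : ℤ) : ℕ := (Z.filter fun w => z < w).card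

/-- number of movers of rank at least `k` -/
def SS (Z M : Finset ℤ) (k : ℕ) : ℕ := (M.filter fun z => k ≤ rk Z z).card

theorem rk_lt {Z : Finset ℤ} {x y : ℤ} (hy : y ∈ Z) (h : x < y) : rk Z y < rk Z x := by
  unfold rk
  apply Finset.card_lt_card
  rw [Finset.ssubset_iff_of_subset]
  · exact ⟨y, by simp [hy, h], by simp⟩
  · intro w hw
    simp only [Finset.mem_filter] at hw ⊢
    exact ⟨hw.1, by omega⟩

theorem rk_inj {Z : Finset ℤ} {x y : ℤ} (hx : x ∈ Z) (hy : y ∈ Z) (h : rk Z x = rk Z y) : x = y := by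
  rcases lt_trichotomy x y with h' | h' | h'
  · have := rk_lt hy h'; omega
  · exact h'
  · have := rk_lt hx h'; omega

theorem rk_le_iff {Z : Finset ℤ} {x y : ℤ} (hx : x ∈ Z) (hy : y ∈ Z) : rk Z x ≤ rk Z y ↔ y ≤ x := by
  constructor
  · intro h
    by_contra h'
    have := rk_lt hy (show x < y by omega); omega
  · intro h
    rcases h.lt_or_eq with h' | h'
    · exact (rk_lt hx h').le
    · rw [h']

theorem rk_lt_card {Z : Finset ℤ} {x : ℤ} (hx : x ∈ Z) : rk Z x < Z.card := by
  unfold rk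
  apply Finset.card_lt_card
  rw [Finset.ssubset_iff_of_subset (Finset.filter_subset _ _)]
  exact ⟨x, hx, by simp⟩

theorem exists_rk {Z : Finset ℤ} {k : ℕ} (hk : k < Z.card) : ∃ z ∈ Z, rk Z z = k := by
  have h1 : Z.image (rk Z) = Finset.range Z.card := by
    apply Finset.eq_of_subset_of_card_le
    · intro j hj
      obtain ⟨z, hz, rfl⟩ := Finset.mem_image.1 hj
      exact Finset.mem_range.2 (rk_lt_card hz)
    · rw [Finset.card_image_of_injOn, Finset.card_range]
      intro x hx y hy e
      exact rk_inj hx hy e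
  have : k ∈ Z.image (rk Z) := by rw [h1]; exact Finset.mem_range.2 hk
  obtain ⟨z, hz, e⟩ := Finset.mem_image.1 this
  exact ⟨z, hz, e⟩

theorem SS_succ {Z M : Finset ℤ} (hM : M ⊆ Z) {k : ℕ} {θ : ℤ} (hθ : θ ∈ Z) (hk : rk Z θ = k) :
    SS Z M k = SS Z M (k + 1) + if θ ∈ M then 1 else 0 := by
  unfold SS
  have : (M.filter fun z => k ≤ rk Z z) = (M.filter fun z => k + 1 ≤ rk Z z) ∪
      (M.filter fun z => z = θ) := by
    ext z
    simp only [Finset.mem_union, Finset.mem_filter]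
    constructor
    · rintro ⟨a, b⟩
      rcases b.lt_or_eq with h | h
      · left; exact ⟨a, h⟩
      · right; exact ⟨a, rk_inj (hM a) hθ (by rw [hk, h])⟩
    · rintro (⟨a, b⟩ | ⟨a, rfl⟩)
      · exact ⟨a, by omega⟩
      · exact ⟨a, hk.ge⟩
  rw [this, Finset.card_union_of_disjoint]
  · congr 1
    by_cases h : θ ∈ M
    · simp [Finset.filter_eq', h]
    · simp [Finset.filter_eq', h]
  · rw [Finset.disjoint_left]
    intro z h1 h2
    simp only [Finset.mem_filter] at h1 h2
    obtain ⟨_, rfl⟩ := h2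
    omega

theorem SS_large {Z M : Finset ℤ} (hM : M ⊆ Z) {k : ℕ} (hk : Z.card ≤ k) : SS Z M k = 0 := by
  unfold SS
  rw [Finset.card_eq_zero, Finset.filter_eq_empty_iff]
  intro z hz
  have := rk_lt_card (hM hz)
  omega

theorem SS_zero (Z M : Finset ℤ) : SS Z M 0 = M.card := by
  simp [SS]

section
variable {Q A : Finset ℤ} {θ : ℤ}

theorem sep_ev (hi : Set.InjOn (ev A) (Q : Set ℤ)) (h2 : θ ∉ A) {x z : ℤ}
    (hx : x ∈ Q) (hz : z ∈ Q) (hzθ : z ≤ θ) (hxθ : θ < x) : ev A z < ev A x := by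
  have hne : ev A z ≠ ev A x := fun e => by have := hi hz hx e; omega
  rcases hzθ.lt_or_eq with h | h
  · unfold ev at *
    split_ifs at * <;> omega
  · have : ev A z = z := by rw [h]; simp [ev, h2]
    have : x ≤ ev A x := ev_le
    omega

theorem rk_image (hi : Set.InjOn (ev A) (Q : Set ℤ)) (z : ℤ) :
    rk (Q.image (ev A)) z = (Q.filter fun w => z < ev A w).card := by
  unfold rk
  rw [Finset.filter_image, Finset.card_image_of_injOn]
  exact hi.mono (by exact_mod_cast Finset.filter_subset _ _)

theorem rk_low (hi : Set.InjOn (ev A) (Q : Set ℤ)) (h2 : θ ∉ A) {z : ℤ}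
    (hz : z ∈ Q) (hzθ : z ≤ θ) : rk (Q.image (ev A)) (ev A z)
      = rk Q θ + (Q.filter fun w => w ≤ θ ∧ ev A z < ev A w).card := by
  rw [rk_image hi, rk, ← Finset.card_union_of_disjoint]
  · congr 1
    ext w
    simp only [Finset.mem_union, Finset.mem_filter]
    constructor
    · rintro ⟨a, b⟩
      rcases le_or_gt w θ with h | h
      · exact Or.inr ⟨a, h, b⟩
      · exact Or.inl ⟨a, h⟩
    · rintro (⟨a, b⟩ | ⟨a, b, c⟩)
      · exact ⟨a, sep_ev hi h2 a hz hzθ b⟩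
      · exact ⟨a, c⟩
  · rw [Finset.disjoint_left]
    intro w h1 h2
    simp only [Finset.mem_filter] at h1 h2
    omega

theorem rk_high (hi : Set.InjOn (ev A) (Q : Set ℤ)) (h2 : θ ∉ A) {z : ℤ}
    (hz : z ∈ Q) (hzθ : θ < z) : rk (Q.image (ev A)) (ev A z) < rk Q θ := by
  rw [rk_image hi, rk]
  apply Finset.card_lt_card
  rw [Finset.ssubset_iff_of_subset]
  · exact ⟨z, by simp [hz, hzθ], by simp⟩
  · intro w hw
    simp only [Finset.mem_filter] at hw ⊢
    refine ⟨hw.1, ?_⟩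
    by_contra h
    have := sep_ev hi h2 hz hw.1 (by omega) hzθ
    omega

theorem SS_img (hi : Set.InjOn (ev A) (Q : Set ℤ)) (h2 : θ ∉ A)
    {B : Finset ℤ} (hB : B ⊆ Q.image (ev A)) {k : ℕ} (hk : rk Q θ ≤ k) :
    SS (Q.image (ev A)) B k = (Q.filter fun z => z ≤ θ ∧ ev A z ∈ B ∧
      k ≤ rk Q θ + (Q.filter fun w => w ≤ θ ∧ ev A z < ev A w).card).card := by
  unfold SS
  symm
  refine Finset.card_bij (fun z _ => ev A z) ?_ ?_ ?_
  · intro z hz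
    rw [Finset.mem_filter] at hz ⊢
    refine ⟨hz.2.2.1, ?_⟩
    rw [rk_low hi h2 hz.1 hz.2.1]
    exact hz.2.2.2
  · intro x hx y hy e
    exact hi (Finset.mem_filter.1 hx).1 (Finset.mem_filter.1 hy).1 e
  · intro w hw
    rw [Finset.mem_filter] at hw
    obtain ⟨z, hz, rfl⟩ := Finset.mem_image.1 (hB hw.1)
    have hzθ : z ≤ θ := by
      by_contra h
      have := rk_high hi h2 hz (by omega)
      omega
    refine ⟨z, ?_, rfl⟩
    rw [Finset.mem_filter]
    refine ⟨hz, hzθ, hw.1, ?_⟩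
    rw [← rk_low hi h2 hz hzθ]
    exact hw.2

theorem SS_loc (hθ : θ ∈ Q) (hA : A ⊆ Q) {k : ℕ} (hk : rk Q θ ≤ k) :
    SS Q A k = (Q.filter fun z => z ≤ θ ∧ z ∈ A ∧ k ≤ rk Q z).card := by
  unfold SS
  congr 1
  ext z
  simp only [Finset.mem_filter]
  constructor
  · rintro ⟨a, b⟩
    exact ⟨hA a, (rk_le_iff hθ (hA a)).1 (hk.trans b), a, b⟩
  · rintro ⟨_, _, a, b⟩; exact ⟨a, b⟩

end

/-- the particle of rank `k` -/
noncomputable def tht (Q : Finset ℤ) (k : ℕ) : ℤ :=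
  open Classical in if h : ∃ z ∈ Q, rk Q z = k then Classical.choose h else 0

theorem tht_spec {Q : Finset ℤ} {k : ℕ} (hk : k < Q.card) : tht Q k ∈ Q ∧ rk Q (tht Q k) = k := by
  have h := exists_rk hk
  unfold tht
  rw [dif_pos h]
  exact Classical.choose_spec h

section
variable {Q M1 M2 : Finset ℤ} {k : ℕ}

theorem fail_local (s1 : M1 ⊆ Q) (i1 : Set.InjOn (ev M1) (Q : Set ℤ))
    (s2 : M2 ⊆ Q.image (ev M1)) (i2 : Set.InjOn (ev M2) (Q.image (ev M1) : Finset ℤ))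
    (hlt : SS Q M1 k < SS (Q.image (ev M1)) M2 k)
    (hle : SS (Q.image (ev M1)) M2 (k + 1) ≤ SS Q M1 (k + 1)) :
    BKH Q M1 M2 (tht Q k) ∧ tht Q k ∈ Q ∧ rk Q (tht Q k) = k ∧ tht Q k ∉ M1 ∧
    SS (Q.image (ev M1)) M2 k = SS Q M1 k + 1 := by
  have hc : (Q.image (ev M1)).card = Q.card := Finset.card_image_of_injOn i1
  have hk : k < Q.card := by
    by_contra h
    rw [SS_large s2 (by omega)] at hlt
    omega
  obtain ⟨t1, t2⟩ := tht_spec hk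
  obtain ⟨p1, p2⟩ := tht_spec (Q := Q.image (ev M1)) (k := k) (by omega)
  have e1 := SS_succ s1 t1 t2
  have e2 := SS_succ s2 p1 p2
  have hn : tht Q k ∉ M1 := by
    intro h
    rw [if_pos h] at e1
    split_ifs at e2 <;> omega
  rw [if_neg hn] at e1
  have hp : tht (Q.image (ev M1)) k ∈ M2 := by
    by_contra h
    rw [if_neg h] at e2
    omega
  rw [if_pos hp] at e2
  refine ⟨⟨s1, i1, s2, i2, ?_⟩, t1, t2, hn, by omega⟩
  intro y hy h1 h2 h3 h4
  set θ := tht Q k with hθ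
  have hy' : y = θ - 1 := by
    have : y ≠ θ := fun h => hn (h ▸ hy)
    omega
  have ey : ev M1 y = y + 2 := by simp [ev, hy]
  have hr : rk (Q.image (ev M1)) (ev M1 y) = k := by
    rw [rk_low i1 hn (s1 hy) h1, t2]
    simp only [Nat.add_eq_left, Finset.card_eq_zero, Finset.filter_eq_empty_iff]
    rintro w hw ⟨a, b⟩
    rcases a.lt_or_eq with h | h
    · have : ev M1 w ≤ w + 2 := by unfold ev; split_ifs <;> omega
      omega
    · have : ev M1 w = w := by rw [h]; simp [ev, hn]
      omega
  have hm : ev M1 y ∈ M2 := by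
    have := rk_inj p1 (Finset.mem_image_of_mem _ (s1 hy)) (by rw [p2, hr])
    rwa [← this]
  have : ev M2 (ev M1 y) = y + 4 := by
    rw [ev_ev_eq, if_pos hy, if_pos hm]; ring
  have := i1 (s1 hy) h2 (i2 (by exact_mod_cast Finset.mem_image_of_mem _ (s1 hy))
    (by exact_mod_cast Finset.mem_image_of_mem _ h2) (by rw [this, h4]))
  omega

theorem BKH.SS1 {θ : ℤ} (h : BKH Q M1 M2 θ) (hθ : θ ∈ Q) (k : ℕ) (hk : rk Q θ ≤ k) :
    SS Q (bk1 Q M1 M2 θ) k = SS Q M1 k := by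
  rw [SS_loc hθ bk1_sub hk, SS_loc hθ h.s1 hk]
  congr 1
  exact Finset.filter_congr fun z hz => and_congr_right fun t => by rw [h.low1 t]

theorem BKH.SS2 {θ : ℤ} (h : BKH Q M1 M2 θ) (hn : θ ∉ M1) (k : ℕ) (hk : rk Q θ ≤ k) :
    SS (Q.image (ev (bk1 Q M1 M2 θ))) (bk2 Q M1 M2 θ) k = SS (Q.image (ev M1)) M2 k := by
  rw [SS_img h.inj1 (by rw [h.low1 le_rfl]; exact hn) bk2_sub hk, SS_img h.i1 hn h.s2 hk]
  congr 1
  refine Finset.filter_congr fun z hz => and_congr_right fun t => ?_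
  rw [h.low2 hz t, h.low1e t]
  have : (Q.filter fun w => w ≤ θ ∧ ev M1 z < ev (bk1 Q M1 M2 θ) w)
      = (Q.filter fun w => w ≤ θ ∧ ev M1 z < ev M1 w) :=
    Finset.filter_congr fun w hw => and_congr_right fun t => by rw [h.low1e t]
  rw [this]

theorem BKH.counts_fail {θ : ℤ} (h : BKH Q M1 M2 θ) (hθ : θ ∈ Q) (hn : θ ∉ M1)
    (hs : SS (Q.image (ev M1)) M2 (rk Q θ) = SS Q M1 (rk Q θ) + 1) :
    (bk1 Q M1 M2 θ).card + 1 = M2.card ∧ (bk2 Q M1 M2 θ).card = M1.card + 1 := by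
  have c := h.counts
  have a := SS_loc hθ h.s1 le_rfl
  have b := SS_img h.i1 hn h.s2 le_rfl
  have a' : (Q.filter fun z => z ≤ θ ∧ z ∈ M1 ∧ rk Q θ ≤ rk Q z)
      = (Q.filter fun z => z ≤ θ ∧ z ∈ M1) :=
    Finset.filter_congr fun z hz => and_congr_right fun t =>
      and_iff_left ((rk_le_iff hθ hz).2 t)
  rw [a'] at a
  simp only [Nat.le_add_right, and_true] at b
  omega

end


/-- modify two consecutive move sets -/
def modM (M : ℕ → Finset ℤ) (t : ℕ) (A B : Finset ℤ) : ℕ → Finset ℤ :=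
  fun s => if s = t then A else if s = t + 1 then B else M s

theorem modM_t (M : ℕ → Finset ℤ) (t : ℕ) (A B : Finset ℤ) : modM M t A B t = A := by simp [modM]
theorem modM_t1 (M : ℕ → Finset ℤ) (t : ℕ) (A B : Finset ℤ) : modM M t A B (t + 1) = B := by
  simp [modM]
theorem modM_ne (M : ℕ → Finset ℤ) (t : ℕ) (A B : Finset ℤ) (s : ℕ) (h1 : s ≠ t) (h2 : s ≠ t + 1) :
    modM M t A B s = M s := by
  simp [modM, h1, h2]

theorem st_mod_le (Z0 : Finset ℤ) (M : ℕ → Finset ℤ) (t : ℕ) (A B : Finset ℤ) (s : ℕ) (hs : s ≤ t) :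
    st Z0 (modM M t A B) s = st Z0 M s := by
  induction s with
  | zero => rfl
  | succ s ih =>
    rw [st, st, ih (by omega), modM_ne _ _ _ _ _ (by omega) (by omega)]

theorem st_mod_t1 (Z0 : Finset ℤ) (M : ℕ → Finset ℤ) (t : ℕ) (A B : Finset ℤ) :
    st Z0 (modM M t A B) (t + 1) = (st Z0 M t).image (ev A) := by
  rw [st, modM_t, st_mod_le _ _ _ _ _ _ le_rfl]

theorem st_mod_ge (Z0 : Finset ℤ) (M : ℕ → Finset ℤ) (t : ℕ) (A B : Finset ℤ)
    (h : ((st Z0 M t).image (ev A)).image (ev B) = st Z0 M (t + 2)) (s : ℕ) :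
    st Z0 (modM M t A B) (t + 2 + s) = st Z0 M (t + 2 + s) := by
  induction s with
  | zero =>
    simp only [Nat.add_zero]
    rw [← h, st, st_mod_t1, modM_t1]
  | succ s ih =>
    rw [← Nat.add_assoc, st, st, ih, modM_ne _ _ _ _ _ (by omega) (by omega)]

/-- the Bender-Knuth move on configurations -/
noncomputable def bkM (Z0 : Finset ℤ) (M : ℕ → Finset ℤ) (t : ℕ) (θ : ℤ) : ℕ → Finset ℤ :=
  modM M t (bk1 (st Z0 M t) (M t) (M (t + 1)) θ) (bk2 (st Z0 M t) (M t) (M (t + 1)) θ)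

section
variable {n : ℕ} {Z0 : Finset ℤ} {M : ℕ → Finset ℤ} {t : ℕ} {θ : ℤ}

theorem bkM_st (h : BKH (st Z0 M t) (M t) (M (t + 1)) θ) (s : ℕ) (hs : s ≠ t + 1) :
    st Z0 (bkM Z0 M t θ) s = st Z0 M s := by
  rcases Nat.lt_or_ge t s with h1 | h1
  · obtain ⟨r, rfl⟩ := Nat.exists_eq_add_of_le (show t + 2 ≤ s by omega)
    exact st_mod_ge _ _ _ _ _ h.img_eq r
  · exact st_mod_le _ _ _ _ _ _ h1

theorem bkM_valid (hv : Valid n Z0 M) (ht : t + 1 < n)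
    (h : BKH (st Z0 M t) (M t) (M (t + 1)) θ) : Valid n Z0 (bkM Z0 M t θ) := by
  refine ⟨fun s => ?_, fun s => ?_, fun s hs => ?_⟩
  · by_cases h1 : s = t
    · subst h1
      rw [bkM_st h _ (by omega), bkM, modM_t]
      exact bk1_sub
    · by_cases h2 : s = t + 1
      · subst h2
        rw [bkM, st_mod_t1, modM_t1]
        exact bk2_sub
      · rw [bkM_st h _ h2, bkM, modM_ne _ _ _ _ _ h1 h2]
        exact hv.sub s
  · by_cases h1 : s = t
    · subst h1
      rw [bkM_st h _ (by omega), bkM, modM_t]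
      exact h.inj1
    · by_cases h2 : s = t + 1
      · subst h2
        rw [bkM, st_mod_t1, modM_t1]
        exact h.inj2
      · rw [bkM_st h _ h2, bkM, modM_ne _ _ _ _ _ h1 h2]
        exact hv.inj s
  · rw [bkM, modM_ne _ _ _ _ _ (by omega) (by omega)]
    exact hv.triv s hs

theorem bkM_inv (h : BKH (st Z0 M t) (M t) (M (t + 1)) θ) :
    bkM Z0 (bkM Z0 M t θ) t θ = M := by
  funext s
  have e : st Z0 (bkM Z0 M t θ) t = st Z0 M t := bkM_st h _ (by omega)
  have e1 : bkM Z0 M t θ t = bk1 (st Z0 M t) (M t) (M (t + 1)) θ := modM_t _ _ _ _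
  have e2 : bkM Z0 M t θ (t + 1) = bk2 (st Z0 M t) (M t) (M (t + 1)) θ := modM_t1 _ _ _ _
  rw [bkM, e, e1, e2, h.inv1, h.inv2]
  by_cases h1 : s = t
  · subst h1; rw [modM_t]
  · by_cases h2 : s = t + 1
    · subst h2; rw [modM_t1]
    · rw [modM_ne _ _ _ _ _ h1 h2, bkM, modM_ne _ _ _ _ _ h1 h2]

theorem exists_bot (Q : Finset ℤ) : ∃ b : ℤ, ∀ z ∈ Q, b < z := by
  obtain ⟨b, hb⟩ := Q.bddBelow
  exact ⟨b - 1, fun z hz => by have := hb (Finset.mem_coe.2 hz); omega⟩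

/-- a lower bound -/
noncomputable def bot (Q : Finset ℤ) : ℤ := Classical.choose (exists_bot Q)
theorem bot_lt {Q : Finset ℤ} {z : ℤ} (hz : z ∈ Q) : bot Q < z :=
  Classical.choose_spec (exists_bot Q) z hz

theorem bkh_bot (hv : Valid n Z0 M) : BKH (st Z0 M t) (M t) (M (t + 1)) (bot (st Z0 M t)) := by
  refine ⟨hv.sub t, hv.inj t, hv.sub (t + 1), hv.inj (t + 1), fun y hy h => ?_⟩
  have := bot_lt (hv.sub t hy)
  omega

theorem bkh_bot_counts (hv : Valid n Z0 M) :
    (bkM Z0 M t (bot (st Z0 M t)) t).card = (M (t + 1)).card ∧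
    (bkM Z0 M t (bot (st Z0 M t)) (t + 1)).card = (M t).card := by
  have h := (bkh_bot (t := t) hv).counts
  have e : ∀ p : ℤ → Prop, ∀ [DecidablePred p],
      ((st Z0 M t).filter fun z => z ≤ bot (st Z0 M t) ∧ p z).card = 0 := by
    intro p _
    rw [Finset.card_eq_zero, Finset.filter_eq_empty_iff]
    rintro z hz ⟨a, _⟩
    have := bot_lt hz
    omega
  rw [e, e] at h
  rw [bkM, modM_t, modM_t1]
  exact h

theorem prod_swap_ne {R : Type*} [CommRing R] (X : ℕ → R) (w w' : ℕ → ℕ) (t : ℕ) (ht : t + 1 < n)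
    (h1 : w' t = w (t + 1)) (h2 : w' (t + 1) = w t) (h3 : ∀ s, s ≠ t → s ≠ t + 1 → w' s = w s) :
    ∏ s ∈ Finset.range n, X (Equiv.swap t (t + 1) s) ^ w' s = ∏ s ∈ Finset.range n, X s ^ w s := by
  refine Finset.prod_equiv (Equiv.swap t (t + 1)) ?_ ?_
  · intro s
    simp only [Finset.mem_range]
    rw [Equiv.swap_apply_def]
    split_ifs <;> omega
  · intro s _
    congr 1
    by_cases e1 : s = t
    · subst e1; rw [Equiv.swap_apply_left]; exact h1
    · by_cases e2 : s = t + 1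
      · subst e2; rw [Equiv.swap_apply_right]; exact h2
      · rw [Equiv.swap_apply_of_ne_of_ne e1 e2]; exact h3 s e1 e2

theorem CF_swap {R : Type*} [CommRing R] (X : ℕ → R) (Zn : Finset ℤ) (ht : t + 1 < n) :
    CF n (fun s => X (Equiv.swap t (t + 1) s)) Z0 Zn = CF n X Z0 Zn := by
  unfold CF
  have hmem : ∀ M ∈ cfg n Z0 Zn, bkM Z0 M t (bot (st Z0 M t)) ∈ cfg n Z0 Zn := by
    intro M hM
    rw [mem_cfg] at hM ⊢
    have h := bkh_bot (t := t) hM.1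
    exact ⟨bkM_valid hM.1 ht h, by rw [bkM_st h _ (by omega)]; exact hM.2⟩
  have hinv : ∀ M ∈ cfg n Z0 Zn, bkM Z0 (bkM Z0 M t (bot (st Z0 M t))) t
      (bot (st Z0 (bkM Z0 M t (bot (st Z0 M t))) t)) = M := by
    intro M hM
    rw [mem_cfg] at hM
    have h := bkh_bot (t := t) hM.1
    rw [bkM_st h t (by omega), bkM_inv h]
  refine Finset.sum_bij' (fun M _ => bkM Z0 M t (bot (st Z0 M t)))
    (fun M _ => bkM Z0 M t (bot (st Z0 M t))) hmem hmem hinv hinv ?_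
  intro M hM
  rw [mem_cfg] at hM
  have h := bkh_bot_counts (t := t) hM.1
  refine prod_swap_ne X _ _ t ht h.2.symm h.1.symm ?_
  intro s h1 h2
  rw [bkM, modM_ne _ _ _ _ _ h1 h2]

end

/-- Yamanouchi configurations. -/
def Yam (n : ℕ) (Z0 : Finset ℤ) (M : ℕ → Finset ℤ) : Prop :=
  ∀ t, t + 1 < n → ∀ k, SS (st Z0 M (t + 1)) (M (t + 1)) k ≤ SS (st Z0 M t) (M t) k

/-- the first failure of the Yamanouchi condition -/
structure Fail (n : ℕ) (Z0 : Finset ℤ) (M : ℕ → Finset ℤ) (k t : ℕ) : Prop where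
  lt : t + 1 < n
  bad : SS (st Z0 M t) (M t) k < SS (st Z0 M (t + 1)) (M (t + 1)) k
  big : ∀ k', k < k' → ∀ s, s + 1 < n →
    SS (st Z0 M (s + 1)) (M (s + 1)) k' ≤ SS (st Z0 M s) (M s) k'
  small : ∀ s, s < t → SS (st Z0 M (s + 1)) (M (s + 1)) k ≤ SS (st Z0 M s) (M s) k

section
variable {n : ℕ} {Z0 : Finset ℤ} {M : ℕ → Finset ℤ} {k t : ℕ}

theorem Fail.uniq {k' t' : ℕ} (h : Fail n Z0 M k t) (h' : Fail n Z0 M k' t') : k = k' ∧ t = t' := by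
  have hk : k = k' := by
    rcases lt_trichotomy k k' with e | e | e
    · have := h.big _ e _ h'.lt; have := h'.bad; omega
    · exact e
    · have := h'.big _ e _ h.lt; have := h.bad; omega
  subst hk
  refine ⟨rfl, ?_⟩
  rcases lt_trichotomy t t' with e | e | e
  · have := h'.small _ e; have := h.bad; omega
  · exact e
  · have := h.small _ e; have := h'.bad; omega

theorem st_card (hv : Valid n Z0 M) (t : ℕ) : (st Z0 M t).card = Z0.card := by
  induction t with
  | zero => rfl
  | succ t ih => rw [st, Finset.card_image_of_injOn (hv.inj t), ih]

theorem exists_fail (hv : Valid n Z0 M) (hy : ¬ Yam n Z0 M) : ∃ k t, Fail n Z0 M k t := by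
  classical
  let P : ℕ → Prop := fun k => ∃ t, t + 1 < n ∧
    SS (st Z0 M t) (M t) k < SS (st Z0 M (t + 1)) (M (t + 1)) k
  have hb : ∀ k, P k → k ≤ Z0.card := by
    rintro k ⟨t, _, h⟩
    by_contra hk
    rw [SS_large (hv.sub (t + 1)) (by rw [st_card hv]; omega)] at h
    omega
  have hex : ∃ k, P k := by
    unfold Yam at hy
    push Not at hy
    obtain ⟨t, ht, k, hk⟩ := hy
    exact ⟨k, t, ht, hk⟩
  obtain ⟨k0, hk0⟩ := hex
  let k := Nat.findGreatest P Z0.card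
  have hk : P k := Nat.findGreatest_spec (hb k0 hk0) hk0
  have hk' : ∀ k', k < k' → ¬ P k' := by
    intro k' h1 h2
    have := Nat.le_findGreatest (hb k' h2) h2
    omega
  have hk2 : ∃ t, t + 1 < n ∧
    SS (st Z0 M t) (M t) k < SS (st Z0 M (t + 1)) (M (t + 1)) k := hk
  obtain ⟨f1, f2⟩ := Nat.find_spec hk2
  refine ⟨k, Nat.find hk2, f1, f2, ?_, ?_⟩
  · intro k' h1 s hs
    by_contra h
    exact hk' k' h1 ⟨s, hs, by omega⟩
  · intro s hs
    have := Nat.find_min hk2 hs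
    by_contra h
    exact this ⟨by omega, by omega⟩

theorem Fail.loc (h : Fail n Z0 M k t) (hv : Valid n Z0 M) :
    BKH (st Z0 M t) (M t) (M (t + 1)) (tht (st Z0 M t) k) ∧ tht (st Z0 M t) k ∈ st Z0 M t ∧
    rk (st Z0 M t) (tht (st Z0 M t) k) = k ∧ tht (st Z0 M t) k ∉ M t ∧
    SS (st Z0 M (t + 1)) (M (t + 1)) k = SS (st Z0 M t) (M t) k + 1 :=
  fail_local (hv.sub t) (hv.inj t) (hv.sub (t + 1)) (hv.inj (t + 1)) h.bad
    (h.big (k + 1) (by omega) t h.lt)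

theorem Fail.SSeq (h : Fail n Z0 M k t) (hv : Valid n Z0 M) (k' : ℕ) (hk : k ≤ k') (s : ℕ) :
    SS (st Z0 (bkM Z0 M t (tht (st Z0 M t) k)) s) (bkM Z0 M t (tht (st Z0 M t) k) s) k'
      = SS (st Z0 M s) (M s) k' := by
  obtain ⟨hb, h1, h2, h3, h4⟩ := h.loc hv
  by_cases e1 : s = t
  · subst e1
    rw [bkM_st hb _ (by omega), bkM, modM_t]
    exact hb.SS1 h1 k' (by omega)
  · by_cases e2 : s = t + 1
    · subst e2
      rw [bkM, st_mod_t1, modM_t1]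
      exact hb.SS2 h3 k' (by omega)
    · rw [bkM_st hb _ e2, bkM, modM_ne _ _ _ _ _ e1 e2]

theorem Fail.fail (h : Fail n Z0 M k t) (hv : Valid n Z0 M) :
    Fail n Z0 (bkM Z0 M t (tht (st Z0 M t) k)) k t := by
  refine ⟨h.lt, ?_, ?_, ?_⟩
  · rw [h.SSeq hv _ le_rfl, h.SSeq hv _ le_rfl]; exact h.bad
  · intro k' hk s hs
    rw [h.SSeq hv _ hk.le, h.SSeq hv _ hk.le]; exact h.big k' hk s hs
  · intro s hs
    rw [h.SSeq hv _ le_rfl, h.SSeq hv _ le_rfl]; exact h.small s hs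

theorem Fail.counts (h : Fail n Z0 M k t) (hv : Valid n Z0 M) :
    (bkM Z0 M t (tht (st Z0 M t) k) t).card + 1 = (M (t + 1)).card ∧
    (bkM Z0 M t (tht (st Z0 M t) k) (t + 1)).card = (M t).card + 1 := by
  obtain ⟨hb, h1, h2, h3, h4⟩ := h.loc hv
  rw [bkM, modM_t, modM_t1]
  refine hb.counts_fail h1 h3 ?_
  rw [h2]; exact h4

open Classical in
/-- the sign reversing involution -/
noncomputable def inv (n : ℕ) (Z0 : Finset ℤ) (M : ℕ → Finset ℤ) : ℕ → Finset ℤ :=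
  if h : ∃ p : ℕ × ℕ, Fail n Z0 M p.1 p.2 then
    bkM Z0 M (Classical.choose h).2 (tht (st Z0 M (Classical.choose h).2) (Classical.choose h).1)
  else M

theorem Fail.inv_eq (h : Fail n Z0 M k t) : inv n Z0 M = bkM Z0 M t (tht (st Z0 M t) k) := by
  have hex : ∃ p : ℕ × ℕ, Fail n Z0 M p.1 p.2 := ⟨(k, t), h⟩
  unfold inv
  rw [dif_pos hex]
  obtain ⟨e1, e2⟩ := h.uniq (Classical.choose_spec hex)
  rw [← e1, ← e2]

theorem Fail.not_yam (h : Fail n Z0 M k t) : ¬ Yam n Z0 M := by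
  intro hy
  have := hy t h.lt k
  have := h.bad
  omega

theorem Fail.inv_inv (h : Fail n Z0 M k t) (hv : Valid n Z0 M) : inv n Z0 (inv n Z0 M) = M := by
  rw [h.inv_eq, (h.fail hv).inv_eq]
  obtain ⟨hb, -⟩ := h.loc hv
  rw [bkM_st hb t (by omega), bkM_inv hb]

end


/-- extend variables to all natural indices -/
def xt {R : Type*} [CommRing R] {N : ℕ} (x : Fin N → R) : ℕ → R :=
  fun t => if h : t < N then x ⟨t, h⟩ else 0

/-- alternant -/
def alt {R : Type*} [CommRing R] {N : ℕ} (x : Fin N → R) (α : ℕ → ℕ) : R :=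
  Matrix.det (Matrix.of fun i l : Fin N => x i ^ α l)

section
variable {R : Type*} [CommRing R]

theorem xt_lt {N : ℕ} (x : Fin N → R) (i : Fin N) : xt x i = x i := by simp [xt]

theorem CF_congr (n : ℕ) (X Y : ℕ → R) (h : ∀ t < n, X t = Y t) (Z0 Zn : Finset ℤ) :
    CF n X Z0 Zn = CF n Y Z0 Zn := by
  unfold CF
  refine Finset.sum_congr rfl fun M _ => Finset.prod_congr rfl fun t ht => ?_
  rw [h t (Finset.mem_range.1 ht)]

theorem CF_perm {N : ℕ} (x : Fin N → R) (w : Equiv.Perm (Fin N)) (Z0 Zn : Finset ℤ) :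
    CF N (xt (x ∘ w)) Z0 Zn = CF N (xt x) Z0 Zn := by
  cases N with
  | zero => exact CF_congr _ _ _ (fun t ht => by omega) _ _
  | succ n =>
    have hw : w ∈ Submonoid.closure (Set.range fun i : Fin n => Equiv.swap i.castSucc i.succ) := by
      rw [Equiv.Perm.mclosure_swap_castSucc_succ]; trivial
    induction hw using Submonoid.closure_induction generalizing x with
    | mem w hw =>
      obtain ⟨i, rfl⟩ := hw
      rw [← CF_swap (t := i) (xt x) Zn (by omega)]
      refine CF_congr _ _ _ (fun t ht => ?_) _ _
      simp only [xt, ht, dif_pos, Function.comp]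
      have hlt : Equiv.swap (i : ℕ) (i + 1) t < n + 1 := by
        rw [Equiv.swap_apply_def]
        split_ifs <;> omega
      rw [dif_pos hlt]
      congr 1
      ext
      simp only [Equiv.swap_apply_def, Fin.ext_iff, Fin.val_castSucc, Fin.val_succ]
      split_ifs <;> simp
    | one => rfl
    | mul a b _ _ ha hb =>
      have : x ∘ ⇑(a * b) = (x ∘ a) ∘ b := rfl
      rw [this, hb, ha]

theorem alt_mul_CF {N : ℕ} (x : Fin N → R) (δ : ℕ → ℕ) (Z0 Zn : Finset ℤ) :
    alt x δ * CF N (xt x) Z0 Zn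
      = ∑ M ∈ cfg N Z0 Zn, alt x (fun l => (M l).card + δ l) := by
  unfold alt
  simp only [Matrix.det_apply', Finset.sum_mul, Matrix.of_apply]
  rw [Finset.sum_comm]
  refine Finset.sum_congr rfl fun w _ => ?_
  rw [← CF_perm x w, CF, Finset.mul_sum]
  refine Finset.sum_congr rfl fun M _ => ?_
  rw [mul_assoc, Finset.prod_range, ← Finset.prod_mul_distrib]
  congr 1
  refine Finset.prod_congr rfl fun i _ => ?_
  rw [xt_lt, Function.comp, pow_add, mul_comm]

open Classical in
theorem alt_mul_CF_yam {N : ℕ} (x : Fin N → R) (Z0 Zn : Finset ℤ) :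
    alt x (fun l => N - 1 - l) * CF N (xt x) Z0 Zn
      = ∑ M ∈ (cfg N Z0 Zn).filter (Yam N Z0), alt x (fun l => (M l).card + (N - 1 - l)) := by
  rw [alt_mul_CF, ← Finset.sum_filter_add_sum_filter_not (cfg N Z0 Zn) (Yam N Z0)]
  rw [add_eq_left]
  have key : ∀ M ∈ (cfg N Z0 Zn).filter (fun M => ¬ Yam N Z0 M), ∃ k t, Fail N Z0 M k t ∧
      Valid N Z0 M := by
    intro M hM
    rw [Finset.mem_filter, mem_cfg] at hM
    obtain ⟨k, t, h⟩ := exists_fail hM.1.1 hM.2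
    exact ⟨k, t, h, hM.1.1⟩
  have hexp : ∀ M k t, Fail N Z0 M k t → Valid N Z0 M → ∀ l,
      (inv N Z0 M l).card + (N - 1 - l) =
        (M (Equiv.swap t (t + 1) l)).card + (N - 1 - (Equiv.swap t (t + 1) l)) := by
    intro M k t h hv l
    have hc := h.counts hv
    have hlt := h.lt
    rw [h.inv_eq]
    by_cases e1 : l = t
    · subst e1; rw [Equiv.swap_apply_left]; omega
    · by_cases e2 : l = t + 1
      · subst e2; rw [Equiv.swap_apply_right]; omega
      · rw [Equiv.swap_apply_of_ne_of_ne e1 e2, bkM, modM_ne _ _ _ _ _ e1 e2]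
  refine Finset.sum_involution (fun M _ => inv N Z0 M) ?_ ?_ ?_ ?_
  · intro M hM
    obtain ⟨k, t, h, hv⟩ := key M hM
    have hlt := h.lt
    have e : alt x (fun l => (inv N Z0 M l).card + (N - 1 - l))
        = - alt x (fun l => (M l).card + (N - 1 - l)) := by
      unfold alt
      let τ : Equiv.Perm (Fin N) := Equiv.swap ⟨t, by omega⟩ ⟨t + 1, hlt⟩
      have hτ : ∀ l : Fin N, ((τ l : Fin N) : ℕ) = Equiv.swap t (t + 1) (l : ℕ) := by
        intro l
        simp only [τ, Equiv.swap_apply_def, Fin.ext_iff]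
        split_ifs <;> rfl
      have hm : (Matrix.of fun i l : Fin N => x i ^ ((inv N Z0 M l).card + (N - 1 - l)))
          = (Matrix.of fun i l : Fin N => x i ^ ((M l).card + (N - 1 - l))).submatrix id τ := by
        ext i l
        simp only [Matrix.of_apply, Matrix.submatrix_apply, id]
        rw [hexp M k t h hv l, hτ]
      rw [hm, Matrix.det_permute', Equiv.Perm.sign_swap (by simp [Fin.ext_iff])]
      simp
    rw [e]; ring
  · intro M hM hne heq
    obtain ⟨k, t, h, hv⟩ := key M hM
    have hlt := h.lt
    have e := hexp M k t h hv t
    rw [heq, Equiv.swap_apply_left] at e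
    apply hne
    unfold alt
    refine Matrix.det_zero_of_column_eq (i := ⟨t, by omega⟩) (j := ⟨t + 1, hlt⟩)
      (by simp [Fin.ext_iff]) ?_
    intro i
    simp only [Matrix.of_apply]
    rw [e]
  · intro M hM
    obtain ⟨k, t, h, hv⟩ := key M hM
    rw [Finset.mem_filter, mem_cfg] at hM ⊢
    rw [h.inv_eq]
    obtain ⟨hb, -⟩ := h.loc hv
    have := h.lt
    refine ⟨⟨bkM_valid hv h.lt hb, ?_⟩, (h.fail hv).not_yam⟩
    rw [bkM_st hb _ (by omega)]
    exact hM.1.2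
  · intro M hM
    obtain ⟨k, t, h, hv⟩ := key M hM
    exact h.inv_inv hv

end


section
variable {R : Type*} [CommRing R]

/-- complete homogeneous sums -/
def hs (σ : Type*) [Fintype σ] [DecidableEq σ] (x : σ → R) (n : ℕ) : R :=
  ∑ s : Sym σ n, (s.1.map x).prod

theorem hs_equiv {σ τ : Type*} [Fintype σ] [DecidableEq σ] [Fintype τ] [DecidableEq τ]
    (e : σ ≃ τ) (x : τ → R) (n : ℕ) : hs σ (x ∘ e) n = hs τ x n := by
  unfold hs
  refine Fintype.sum_equiv (Sym.equivCongr e) _ _ ?_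
  intro s
  simp [Sym.equivCongr, Sym.map, Multiset.map_map]

theorem hs_option {σ : Type*} [Fintype σ] [DecidableEq σ] (x : Option σ → R) (n : ℕ) :
    hs (Option σ) x (n + 1) = hs σ (fun i => x (some i)) (n + 1) + x none * hs (Option σ) x n := by
  unfold hs
  rw [← Equiv.sum_comp (Equiv.symm (symOptionSuccEquiv : Sym (Option σ) n.succ ≃ _)),
    Fintype.sum_sum_type, add_comm, Finset.mul_sum]
  congr 1
  · refine Finset.sum_congr rfl fun s _ => ?_
    change ((SymOptionSuccEquiv.decode (Sum.inr s)).1.map x).prod = _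
    simp [SymOptionSuccEquiv.decode, Sym.map, Multiset.map_map]
  · refine Finset.sum_congr rfl fun s _ => ?_
    change ((none ::ₘ s.1).map x).prod = _
    simp

/-- complete homogeneous functions with integer index -/
def HH {N : ℕ} (x : Fin N → R) (m : ℤ) : R := if 0 ≤ m then hs (Fin N) x m.toNat else 0

theorem homog_eq (N : ℕ) (m : ℤ) : homog N m = HH (fun i : Fin N => (MvPolynomial.X i : MvPolynomial (Fin N) ℤ)) m := by
  unfold homog HH
  split_ifs
  · rfl
  · rfl

theorem HH_perm {N : ℕ} (x : Fin N → R) (w : Equiv.Perm (Fin N)) (m : ℤ) :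
    HH (x ∘ w) m = HH x m := by
  unfold HH; rw [hs_equiv w x]

theorem HH_neg {N : ℕ} (x : Fin N → R) (m : ℤ) (h : m < 0) : HH x m = 0 := by
  unfold HH; rw [if_neg (by omega)]

theorem HH_zero {N : ℕ} (x : Fin N → R) : HH x 0 = 1 := by
  unfold HH
  rw [if_pos le_rfl]
  change hs (Fin N) x 0 = 1
  unfold hs
  rw [Fintype.sum_eq_single Sym.nil (fun s hs => absurd (Sym.eq_nil_of_card_zero s) hs)]
  change (Multiset.map x 0).prod = 1
  simp

/-- first `n` variables of a sequence -/
def Hn (n : ℕ) (X : ℕ → R) (m : ℤ) : R := HH (fun i : Fin n => X i) m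

theorem Hn_zero (X : ℕ → R) (m : ℤ) : Hn 0 X m = if m = 0 then 1 else 0 := by
  unfold Hn
  split_ifs with h
  · rw [h, HH_zero]
  · rcases lt_or_gt_of_ne h with h' | h'
    · exact HH_neg _ _ h'
    · unfold HH
      rw [if_pos h'.le]
      obtain ⟨k, hk⟩ : ∃ k, m.toNat = k + 1 := ⟨m.toNat - 1, by omega⟩
      rw [hk, hs]
      have : IsEmpty (Sym (Fin 0) (k + 1)) := by infer_instance
      exact Finset.sum_of_isEmpty _

theorem Hn_succ (n : ℕ) (X : ℕ → R) (m : ℤ) :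
    Hn (n + 1) X m = Hn n (fun t => X (t + 1)) m + X 0 * Hn (n + 1) X (m - 1) := by
  unfold Hn
  rcases lt_trichotomy m 0 with h | h | h
  · rw [HH_neg _ _ h, HH_neg _ _ h, HH_neg _ _ (by omega)]; ring
  · subst h
    rw [HH_zero, HH_zero, HH_neg _ _ (by omega)]; ring
  · unfold HH
    rw [if_pos h.le, if_pos h.le, if_pos (by omega)]
    obtain ⟨k, hk⟩ : ∃ k : ℕ, m = k + 1 := ⟨(m - 1).toNat, by omega⟩
    subst hk
    have e1 : ((k : ℤ) + 1).toNat = k + 1 := by omega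
    have e2 : ((k : ℤ) + 1 - 1).toNat = k := by omega
    rw [e1, e2]
    let y : Option (Fin n) → R := fun o => X ((finSuccEquiv n).symm o)
    have hy : (fun i : Fin (n + 1) => X i) = y ∘ (finSuccEquiv n) := by
      funext i; simp [y]
    rw [hy, hs_equiv, hs_equiv, hs_option]
    simp [y]

theorem exists_coef (n : ℕ) (X : ℕ → R) : ∃ c : ℕ → R, ∀ m : ℕ,
    X n ^ m = ∑ s ∈ Finset.range (n + 1), c s * Hn (n + 1) X ((m : ℤ) - s) := by
  induction n generalizing X with
  | zero =>
    refine ⟨fun _ => 1, fun m => ?_⟩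
    simp only [zero_add, Finset.sum_range_one, one_mul, Nat.cast_zero, sub_zero]
    induction m with
    | zero => rw [Hn]; simp [HH_zero]
    | succ m ih =>
      rw [Hn_succ, Hn_zero, if_neg (by omega), pow_succ, ih, zero_add, mul_comm]
      congr 2
      push_cast; ring
  | succ n ih =>
    obtain ⟨c, hc⟩ := ih (fun t => X (t + 1))
    refine ⟨fun s => (if s ≤ n then c s else 0) - X 0 * (if 0 < s then c (s - 1) else 0), fun m => ?_⟩
    rw [hc m]
    have : ∀ s ∈ Finset.range (n + 1), c s * Hn (n + 1) (fun t => X (t + 1)) ((m : ℤ) - s)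
        = c s * Hn (n + 2) X ((m : ℤ) - s) - X 0 * c s * Hn (n + 2) X ((m : ℤ) - (s + 1 : ℕ)) := by
      intro s _
      have := Hn_succ (n + 1) X ((m : ℤ) - s)
      rw [this]
      push_cast
      rw [sub_add_eq_sub_sub]
      ring
    rw [Finset.sum_congr rfl this, Finset.sum_sub_distrib]
    simp only [sub_mul]
    rw [Finset.sum_sub_distrib]
    congr 1
    · rw [Finset.sum_range_succ _ (n + 1)]
      rw [if_neg (by omega), zero_mul, add_zero]
      refine Finset.sum_congr rfl fun s hs => ?_
      rw [Finset.mem_range] at hs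
      rw [if_pos (by omega)]
    · rw [Finset.sum_range_succ' _ (n + 1)]
      simp

theorem exists_coef_fin {N : ℕ} (x : Fin N → R) (i : Fin N) : ∃ c : ℕ → R, ∀ m : ℕ,
    x i ^ m = ∑ s ∈ Finset.range N, c s * HH x ((m : ℤ) - s) := by
  cases N with
  | zero => exact i.elim0
  | succ n =>
    obtain ⟨c, hc⟩ := exists_coef n (xt (x ∘ Equiv.swap i (Fin.last n)))
    refine ⟨c, fun m => ?_⟩
    have e : ∀ m, Hn (n + 1) (xt (x ∘ Equiv.swap i (Fin.last n))) m = HH x m := by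
      intro m
      unfold Hn
      simp only [xt_lt]
      exact HH_perm x _ m
    have hx : xt (x ∘ Equiv.swap i (Fin.last n)) n = x i := by
      have := xt_lt (x ∘ Equiv.swap i (Fin.last n)) (Fin.last n)
      simpa using this
    rw [← hx, hc m]
    simp only [e]

/-- Jacobi-Trudi matrix for straight shapes -/
def JT {N : ℕ} (x : Fin N → R) (κ : ℕ → ℕ) : Matrix (Fin N) (Fin N) R :=
  Matrix.of fun i j : Fin N => HH x ((κ i : ℤ) - (i : ℤ) + (j : ℤ))

theorem JT_zero_det {N : ℕ} (x : Fin N → R) : (JT x (fun _ => 0)).det = 1 := by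
  rw [Matrix.det_of_isUpperTriangular]
  · refine Finset.prod_eq_one fun i _ => ?_
    simp [JT, HH_zero]
  · intro i j hij
    simp only [id] at hij
    simp only [JT, Matrix.of_apply]
    apply HH_neg
    have : (j : ℕ) < i := hij
    push_cast
    omega

theorem bialternant {N : ℕ} (x : Fin N → R) (κ : ℕ → ℕ) :
    alt x (fun l => κ l + (N - 1 - l)) = alt x (fun l => N - 1 - l) * (JT x κ).det := by
  choose c hc using exists_coef_fin x
  let C : Matrix (Fin N) (Fin N) R := Matrix.of fun i j => c i (N - 1 - j)
  have key : ∀ κ : ℕ → ℕ, alt x (fun l => κ l + (N - 1 - l)) = C.det * (JT x κ).det := by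
    intro κ
    rw [← Matrix.det_transpose (JT x κ), ← Matrix.det_mul]
    unfold alt
    congr 1
    ext i l
    rw [Matrix.of_apply, hc, Matrix.mul_apply, Finset.sum_range, ← Equiv.sum_comp Fin.revPerm]
    refine Finset.sum_congr rfl fun j _ => ?_
    simp only [C, JT, Matrix.of_apply, Matrix.transpose_apply, Fin.revPerm_apply, Fin.val_rev]
    have hj := j.2
    have hl := l.2
    congr 2
    · omega
    · omega
  have k0 := key (fun _ => 0)
  simp only [zero_add, JT_zero_det, mul_one] at k0
  rw [key, k0]

end

theorem skewSchur_eq_JT (N : ℕ) (κ : ℕ → ℕ) :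
    skewSchur N N κ (fun _ => 0)
      = (JT (fun i : Fin N => (MvPolynomial.X i : MvPolynomial (Fin N) ℤ)) κ).det := by
  unfold skewSchur JT
  congr 1

/-- the variables -/
noncomputable def xv (N : ℕ) : Fin N → MvPolynomial (Fin N) ℤ := fun i => MvPolynomial.X i

theorem alt_ne_zero (N : ℕ) : alt (xv N) (fun l => N - 1 - l) ≠ 0 := by
  have h : (Matrix.of fun i l : Fin N => xv N i ^ (N - 1 - (l : ℕ)))
      = (Matrix.vandermonde (xv N)).submatrix id Fin.revPerm := by
    ext i l : 2
    simp only [Matrix.of_apply, Matrix.submatrix_apply, Matrix.vandermonde_apply, id,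
      Fin.revPerm_apply, Fin.val_rev]
    have := l.2
    rw [show N - 1 - (l : ℕ) = N - (l + 1) by omega]
  unfold alt
  rw [h, Matrix.det_permute']
  refine mul_ne_zero ?_ ?_
  · have := (Equiv.Perm.sign (Fin.revPerm (n := N))).ne_zero
    exact_mod_cast this
  · rw [Matrix.det_vandermonde_ne_zero_iff]
    exact MvPolynomial.X_injective

open Classical in
theorem CF_eq_schur (N : ℕ) (Z0 Zn : Finset ℤ) :
    CF N (xt (xv N)) Z0 Zn = ∑ M ∈ (cfg N Z0 Zn).filter (Yam N Z0),
      skewSchur N N (fun l => (M l).card) (fun _ => 0) := by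
  apply mul_left_cancel₀ (alt_ne_zero N)
  rw [alt_mul_CF_yam, Finset.mul_sum]
  refine Finset.sum_congr rfl fun M _ => ?_
  rw [bialternant (xv N) (fun l => (M l).card), skewSchur_eq_JT]
  rfl

theorem isn_zero (N : ℕ) : IsSchurNonneg N 0 :=
  ⟨0, fun _ => 0, fun _ => 0, fun _ _ => 0, fun i => i.elim0, fun i => i.elim0, by simp⟩

theorem isn_add {N : ℕ} {f g : MvPolynomial (Fin N) ℤ} (hf : IsSchurNonneg N f)
    (hg : IsSchurNonneg N g) : IsSchurNonneg N (f + g) := by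
  obtain ⟨m, c, k, l, h1, h2, h3⟩ := hf
  obtain ⟨m', c', k', l', h1', h2', h3'⟩ := hg
  refine ⟨m + m', Fin.append c c', Fin.append k k', Fin.append l l', ?_, ?_, ?_⟩
  · intro i
    refine Fin.addCases (fun i => ?_) (fun i => ?_) i
    · rw [Fin.append_left]; exact h1 i
    · rw [Fin.append_right]; exact h1' i
  · intro i
    refine Fin.addCases (fun i => ?_) (fun i => ?_) i
    · rw [Fin.append_left, Fin.append_left]; exact h2 i
    · rw [Fin.append_right, Fin.append_right]; exact h2' i
  · rw [Fin.sum_univ_add, h3, h3']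
    simp only [Fin.append_left, Fin.append_right]

theorem isn_sum {N : ℕ} {ι : Type*} (s : Finset ι) (f : ι → MvPolynomial (Fin N) ℤ)
    (h : ∀ i ∈ s, IsSchurNonneg N (f i)) : IsSchurNonneg N (∑ i ∈ s, f i) := by
  classical
  induction s using Finset.induction_on with
  | empty => simpa using isn_zero N
  | insert a s ha ih =>
    rw [Finset.sum_insert ha]
    exact isn_add (h a (Finset.mem_insert_self _ _))
      (ih fun i hi => h i (Finset.mem_insert_of_mem hi))

theorem isn_schur (N k : ℕ) (κ : ℕ → ℕ) (h1 : Antitone κ) (h2 : ∀ j, k ≤ j → κ j = 0) :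
    IsSchurNonneg N (skewSchur N k κ (fun _ => 0)) :=
  ⟨1, fun _ => 1, fun _ => k, fun _ => κ, fun _ => h1, fun _ => h2, by simp⟩

theorem isn_yam {N : ℕ} {Z0 : Finset ℤ} {M : ℕ → Finset ℤ} (hv : Valid N Z0 M) (hy : Yam N Z0 M) :
    IsSchurNonneg N (skewSchur N N (fun l => (M l).card) (fun _ => 0)) := by
  refine isn_schur N N _ ?_ ?_
  · refine antitone_nat_of_succ_le fun t => ?_
    by_cases h : t + 1 < N
    · have := hy t h 0
      rwa [SS_zero, SS_zero] at this
    · rw [hv.triv (t + 1) (by omega)]; simp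
  · intro j hj
    rw [hv.triv j hj]; simp

open Classical in
/-- The comparison principle: an injection of Yamanouchi configurations preserving weights. -/
theorem CF_compare (N : ℕ) (Z0 Zn Z0' Zn' : Finset ℤ) (φ : (ℕ → Finset ℤ) → (ℕ → Finset ℤ))
    (hφ : ∀ M, Valid N Z0 M → st Z0 M N = Zn → Yam N Z0 M →
      Valid N Z0' (φ M) ∧ st Z0' (φ M) N = Zn' ∧ Yam N Z0' (φ M) ∧ ∀ t, (φ M t).card = (M t).card)
    (hinj : ∀ M M', Valid N Z0 M → st Z0 M N = Zn → Valid N Z0 M' → st Z0 M' N = Zn →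
      φ M = φ M' → M = M') :
    IsSchurNonneg N (CF N (xt (xv N)) Z0' Zn' - CF N (xt (xv N)) Z0 Zn) := by
  rw [CF_eq_schur, CF_eq_schur]
  have e : ∑ M ∈ (cfg N Z0 Zn).filter (Yam N Z0), skewSchur N N (fun l => (M l).card) (fun _ => 0)
      = ∑ M ∈ ((cfg N Z0 Zn).filter (Yam N Z0)).image φ,
        skewSchur N N (fun l => (M l).card) (fun _ => 0) := by
    rw [Finset.sum_image]
    · refine Finset.sum_congr rfl fun M hM => ?_
      rw [Finset.mem_filter, mem_cfg] at hM
      have := (hφ M hM.1.1 hM.1.2 hM.2).2.2.2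
      simp only [this]
    · intro M hM M' hM' h
      simp only [Finset.coe_filter, Set.mem_ofPred_eq, mem_cfg] at hM hM'
      exact hinj M M' hM.1.1 hM.1.2 hM'.1.1 hM'.1.2 h
  have hsub : ((cfg N Z0 Zn).filter (Yam N Z0)).image φ ⊆ (cfg N Z0' Zn').filter (Yam N Z0') := by
    intro M' hM'
    obtain ⟨M, hM, rfl⟩ := Finset.mem_image.1 hM'
    rw [Finset.mem_filter, mem_cfg] at hM ⊢
    obtain ⟨a, b, c, _⟩ := hφ M hM.1.1 hM.1.2 hM.2
    exact ⟨⟨a, b⟩, c⟩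
  rw [e, ← Finset.sum_sdiff hsub, add_sub_cancel_right]
  refine isn_sum _ _ fun M hM => ?_
  rw [Finset.mem_sdiff, Finset.mem_filter, mem_cfg] at hM
  exact isn_yam hM.1.1.1 hM.1.2


/-- the other particle position on the same site -/
def bar (z : ℤ) : ℤ := 4 * (z / 2) + 1 - z

theorem bar_bar (z : ℤ) : bar (bar z) = z := by unfold bar; omega
theorem bar_div (z : ℤ) : bar z / 2 = z / 2 := by unfold bar; omega
theorem bar_add (z : ℤ) : bar (z + 2) = bar z + 2 := by unfold bar; omega
theorem bar_ne (z : ℤ) : bar z ≠ z := by unfold bar; omega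
theorem site_cases {z w : ℤ} (h : z / 2 = w / 2) : w = z ∨ w = bar z := by unfold bar; omega

open Classical in
/-- flip the particles satisfying `G` -/
noncomputable def fl (G : ℤ → Prop) (z : ℤ) : ℤ := if G z then bar z else z

theorem fl_div (G : ℤ → Prop) (z : ℤ) : fl G z / 2 = z / 2 := by
  unfold fl; split_ifs
  · exact bar_div z
  · rfl

/-- coherence on double sites -/
def Coh (Z : Finset ℤ) (G : ℤ → Prop) : Prop := ∀ w ∈ Z, bar w ∈ Z → (G w ↔ G (bar w))

theorem fl_pos {G : ℤ → Prop} {z : ℤ} (h : G z) : fl G z = bar z := by simp [fl, h]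
theorem fl_neg {G : ℤ → Prop} {z : ℤ} (h : ¬ G z) : fl G z = z := by simp [fl, h]

theorem fl_injOn {Z : Finset ℤ} {G : ℤ → Prop} (h : Coh Z G) : Set.InjOn (fl G) (Z : Set ℤ) := by
  intro x hx y hy e
  have hs : x / 2 = y / 2 := by rw [← fl_div G x, e, fl_div]
  rcases site_cases hs with rfl | rfl
  · rfl
  · exfalso
    have hc := h x hx hy
    by_cases g : G x
    · rw [fl_pos g, fl_pos (hc.1 g), bar_bar] at e
      exact bar_ne x e
    · rw [fl_neg g, fl_neg (fun h' => g (hc.2 h'))] at e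
      exact bar_ne x e.symm

theorem fl_image_sub {Z : Finset ℤ} {G G' : ℤ → Prop} (h' : Coh Z G')
    (hs : ∀ w ∈ Z, bar w ∉ Z → (G w ↔ G' w)) : Z.image (fl G) ⊆ Z.image (fl G') := by
  intro v hv
  obtain ⟨w, hw, rfl⟩ := Finset.mem_image.1 hv
  by_cases hb : bar w ∈ Z
  · have hc := h' w hw hb
    have : w ∈ Z.image (fl G') ∧ bar w ∈ Z.image (fl G') := by
      by_cases g : G' w
      · exact ⟨Finset.mem_image.2 ⟨bar w, hb, by rw [fl_pos (hc.1 g), bar_bar]⟩,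
          Finset.mem_image.2 ⟨w, hw, fl_pos g⟩⟩
      · exact ⟨Finset.mem_image.2 ⟨w, hw, fl_neg g⟩,
          Finset.mem_image.2 ⟨bar w, hb, fl_neg fun h => g (hc.2 h)⟩⟩
    unfold fl
    split_ifs
    · exact this.2
    · exact this.1
  · refine Finset.mem_image.2 ⟨w, hw, ?_⟩
    have := hs w hw hb
    by_cases g : G w
    · rw [fl_pos g, fl_pos (this.1 g)]
    · rw [fl_neg g, fl_neg (fun h => g (this.2 h))]

theorem fl_image_eq {Z : Finset ℤ} {G G' : ℤ → Prop} (h : Coh Z G) (h' : Coh Z G')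
    (hs : ∀ w ∈ Z, bar w ∉ Z → (G w ↔ G' w)) : Z.image (fl G) = Z.image (fl G') :=
  (fl_image_sub h' hs).antisymm (fl_image_sub h fun w hw hb => (hs w hw hb).symm)

/-- indicator -/
def iN (S : Finset ℤ) (z : ℤ) : ℕ := if z ∈ S then 1 else 0

theorem iN_le (S : Finset ℤ) (z : ℤ) : iN S z ≤ 1 := by unfold iN; split_ifs <;> omega
theorem iN_pos {S : Finset ℤ} {z : ℤ} (h : z ∈ S) : iN S z = 1 := by simp [iN, h]
theorem iN_neg {S : Finset ℤ} {z : ℤ} (h : z ∉ S) : iN S z = 0 := by simp [iN, h]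
theorem iN_iff {S : Finset ℤ} {z : ℤ} : z ∈ S ↔ iN S z = 1 := by simp [iN]

/-- edge coordinate of the outgoing edge -/
def ey (M : Finset ℤ) (z : ℤ) : ℤ := 2 * (z / 2) + if z ∈ M then 1 else 0

/-- edge multiplicity -/
def EE (Z M : Finset ℤ) (y : ℤ) : ℕ := (Z.filter fun z => ey M z = y).card

theorem ey_div (M : Finset ℤ) (z : ℤ) : ey M z / 2 = z / 2 := by
  unfold ey; split_ifs <;> omega

theorem EE_pos_of {Z M : Finset ℤ} {z : ℤ} (hz : z ∈ Z) : 1 ≤ EE Z M (ey M z) := by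
  unfold EE
  exact Finset.card_pos.2 ⟨z, by simp [hz]⟩

theorem card_pair (S : Finset ℤ) (a b : ℤ) (hab : a ≠ b) (h : ∀ z ∈ S, z = a ∨ z = b) :
    S.card = iN S a + iN S b := by
  have hsub : S ⊆ {a, b} := by
    intro z hz
    rcases h z hz with h | h <;> simp [h]
  rw [Finset.card_eq_sum_ones, ← Finset.inter_eq_right.2 hsub, ← Finset.sum_ite_mem,
    Finset.sum_pair hab]
  rw [Finset.inter_eq_right.2 hsub]
  rfl

theorem EE_even {Z M : Finset ℤ} (s : ℤ) :
    EE Z M (2 * s) = iN (Z \ M) (2 * s) + iN (Z \ M) (2 * s + 1) := by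
  unfold EE
  rw [card_pair _ (2 * s) (2 * s + 1) (by omega)]
  · congr 1
    · unfold iN ey
      simp only [Finset.mem_filter, Finset.mem_sdiff]
      congr 1
      rw [show 2 * s / 2 = s by omega]
      by_cases h : 2 * s ∈ M <;> simp [h]
    · unfold iN ey
      simp only [Finset.mem_filter, Finset.mem_sdiff]
      congr 1
      rw [show (2 * s + 1) / 2 = s by omega]
      by_cases h : 2 * s + 1 ∈ M <;> simp [h]
  · intro z hz
    have := (Finset.mem_filter.1 hz).2
    unfold ey at this
    split_ifs at this <;> omega

theorem EE_odd {Z M : Finset ℤ} (hM : M ⊆ Z) (s : ℤ) :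
    EE Z M (2 * s + 1) = iN M (2 * s) + iN M (2 * s + 1) := by
  unfold EE
  rw [card_pair _ (2 * s) (2 * s + 1) (by omega)]
  · congr 1
    · unfold iN ey
      simp only [Finset.mem_filter]
      congr 1
      rw [show 2 * s / 2 = s by omega]
      by_cases h : 2 * s ∈ M <;> simp [h]
      exact hM h
    · unfold iN ey
      simp only [Finset.mem_filter]
      congr 1
      rw [show (2 * s + 1) / 2 = s by omega]
      by_cases h : 2 * s + 1 ∈ M <;> simp [h]
      exact hM h
  · intro z hz
    have := (Finset.mem_filter.1 hz).2
    unfold ey at this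
    split_ifs at this <;> omega

theorem iN_split {Z M : Finset ℤ} (hM : M ⊆ Z) (z : ℤ) : iN Z z = iN (Z \ M) z + iN M z := by
  unfold iN
  simp only [Finset.mem_sdiff]
  by_cases h1 : z ∈ M
  · simp [h1, hM h1]
  · simp [h1]

theorem iN_image {Z M : Finset ℤ} (hM : M ⊆ Z) (hi : Set.InjOn (ev M) (Z : Set ℤ)) (w : ℤ) :
    iN (Z.image (ev M)) w = iN (Z \ M) w + iN M (w - 2) := by
  by_cases h1 : w - 2 ∈ M
  · have hw : w ∈ Z.image (ev M) := Finset.mem_image.2 ⟨w - 2, hM h1, by simp [ev, h1]⟩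
    have h2 : w ∉ Z \ M := by
      intro h
      rw [Finset.mem_sdiff] at h
      have := hi (Finset.mem_coe.2 (hM h1)) (Finset.mem_coe.2 h.1) (by simp [ev, h1, h.2])
      omega
    rw [iN_pos h1, iN_pos hw, iN_neg h2]
  · rw [iN_neg h1, add_zero]
    unfold iN
    congr 1
    apply propext
    rw [Finset.mem_image, Finset.mem_sdiff]
    constructor
    · rintro ⟨z, hz, e⟩
      unfold ev at e
      split_ifs at e with h
      · exfalso; apply h1; rw [← e]; simpa using h
      · subst e; exact ⟨hz, h⟩
    · rintro ⟨a, b⟩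
      exact ⟨w, a, by simp [ev, b]⟩

/-- sign of a particle -/
def sg (z : ℤ) : ℤ := if z % 2 = 0 then 1 else -1

/-- height function -/
def dl (Z : Finset ℤ) (x : ℤ) : ℤ := ∑ z ∈ Z.filter (fun z => 2 * x ≤ z), sg z

theorem sum_pair (S : Finset ℤ) (x : ℤ) (h : ∀ z ∈ S, z / 2 = x) :
    ∑ z ∈ S, sg z = iN S (2 * x) - iN S (2 * x + 1) := by
  have hsub : S ⊆ {2 * x, 2 * x + 1} := by
    intro z hz
    have := h z hz
    simp only [Finset.mem_insert, Finset.mem_singleton]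
    omega
  have h1 : ∑ z ∈ S, sg z = ∑ z ∈ ({2 * x, 2 * x + 1} : Finset ℤ), if z ∈ S then sg z else 0 := by
    rw [← Finset.sum_filter]
    congr 1
    rw [Finset.filter_mem_eq_inter]
    exact (Finset.inter_eq_right.2 hsub).symm
  rw [h1, Finset.sum_pair (by omega)]
  have e1 : sg (2 * x) = 1 := by unfold sg; rw [if_pos (by omega)]
  have e2 : sg (2 * x + 1) = -1 := by unfold sg; rw [if_neg (by omega)]
  rw [e1, e2]
  unfold iN
  split_ifs <;> simp

theorem dl_succ (Z : Finset ℤ) (x : ℤ) :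
    dl Z x = dl Z (x + 1) + iN Z (2 * x) - iN Z (2 * x + 1) := by
  have h := sum_pair (Z.filter fun z => z / 2 = x) x (fun z hz => (Finset.mem_filter.1 hz).2)
  have e : Z.filter (fun z => 2 * x ≤ z) = Z.filter (fun z => 2 * (x + 1) ≤ z) ∪
      Z.filter (fun z => z / 2 = x) := by
    ext z
    simp only [Finset.mem_union, Finset.mem_filter]
    constructor
    · rintro ⟨a, b⟩
      by_cases h : 2 * (x + 1) ≤ z
      · exact Or.inl ⟨a, h⟩
      · exact Or.inr ⟨a, by omega⟩
    · rintro (⟨a, b⟩ | ⟨a, b⟩)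
      · exact ⟨a, by omega⟩
      · exact ⟨a, by omega⟩
  unfold dl
  rw [e, Finset.sum_union, h]
  · have e1 : iN (Z.filter fun z => z / 2 = x) (2 * x) = iN Z (2 * x) := by
      unfold iN; simp
    have e2 : iN (Z.filter fun z => z / 2 = x) (2 * x + 1) = iN Z (2 * x + 1) := by
      unfold iN
      have : (2 * x + 1) / 2 = x := by omega
      simp [this]
    rw [e1, e2]; ring
  · rw [Finset.disjoint_left]
    intro z h1 h2
    simp only [Finset.mem_filter] at h1 h2
    omega

theorem sg_ev (M : Finset ℤ) (z : ℤ) : sg (ev M z) = sg z := by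
  unfold sg; rw [ev_parity]

theorem dl_image {Z M : Finset ℤ} (hM : M ⊆ Z) (hi : Set.InjOn (ev M) (Z : Set ℤ)) (x : ℤ) :
    dl (Z.image (ev M)) (x + 1) = dl Z (x + 1) + iN M (2 * x) - iN M (2 * x + 1) := by
  have h := sum_pair (M.filter fun z => z / 2 = x) x (fun z hz => (Finset.mem_filter.1 hz).2)
  have e : Z.filter (fun z => 2 * (x + 1) ≤ ev M z) = Z.filter (fun z => 2 * (x + 1) ≤ z) ∪
      M.filter (fun z => z / 2 = x) := by
    ext z
    simp only [Finset.mem_union, Finset.mem_filter]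
    constructor
    · rintro ⟨a, b⟩
      by_cases h : 2 * (x + 1) ≤ z
      · exact Or.inl ⟨a, h⟩
      · unfold ev at b
        split_ifs at b with hm
        · exact Or.inr ⟨hm, by omega⟩
        · omega
    · rintro (⟨a, b⟩ | ⟨a, b⟩)
      · exact ⟨a, b.trans ev_le⟩
      · exact ⟨hM a, by unfold ev; rw [if_pos a]; omega⟩
  unfold dl
  rw [Finset.filter_image, Finset.sum_image (hi.mono (by exact_mod_cast Finset.filter_subset _ _))]
  simp only [sg_ev]
  rw [e, Finset.sum_union, h]
  · have e1 : iN (M.filter fun z => z / 2 = x) (2 * x) = iN M (2 * x) := by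
      unfold iN; simp
    have e2 : iN (M.filter fun z => z / 2 = x) (2 * x + 1) = iN M (2 * x + 1) := by
      unfold iN
      have : (2 * x + 1) / 2 = x := by omega
      simp [this]
    rw [e1, e2]; ring
  · rw [Finset.disjoint_left]
    intro z h1 h2
    simp only [Finset.mem_filter] at h1 h2
    omega


/-- the other edge into the same site -/
def elk (y : ℤ) : ℤ := bar (y + 1) - 1

theorem bar_even (s : ℤ) : bar (2 * s) = 2 * s + 1 := by unfold bar; omega
theorem bar_odd (s : ℤ) : bar (2 * s + 1) = 2 * s := by unfold bar; omega
theorem elk_even (s : ℤ) : elk (2 * s) = 2 * s - 1 := by unfold elk bar; omega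
theorem elk_odd (s : ℤ) : elk (2 * s - 1) = 2 * s := by unfold elk bar; omega
theorem elk_elk (y : ℤ) : elk (elk y) = y := by unfold elk bar; omega

theorem EE_out {Z M : Finset ℤ} (hM : M ⊆ Z) {y z : ℤ} (h : z / 2 = y / 2) :
    EE Z M y + EE Z M (bar y) = iN Z z + iN Z (bar z) := by
  have h1 := EE_even (Z := Z) (M := M) (y / 2)
  have h2 := EE_odd hM (y / 2)
  have h3 := iN_split hM (2 * (y / 2))
  have h4 := iN_split hM (2 * (y / 2) + 1)
  have hy : (y = 2 * (y / 2) ∧ bar y = 2 * (y / 2) + 1) ∨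
      (y = 2 * (y / 2) + 1 ∧ bar y = 2 * (y / 2)) := by unfold bar; omega
  have hz : (z = 2 * (y / 2) ∧ bar z = 2 * (y / 2) + 1) ∨
      (z = 2 * (y / 2) + 1 ∧ bar z = 2 * (y / 2)) := by unfold bar; omega
  generalize y / 2 = s at *
  rcases hy with ⟨a, b⟩ | ⟨a, b⟩ <;> rcases hz with ⟨c, d⟩ | ⟨c, d⟩ <;> rw [b, d, a, c] <;> omega

theorem EE_in {Z M : Finset ℤ} (hM : M ⊆ Z) (hi : Set.InjOn (ev M) (Z : Set ℤ)) {y w : ℤ}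
    (h : w / 2 = (y + 1) / 2) :
    EE Z M y + EE Z M (elk y) = iN (Z.image (ev M)) w + iN (Z.image (ev M)) (bar w) := by
  have h1 := EE_even (Z := Z) (M := M) (w / 2)
  have h2 := EE_odd hM (w / 2 - 1)
  have h3 := iN_image hM hi (2 * (w / 2))
  have h4 := iN_image hM hi (2 * (w / 2) + 1)
  have hy : (y = 2 * (w / 2) ∧ elk y = 2 * (w / 2 - 1) + 1) ∨
      (y = 2 * (w / 2 - 1) + 1 ∧ elk y = 2 * (w / 2)) := by unfold elk bar; omega
  have hz : (w = 2 * (w / 2) ∧ bar w = 2 * (w / 2) + 1) ∨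
      (w = 2 * (w / 2) + 1 ∧ bar w = 2 * (w / 2)) := by unfold bar; omega
  generalize w / 2 = s at *
  rw [show 2 * (s - 1) = 2 * s - 2 by ring] at *
  rw [show 2 * s + 1 - 2 = 2 * s - 2 + 1 by ring] at h4
  rcases hy with ⟨a, b⟩ | ⟨a, b⟩ <;> rcases hz with ⟨c, d⟩ | ⟨c, d⟩ <;> rw [b, d, a, c] <;> omega

/-- edge coordinate of the incoming edge -/
def iny (M : Finset ℤ) (w : ℤ) : ℤ := if w - 2 ∈ M then 2 * (w / 2) - 1 else 2 * (w / 2)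

theorem iny_ev {Z M : Finset ℤ} (hM : M ⊆ Z) (hi : Set.InjOn (ev M) (Z : Set ℤ)) {z : ℤ}
    (hz : z ∈ Z) : iny M (ev M z) = ey M z := by
  unfold iny ey
  by_cases h : z ∈ M
  · have : ev M z = z + 2 := by simp [ev, h]
    rw [this, if_pos (by simpa using h), if_pos h]; omega
  · have e : ev M z = z := by simp [ev, h]
    rw [e, if_neg, if_neg h]
    · ring
    · intro h'
      have : z - 2 = z := hi (Finset.mem_coe.2 (hM h')) (Finset.mem_coe.2 hz) (by
        rw [e]; simp [ev, h'])
      omega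

theorem ev_div (M : Finset ℤ) (z : ℤ) : ev M z / 2 = (ey M z + 1) / 2 := by
  unfold ev ey; split_ifs <;> omega

section step
variable {Z M : Finset ℤ} {F : ℤ → Prop}

theorem coh_out (h1 : ∀ y, F y → 1 ≤ EE Z M y → 1 ≤ EE Z M (bar y) → F (bar y)) :
    Coh Z (fun w => F (ey M w)) := by
  have key : ∀ w ∈ Z, bar w ∈ Z → F (ey M w) → F (ey M (bar w)) := by
    intro w hw hb hF
    have p1 := EE_pos_of (M := M) hw
    have p2 := EE_pos_of (M := M) hb
    have : ey M (bar w) / 2 = ey M w / 2 := by rw [ey_div, ey_div, bar_div]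
    rcases site_cases this.symm with h | h
    · rw [h]; exact hF
    · rw [h]; exact h1 _ hF p1 (h ▸ p2)
  intro w hw hb
  refine ⟨key w hw hb, fun h => ?_⟩
  have := key (bar w) hb (by rwa [bar_bar]) h
  rwa [bar_bar] at this

theorem coh_in (hM : M ⊆ Z) (hi : Set.InjOn (ev M) (Z : Set ℤ)) (h2 : ∀ y, F y → 1 ≤ EE Z M y → 1 ≤ EE Z M (elk y) → F (elk y)) :
    Coh (Z.image (ev M)) (fun w => F (iny M w)) := by
  have key : ∀ w ∈ Z.image (ev M), bar w ∈ Z.image (ev M) → F (iny M w) → F (iny M (bar w)) := by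
    intro w hw hb hF
    obtain ⟨z, hz, e⟩ := Finset.mem_image.1 hw
    obtain ⟨z', hz', e'⟩ := Finset.mem_image.1 hb
    have p1 := EE_pos_of (M := M) hz
    have p2 := EE_pos_of (M := M) hz'
    rw [← e', iny_ev hM hi hz']
    rw [← e, iny_ev hM hi hz] at hF
    have : (ey M z' + 1) / 2 = (ey M z + 1) / 2 := by
      rw [← ev_div, ← ev_div, e, e', bar_div]
    have h : ey M z' = ey M z ∨ ey M z' = elk (ey M z) := by unfold elk bar; omega
    rcases h with h | h
    · rw [h]; exact hF
    · rw [h]; exact h2 _ hF p1 (h ▸ p2)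
  intro w hw hb
  refine ⟨key w hw hb, fun h => ?_⟩
  have := key (bar w) hb (by rwa [bar_bar]) h
  rwa [bar_bar] at this

theorem mem_fl {G : ℤ → Prop} (hM : M ⊆ Z) (hc : Coh Z G) {z : ℤ} (hz : z ∈ Z) :
    fl G z ∈ M.image (fl G) ↔ z ∈ M := by
  constructor
  · intro h
    obtain ⟨z', hz', e⟩ := Finset.mem_image.1 h
    rwa [← fl_injOn hc (Finset.mem_coe.2 (hM hz')) (Finset.mem_coe.2 hz) e]
  · intro h; exact Finset.mem_image_of_mem _ h

theorem ey_fl {G : ℤ → Prop} (hM : M ⊆ Z) (hc : Coh Z G) {z : ℤ} (hz : z ∈ Z) :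
    ey (M.image (fl G)) (fl G z) = ey M z := by
  unfold ey
  simp only [mem_fl hM hc hz, fl_div]

theorem ev_fl (hM : M ⊆ Z) (hi : Set.InjOn (ev M) (Z : Set ℤ)) (hc : Coh Z (fun w => F (ey M w))) {z : ℤ} (hz : z ∈ Z) :
    ev (M.image (fl fun w => F (ey M w))) (fl (fun w => F (ey M w)) z) =
      fl (fun w => F (iny M w)) (ev M z) := by
  have e1 : fl (fun w => F (iny M w)) (ev M z) =
      if z ∈ M then fl (fun w => F (ey M w)) z + 2 else fl (fun w => F (ey M w)) z := by
    by_cases g : F (ey M z)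
    · rw [fl_pos (G := fun w => F (iny M w)) (by rw [iny_ev hM hi hz]; exact g),
        fl_pos (G := fun w => F (ey M w)) g]
      unfold ev
      split_ifs
      · exact bar_add z
      · rfl
    · rw [fl_neg (G := fun w => F (iny M w)) (by rw [iny_ev hM hi hz]; exact g),
        fl_neg (G := fun w => F (ey M w)) g]
      rfl
  rw [e1]
  conv_lhs => unfold ev
  simp only [mem_fl hM hc hz]

theorem step_image (hM : M ⊆ Z) (hi : Set.InjOn (ev M) (Z : Set ℤ)) (hc : Coh Z (fun w => F (ey M w))) :
    (Z.image (fl fun w => F (ey M w))).image (ev (M.image (fl fun w => F (ey M w)))) =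
      (Z.image (ev M)).image (fl (fun w => F (iny M w))) := by
  rw [Finset.image_image, Finset.image_image]
  apply Finset.image_congr
  intro z hz
  exact ev_fl hM hi hc hz

theorem step_inj (hM : M ⊆ Z) (hi : Set.InjOn (ev M) (Z : Set ℤ)) (hc : Coh Z (fun w => F (ey M w)))
    (hc' : Coh (Z.image (ev M)) (fun w => F (iny M w))) :
    Set.InjOn (ev (M.image (fl fun w => F (ey M w))))
      ((Z.image (fl fun w => F (ey M w)) : Finset ℤ) : Set ℤ) := by
  intro a ha b hb e
  obtain ⟨z, hz, rfl⟩ := Finset.mem_image.1 (Finset.mem_coe.1 ha)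
  obtain ⟨z', hz', rfl⟩ := Finset.mem_image.1 (Finset.mem_coe.1 hb)
  rw [ev_fl hM hi hc hz, ev_fl hM hi hc hz'] at e
  have := fl_injOn hc' (Finset.mem_coe.2 (Finset.mem_image_of_mem _ hz))
    (Finset.mem_coe.2 (Finset.mem_image_of_mem _ hz')) e
  rw [hi (Finset.mem_coe.2 hz) (Finset.mem_coe.2 hz') this]

theorem step_EE {G : ℤ → Prop} (hM : M ⊆ Z) (hc : Coh Z G) (y : ℤ) :
    EE (Z.image (fl G)) (M.image (fl G)) y = EE Z M y := by
  unfold EE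
  rw [Finset.filter_image, Finset.card_image_of_injOn ((fl_injOn hc).mono (by
    exact_mod_cast Finset.filter_subset _ _))]
  congr 1
  apply Finset.filter_congr
  intro z hz
  rw [ey_fl hM hc hz]

theorem step_back (hM : M ⊆ Z) (hc : Coh Z (fun w => F (ey M w))) :
    (M.image (fl fun w => F (ey M w))).image
      (fl fun w => F (ey (M.image (fl fun w => F (ey M w))) w)) = M := by
  rw [Finset.image_image]
  conv_rhs => rw [← Finset.image_id (s := M)]
  apply Finset.image_congr
  intro z hz
  have hz := hM hz
  have e := ey_fl hM hc hz
  simp only [Function.comp, id]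
  by_cases g : F (ey M z)
  · rw [fl_pos (z := fl (fun w => F (ey M w)) z) (by rw [e]; exact g),
      fl_pos (G := fun w => F (ey M w)) g, bar_bar]
  · rw [fl_neg (z := fl (fun w => F (ey M w)) z) (by rw [e]; exact g),
      fl_neg (G := fun w => F (ey M w)) g]

end step

/-- Closed families of edges. -/
structure Clo (n : ℕ) (Z0 : Finset ℤ) (M : ℕ → Finset ℤ) (F : ℕ → ℤ → Prop) : Prop where
  slink : ∀ t y, t < n → F t y → 1 ≤ EE (st Z0 M t) (M t) y →
    1 ≤ EE (st Z0 M t) (M t) (bar y) → F t (bar y)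
  elink : ∀ t y, t < n → F t y → 1 ≤ EE (st Z0 M t) (M t) y →
    1 ≤ EE (st Z0 M t) (M t) (elk y) → F t (elk y)
  thr : ∀ t y y', t + 1 < n → 1 ≤ EE (st Z0 M t) (M t) y →
    EE (st Z0 M t) (M t) y + EE (st Z0 M t) (M t) (elk y) = 1 → y' / 2 = (y + 1) / 2 →
    1 ≤ EE (st Z0 M (t + 1)) (M (t + 1)) y' → (F t y ↔ F (t + 1) y')

/-- the flip -/
noncomputable def flp (F : ℕ → ℤ → Prop) (M : ℕ → Finset ℤ) : ℕ → Finset ℤ :=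
  fun t => (M t).image (fl fun w => F t (ey (M t) w))

section flip
variable {n : ℕ} {Z0 : Finset ℤ} {M : ℕ → Finset ℤ} {F : ℕ → ℤ → Prop}

theorem flp_coh (hF : Clo n Z0 M F) {t : ℕ} (ht : t < n) : Coh (st Z0 M t) (fun w => F t (ey (M t) w)) :=
  coh_out fun y => hF.slink t y ht

theorem flp_coh_in (hv : Valid n Z0 M) (hF : Clo n Z0 M F) {t : ℕ} (ht : t < n) : Coh (st Z0 M (t + 1)) (fun w => F t (iny (M t) w)) :=
  coh_in (hv.sub t) (hv.inj t) fun y => hF.elink t y ht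

theorem flp_match (hv : Valid n Z0 M) (hF : Clo n Z0 M F) {t : ℕ} (ht : t + 1 < n) (w : ℤ) (hw : w ∈ st Z0 M (t + 1))
    (hb : bar w ∉ st Z0 M (t + 1)) : F t (iny (M t) w) ↔ F (t + 1) (ey (M (t + 1)) w) := by
  obtain ⟨z, hz, rfl⟩ := Finset.mem_image.1 hw
  rw [iny_ev (hv.sub t) (hv.inj t) hz]
  refine hF.thr t _ _ ht (EE_pos_of hz) ?_ ?_ (EE_pos_of hw)
  · rw [EE_in (hv.sub t) (hv.inj t) (w := ev (M t) z) (ev_div _ _)]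
    have h1 := iN_pos hw
    have h2 := iN_neg hb
    simp only [st] at h1 h2
    omega
  · rw [ey_div, ev_div]

theorem flp_st_in (hv : Valid n Z0 M) (hF : Clo n Z0 M F) {t : ℕ} (ht : t < n)
    (h : st (Z0.image (fl fun w => F 0 (ey (M 0) w))) (flp F M) t =
      (st Z0 M t).image (fl fun w => F t (ey (M t) w))) :
    st (Z0.image (fl fun w => F 0 (ey (M 0) w))) (flp F M) (t + 1) =
      (st Z0 M (t + 1)).image (fl fun w => F t (iny (M t) w)) := by
  have : st (Z0.image (fl fun w => F 0 (ey (M 0) w))) (flp F M) (t + 1) =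
    (st (Z0.image (fl fun w => F 0 (ey (M 0) w))) (flp F M) t).image (ev (flp F M t)) := rfl
  rw [this, h]
  exact step_image (F := F t) (hv.sub t) (hv.inj t) (flp_coh hF ht)

theorem flp_st (hv : Valid n Z0 M) (hF : Clo n Z0 M F) {t : ℕ} (ht : t < n) :
    st (Z0.image (fl fun w => F 0 (ey (M 0) w))) (flp F M) t =
      (st Z0 M t).image (fl fun w => F t (ey (M t) w)) := by
  induction t with
  | zero => rfl
  | succ t ih =>
    rw [flp_st_in hv hF (by omega) (ih (by omega))]
    exact fl_image_eq (flp_coh_in hv hF (by omega)) (flp_coh hF ht)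
      (fun w hw hb => flp_match hv hF ht w hw hb)

theorem flp_valid (hv : Valid n Z0 M) (hF : Clo n Z0 M F) : Valid n (Z0.image (fl fun w => F 0 (ey (M 0) w))) (flp F M) where
  sub t := by
    by_cases ht : t < n
    · rw [flp_st hv hF ht]
      exact Finset.image_subset_image (hv.sub t)
    · unfold flp
      rw [hv.triv t (by omega)]; simp
  inj t := by
    by_cases ht : t < n
    · rw [flp_st hv hF ht]
      exact step_inj (F := F t) (hv.sub t) (hv.inj t) (flp_coh hF ht) (flp_coh_in hv hF ht)
    · unfold flp
      rw [hv.triv t (by omega)]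
      intro a _ b _ e
      simpa [ev_empty] using e
  triv t ht := by
    unfold flp
    rw [hv.triv t ht]; simp

theorem flp_card (hv : Valid n Z0 M) (hF : Clo n Z0 M F) (t : ℕ) : (flp F M t).card = (M t).card := by
  by_cases ht : t < n
  · exact Finset.card_image_of_injOn ((fl_injOn (flp_coh hF ht)).mono (by exact_mod_cast hv.sub t))
  · unfold flp
    rw [hv.triv t (by omega)]; simp

theorem flp_EE (hv : Valid n Z0 M) (hF : Clo n Z0 M F) {t : ℕ} (ht : t < n) (y : ℤ) :
    EE (st (Z0.image (fl fun w => F 0 (ey (M 0) w))) (flp F M) t) (flp F M t) y =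
      EE (st Z0 M t) (M t) y := by
  rw [flp_st hv hF ht]
  exact step_EE (hv.sub t) (flp_coh hF ht) y

theorem flp_back (hv : Valid n Z0 M) (hF : Clo n Z0 M F) : flp F (flp F M) = M := by
  funext t
  by_cases ht : t < n
  · exact step_back (F := F t) (hv.sub t) (flp_coh hF ht)
  · unfold flp
    rw [hv.triv t (by omega)]; simp

end flip


/-- vertex level -/
def vlev (Z : Finset ℤ) (s : ℤ) : ℤ := dl Z s + dl Z (s + 1)
/-- edge level -/
def elev (Z Z1 : Finset ℤ) (y : ℤ) : ℤ := dl Z ((y + 1) / 2) + dl Z1 (y / 2 + 1)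

section lev
variable {Z M : Finset ℤ}

theorem elev_even (Z Z1 : Finset ℤ) (s : ℤ) : elev Z Z1 (2 * s) = dl Z s + dl Z1 (s + 1) := by
  unfold elev; rw [show (2 * s + 1) / 2 = s by omega, show 2 * s / 2 = s by omega]
theorem elev_odd (Z Z1 : Finset ℤ) (s : ℤ) :
    elev Z Z1 (2 * s + 1) = dl Z (s + 1) + dl Z1 (s + 1) := by
  unfold elev
  rw [show (2 * s + 1 + 1) / 2 = s + 1 by omega, show (2 * s + 1) / 2 = s by omega]

theorem even_odd (y : ℤ) : ∃ s, y = 2 * s ∨ y = 2 * s + 1 := ⟨y / 2, by omega⟩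

theorem lev_slink (hM : M ⊆ Z) {y : ℤ} (Z1 : Finset ℤ) (h1 : 1 ≤ EE Z M y) (h2 : 1 ≤ EE Z M (bar y)) :
    elev Z Z1 (bar y) = elev Z Z1 y := by
  have key : ∀ s, 1 ≤ EE Z M (2 * s) → 1 ≤ EE Z M (2 * s + 1) → dl Z s = dl Z (s + 1) := by
    intro s a b
    have := EE_out hM (y := 2 * s) (z := 2 * s) rfl
    rw [bar_even] at this
    have l1 := iN_le Z (2 * s)
    have l2 := iN_le Z (2 * s + 1)
    have := dl_succ Z s
    omega
  obtain ⟨s, rfl | rfl⟩ := even_odd y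
  · rw [bar_even] at *
    rw [elev_even, elev_odd, key s h1 h2]
  · rw [bar_odd] at *
    rw [elev_even, elev_odd, key s h2 h1]

theorem lev_elink (hM : M ⊆ Z) (hi : Set.InjOn (ev M) (Z : Set ℤ)) {y : ℤ} (h1 : 1 ≤ EE Z M y) (h2 : 1 ≤ EE Z M (elk y)) :
    elev Z (Z.image (ev M)) (elk y) = elev Z (Z.image (ev M)) y := by
  have key : ∀ s, 1 ≤ EE Z M (2 * s) → 1 ≤ EE Z M (2 * s - 1) →
      dl (Z.image (ev M)) s = dl (Z.image (ev M)) (s + 1) := by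
    intro s a b
    have := EE_in hM hi (y := 2 * s) (w := 2 * s) (by omega)
    rw [elk_even, bar_even] at this
    have l1 := iN_le (Z.image (ev M)) (2 * s)
    have l2 := iN_le (Z.image (ev M)) (2 * s + 1)
    have := dl_succ (Z.image (ev M)) s
    omega
  have eo : ∀ s, elev Z (Z.image (ev M)) (2 * s - 1) = dl Z s + dl (Z.image (ev M)) s := by
    intro s
    have := elev_odd Z (Z.image (ev M)) (s - 1)
    rwa [show 2 * (s - 1) + 1 = 2 * s - 1 by ring, sub_add_cancel] at this
  have : ∃ s, y = 2 * s ∨ y = 2 * s - 1 := ⟨(y + 1) / 2, by omega⟩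
  obtain ⟨s, rfl | rfl⟩ := this
  · rw [elk_even] at *
    rw [elev_even, eo, key s h1 h2]
  · rw [elk_odd] at *
    rw [elev_even, eo, key s h2 h1]

theorem lev_out (hM : M ⊆ Z) (hi : Set.InjOn (ev M) (Z : Set ℤ)) {y : ℤ} (h1 : 1 ≤ EE Z M y) (h2 : EE Z M y + EE Z M (bar y) = 1) :
    elev Z (Z.image (ev M)) y = vlev Z (y / 2) := by
  obtain ⟨s, rfl | rfl⟩ := even_odd y
  · rw [bar_even] at *
    rw [elev_even, show 2 * s / 2 = s by omega]
    have := EE_odd hM s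
    have := dl_image hM hi s
    unfold vlev
    omega
  · rw [bar_odd] at *
    rw [elev_odd, show (2 * s + 1) / 2 = s by omega]
    have := EE_odd hM s
    have := EE_even (Z := Z) (M := M) s
    have := dl_image hM hi s
    have := dl_succ Z s
    have := iN_split hM (2 * s)
    have := iN_split hM (2 * s + 1)
    unfold vlev
    omega

theorem lev_in (hM : M ⊆ Z) (hi : Set.InjOn (ev M) (Z : Set ℤ)) {y : ℤ} (h1 : 1 ≤ EE Z M y) (h2 : EE Z M y + EE Z M (elk y) = 1) :
    elev Z (Z.image (ev M)) y = vlev (Z.image (ev M)) ((y + 1) / 2) := by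
  have : ∃ s, y = 2 * (s + 1) ∨ y = 2 * s + 1 := ⟨(y + 1) / 2 - 1, by omega⟩
  obtain ⟨s, rfl | rfl⟩ := this
  · rw [elk_even] at *
    rw [show 2 * (s + 1) - 1 = 2 * s + 1 by ring] at *
    rw [elev_even, show (2 * (s + 1) + 1) / 2 = s + 1 by omega]
    have := EE_odd hM s
    have := dl_image hM hi s
    unfold vlev
    omega
  · rw [show 2 * s + 1 = 2 * (s + 1) - 1 by ring, elk_odd] at h2
    rw [show 2 * (s + 1) - 1 = 2 * s + 1 by ring] at *
    rw [elev_odd, show (2 * s + 1 + 1) / 2 = s + 1 by omega]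
    have := EE_odd hM s
    have := EE_even (Z := Z) (M := M) (s + 1)
    have := dl_image hM hi s
    have := dl_succ (Z.image (ev M)) (s + 1)
    have h5 := iN_image hM hi (2 * (s + 1))
    have h6 := iN_image hM hi (2 * (s + 1) + 1)
    rw [show 2 * (s + 1) - 2 = 2 * s by ring] at h5
    rw [show 2 * (s + 1) + 1 - 2 = 2 * s + 1 by ring] at h6
    unfold vlev
    omega
end lev

/-- edges connected to the boundary vertices in `D0`, `Dn` -/
inductive Reach (n : ℕ) (E : ℕ → ℤ → ℕ) (D0 Dn : ℤ → Prop) : ℕ → ℤ → Prop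
  | start0 (y) : 1 ≤ E 0 y → E 0 y + E 0 (bar y) = 1 → D0 (y / 2) → Reach n E D0 Dn 0 y
  | startn (t y) : t + 1 = n → 1 ≤ E t y → E t y + E t (elk y) = 1 → Dn ((y + 1) / 2) →
      Reach n E D0 Dn t y
  | slink (t y) : Reach n E D0 Dn t y → 1 ≤ E t (bar y) → Reach n E D0 Dn t (bar y)
  | elink (t y) : Reach n E D0 Dn t y → 1 ≤ E t (elk y) → Reach n E D0 Dn t (elk y)
  | up (t y y') : Reach n E D0 Dn t y → E t y + E t (elk y) = 1 → y' / 2 = (y + 1) / 2 →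
      1 ≤ E (t + 1) y' → Reach n E D0 Dn (t + 1) y'
  | down (t y y') : Reach n E D0 Dn (t + 1) y' → 1 ≤ E t y → E t y + E t (elk y) = 1 →
      y' / 2 = (y + 1) / 2 → Reach n E D0 Dn t y

theorem Reach.pos {n : ℕ} {E : ℕ → ℤ → ℕ} {D0 Dn : ℤ → Prop} {t : ℕ} {y : ℤ}
    (h : Reach n E D0 Dn t y) : 1 ≤ E t y := by
  cases h <;> assumption

/-- edge multiplicities of a configuration -/
def EF (n : ℕ) (Z0 : Finset ℤ) (M : ℕ → Finset ℤ) (t : ℕ) (y : ℤ) : ℕ :=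
  if t < n then EE (st Z0 M t) (M t) y else 0

theorem EF_lt {n : ℕ} {Z0 : Finset ℤ} {M : ℕ → Finset ℤ} {t : ℕ} (h : t < n) (y : ℤ) :
    EF n Z0 M t y = EE (st Z0 M t) (M t) y := by simp [EF, h]

theorem EF_pos {n : ℕ} {Z0 : Finset ℤ} {M : ℕ → Finset ℤ} {t : ℕ} {y : ℤ}
    (h : 1 ≤ EF n Z0 M t y) : t < n := by
  by_contra hc; simp [EF, hc] at h

/-- the flipped edges -/
def FR (n : ℕ) (Z0 Zn : Finset ℤ) (M : ℕ → Finset ℤ) : ℕ → ℤ → Prop :=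
  Reach n (EF n Z0 M) (fun s => vlev Z0 s < 0) (fun s => vlev Zn s < 0)

theorem FR_clo (n : ℕ) (Z0 Zn : Finset ℤ) (M : ℕ → Finset ℤ) : Clo n Z0 M (FR n Z0 Zn M) where
  slink t y ht h _ h2 := Reach.slink t y h (by rwa [EF_lt ht])
  elink t y ht h _ h2 := Reach.elink t y h (by rwa [EF_lt ht])
  thr t y y' ht h1 h2 h3 h4 := by
    have e : t < n := by omega
    rw [← EF_lt (Z0 := Z0) (M := M) e] at h1 h2
    rw [← EF_lt (Z0 := Z0) (M := M) e] at h2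
    rw [← EF_lt (Z0 := Z0) (M := M) ht] at h4
    exact ⟨fun h => Reach.up t y y' h h2 h3 h4, fun h => Reach.down t y y' h h1 h2 h3⟩

theorem FR_lev {n : ℕ} {Z0 Zn : Finset ℤ} {M : ℕ → Finset ℤ} (hv : Valid n Z0 M)
    (hn : st Z0 M n = Zn) {t : ℕ} {y : ℤ} (h : FR n Z0 Zn M t y) :
    elev (st Z0 M t) (st Z0 M (t + 1)) y < 0 := by
  have thr : ∀ t y y', t + 1 < n → 1 ≤ EF n Z0 M t y → EF n Z0 M t y + EF n Z0 M t (elk y) = 1 →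
      y' / 2 = (y + 1) / 2 → 1 ≤ EF n Z0 M (t + 1) y' →
      elev (st Z0 M t) (st Z0 M (t + 1)) y =
        elev (st Z0 M (t + 1)) (st Z0 M (t + 1 + 1)) y' := by
    intro t y y' ht h1 h2 h3 h4
    have ht' : t < n := by omega
    rw [EF_lt ht'] at h1 h2
    rw [EF_lt ht'] at h2
    rw [EF_lt ht] at h4
    have e1 := lev_in (hv.sub t) (hv.inj t) h1 h2
    have h5 : EE (st Z0 M (t + 1)) (M (t + 1)) y' + EE (st Z0 M (t + 1)) (M (t + 1)) (bar y') = 1 := by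
      rw [EE_out (hv.sub (t + 1)) (z := y') rfl]
      rw [EE_in (hv.sub t) (hv.inj t) h3] at h2
      exact h2
    have e2 := lev_out (hv.sub (t + 1)) (hv.inj (t + 1)) h4 h5
    have e3 : elev (st Z0 M t) (st Z0 M (t + 1)) y = vlev (st Z0 M (t + 1)) ((y + 1) / 2) := e1
    have e4 : elev (st Z0 M (t + 1)) (st Z0 M (t + 1 + 1)) y' = vlev (st Z0 M (t + 1)) (y' / 2) := e2
    rw [e3, e4, h3]
  unfold FR at h
  induction h with
  | start0 y h1 h2 h3 =>
    have ht := EF_pos h1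
    rw [EF_lt ht] at h1 h2
    rw [EF_lt ht] at h2
    have e := lev_out (hv.sub 0) (hv.inj 0) h1 h2
    have : elev (st Z0 M 0) (st Z0 M (0 + 1)) y = vlev Z0 (y / 2) := e
    rw [this]; exact h3
  | startn t y h0 h1 h2 h3 =>
    have ht := EF_pos h1
    rw [EF_lt ht] at h1 h2
    rw [EF_lt ht] at h2
    have e := lev_in (hv.sub t) (hv.inj t) h1 h2
    have : elev (st Z0 M t) (st Z0 M (t + 1)) y = vlev Zn ((y + 1) / 2) := by
      rw [← hn, ← h0]; exact e
    rw [this]; exact h3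
  | slink t y h h2 ih =>
    have h1 := h.pos
    have ht := EF_pos h1
    rw [EF_lt ht] at h1 h2
    rw [lev_slink (hv.sub t) _ h1 h2]; exact ih
  | elink t y h h2 ih =>
    have h1 := h.pos
    have ht := EF_pos h1
    rw [EF_lt ht] at h1 h2
    have := lev_elink (hv.sub t) (hv.inj t) h1 h2
    have e : elev (st Z0 M t) (st Z0 M (t + 1)) (elk y) = elev (st Z0 M t) (st Z0 M (t + 1)) y := this
    rw [e]; exact ih
  | up t y y' h h2 h3 h4 ih =>
    rw [← thr t y y' (EF_pos h4) h.pos h2 h3 h4]; exact ih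
  | down t y y' h h1 h2 h3 ih =>
    rw [thr t y y' (EF_pos h.pos) h1 h2 h3 h.pos]; exact ih

/-- the folded configuration -/
noncomputable def fold (Z : Finset ℤ) : Finset ℤ :=
  Z.image (fl fun w => bar w ∉ Z ∧ vlev Z (w / 2) < 0)

theorem fold_coh (Z : Finset ℤ) : Coh Z (fun w => bar w ∉ Z ∧ vlev Z (w / 2) < 0) := by
  intro w hw hb
  simp only [bar_bar]
  tauto

theorem FR_fold0 {n : ℕ} {Z0 Zn : Finset ℤ} {M : ℕ → Finset ℤ} (hv : Valid n Z0 M)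
    (hn : st Z0 M n = Zn) (hpos : 0 < n) :
    Z0.image (fl fun w => FR n Z0 Zn M 0 (ey (M 0) w)) = fold Z0 := by
  apply fl_image_eq (flp_coh (FR_clo n Z0 Zn M) hpos) (fold_coh Z0)
  intro w hw hb
  have h1 : 1 ≤ EE (st Z0 M 0) (M 0) (ey (M 0) w) := EE_pos_of hw
  have h2 : EE (st Z0 M 0) (M 0) (ey (M 0) w) + EE (st Z0 M 0) (M 0) (bar (ey (M 0) w)) = 1 := by
    rw [EE_out (hv.sub 0) (ey_div _ _).symm]
    rw [iN_pos hw, iN_neg hb]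
  constructor
  · intro h
    refine ⟨hb, ?_⟩
    have l := FR_lev hv hn h
    have e := lev_out (hv.sub 0) (hv.inj 0) h1 h2
    change elev (st Z0 M 0) (st Z0 M (0 + 1)) _ = vlev Z0 _ at e
    rw [e, ey_div] at l
    exact l
  · rintro ⟨-, h⟩
    refine Reach.start0 _ (by rwa [EF_lt hpos]) (by rwa [EF_lt hpos, EF_lt hpos]) ?_
    rwa [ey_div]

theorem FR_foldn {n : ℕ} {Z0 Zn : Finset ℤ} {M : ℕ → Finset ℤ} (hv : Valid n Z0 M)
    (hn : st Z0 M n = Zn) (hpos : 0 < n) :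
    st (fold Z0) (flp (FR n Z0 Zn M) M) n = fold Zn := by
  obtain ⟨t, rfl⟩ : ∃ t, n = t + 1 := ⟨n - 1, by omega⟩
  have ht : t < t + 1 := by omega
  have hF := FR_clo (t + 1) Z0 Zn M
  rw [← FR_fold0 hv hn hpos, flp_st_in hv hF ht (flp_st hv hF ht), hn]
  have hc := flp_coh_in hv hF ht
  rw [hn] at hc
  apply fl_image_eq hc (fold_coh Zn)
  intro w hw hb
  have hn' : (st Z0 M t).image (ev (M t)) = Zn := hn
  have hw0 := hw
  rw [← hn'] at hw
  obtain ⟨z, hz, rfl⟩ := Finset.mem_image.1 hw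
  rw [iny_ev (hv.sub t) (hv.inj t) hz]
  have h1 := EE_pos_of (M := M t) hz
  have h2 : EE (st Z0 M t) (M t) (ey (M t) z) + EE (st Z0 M t) (M t) (elk (ey (M t) z)) = 1 := by
    rw [EE_in (hv.sub t) (hv.inj t) (ev_div _ _), hn', iN_pos hw0, iN_neg hb]
  constructor
  · intro h
    refine ⟨hb, ?_⟩
    have l := FR_lev hv hn h
    have e := lev_in (hv.sub t) (hv.inj t) h1 h2
    rw [hn'] at e
    rw [hn, e, ← ev_div] at l
    exact l
  · rintro ⟨-, h⟩
    refine Reach.startn _ _ rfl (by rwa [EF_lt ht]) (by rwa [EF_lt ht, EF_lt ht]) ?_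
    rwa [← ev_div]

theorem FR_inj {n : ℕ} {Z0 Zn : Finset ℤ} {M M' : ℕ → Finset ℤ} (hv : Valid n Z0 M)
    (hn : st Z0 M n = Zn) (hv' : Valid n Z0 M') (hn' : st Z0 M' n = Zn) (hpos : 0 < n)
    (h : flp (FR n Z0 Zn M) M = flp (FR n Z0 Zn M') M') : M = M' := by
  have hE : EF n Z0 M = EF n Z0 M' := by
    funext t y
    unfold EF
    split_ifs with ht
    · rw [← flp_EE hv (FR_clo n Z0 Zn M) ht, ← flp_EE hv' (FR_clo n Z0 Zn M') ht, h,
        FR_fold0 hv hn hpos, FR_fold0 hv' hn' hpos]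
    · rfl
  have hF : FR n Z0 Zn M = FR n Z0 Zn M' := by unfold FR; rw [hE]
  rw [← flp_back hv (FR_clo n Z0 Zn M), ← flp_back hv' (FR_clo n Z0 Zn M'), h, hF]


/-- numerical data of two consecutive layers -/
structure NumD (a b sq mq sp mp i1 i2 : ℤ → ℕ) : Prop where
  ha : ∀ s, a (s + 1) = a s + mq s
  hb : ∀ s, b (s + 1) = b s + mp s
  hq : ∀ s, sq s + mq s ≤ 2
  hp : ∀ s, sp (s + 1) + mp (s + 1) = sq (s + 1) + mq s
  hp2 : ∀ s, sp s + mp s ≤ 2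
  hr : ∀ s, sp (s + 1) + mp s ≤ 2
  hi1 : ∀ s, i1 s ≤ mq s
  hi1' : ∀ s, mq s ≤ 1 + i1 s
  hi2 : ∀ s, i2 s ≤ mp s
  hi2' : ∀ s, mp s ≤ 1 + i2 s
  h1 : ∀ s, i1 s ≤ 1
  h2 : ∀ s, i2 s ≤ 1

/-- numerical form of the Yamanouchi condition -/
structure YN (a b sq mq i1 i2 : ℤ → ℕ) : Prop where
  A1 : ∀ s, mq s = 0 → b (s + 1) ≤ a (s + 1)
  A2 : ∀ s, sq s = 0 → b (s + 1) ≤ a s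
  B : ∀ s, sq (s + 1) = 1 → mq s = 1 → b (s + 1) + i2 (s + 1) ≤ a (s + 1)
  E : ∀ s, sq s = 1 → mq s = 1 → b (s + 1) ≤ a s + i1 s

/-- blocked sites -/
def Bad (a b sq mq : ℤ → ℕ) (s : ℤ) : Prop := sq s = 1 ∧ mq s = 1 ∧ b (s + 1) = a s + 1

section
variable {a b sq mq sp mp i1 i2 : ℤ → ℕ}

theorem bad_dn0 (H : NumD a b sq mq sp mp i1 i2) (Y : YN a b sq mq i1 i2) {s : ℤ} (h : Bad a b sq mq (s + 1)) : mp (s + 1) = 1 := by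
  obtain ⟨h1, h2, h3⟩ := h
  have := H.ha s; have := H.hb s; have := H.ha (s + 1); have := H.hb (s + 1)
  have := H.hb (s + 1 + 1); have := H.ha (s + 1 + 1)
  have := H.hq s; have := H.hq (s + 1); have := H.hp s; have := H.hp (s + 1)
  have := H.hp2 (s + 1); have := H.hp2 (s + 1 + 1); have := H.hr (s + 1)
  have := H.hi2 (s + 1 + 1); have := H.hi2' (s + 1 + 1); have := H.h2 (s + 1 + 1)
  have := H.hi2 (s + 1); have := H.hi2' (s + 1); have := H.h2 (s + 1)
  have := Y.A1 s; have := Y.B s; have := Y.B (s + 1); have := Y.A2 (s + 1 + 1)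
  omega

theorem bad_dn (H : NumD a b sq mq sp mp i1 i2) (Y : YN a b sq mq i1 i2) {s : ℤ} (h : Bad a b sq mq (s + 1)) :
    (mq s = 0 ∧ mp (s + 1) = 1 ∧ sp (s + 1) = 0) ∨
      (Bad a b sq mq s ∧ mp (s + 1) = 1 ∧ sp (s + 1) = 1) := by
  have h0 := bad_dn0 H Y h
  unfold Bad at *
  obtain ⟨h1, h2, h3⟩ := h
  have := H.ha s; have := H.hb s; have := H.hb (s + 1)
  have := H.hq s; have := H.hp s; have := H.hp2 (s + 1)
  have := Y.A1 s; have := Y.B s; have := Y.A2 s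
  omega

theorem bad_mp (H : NumD a b sq mq sp mp i1 i2) (Y : YN a b sq mq i1 i2) {s : ℤ} (h : Bad a b sq mq s) : mp s = 1 := by
  have := bad_dn0 H Y (s := s - 1) (by rwa [sub_add_cancel])
  rwa [sub_add_cancel] at this

theorem bad_up (H : NumD a b sq mq sp mp i1 i2) (Y : YN a b sq mq i1 i2) {s : ℤ} (h : Bad a b sq mq s) :
    (sq (s + 1) = 0 ∧ mp (s + 1) = 0 ∧ sp (s + 1) = 1) ∨
      (Bad a b sq mq (s + 1) ∧ mp (s + 1) = 1 ∧ sp (s + 1) = 1) := by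
  have h0 := bad_mp H Y h
  unfold Bad at *
  obtain ⟨h1, h2, h3⟩ := h
  have := H.ha s; have := H.hb s; have := H.hb (s + 1); have := H.ha (s + 1)
  have := H.hq (s + 1); have := H.hp s; have := H.hp2 (s + 1); have := H.hr s
  have := H.hi2 (s + 1); have := H.hi2' (s + 1); have := H.h2 (s + 1)
  have := Y.A1 (s + 1); have := Y.B s; have := Y.A2 (s + 1)
  omega

end

/-- number of particles at or above `θ` -/
def ge (Z : Finset ℤ) (θ : ℤ) : ℕ := (Z.filter fun z => θ ≤ z).card
/-- number of particles below `θ` -/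
def lo (Z : Finset ℤ) (θ : ℤ) : ℕ := (Z.filter fun z => z < θ).card

theorem filter_eq_card (Z : Finset ℤ) (θ : ℤ) : (Z.filter fun z => z = θ).card = iN Z θ := by
  rw [Finset.filter_eq']
  unfold iN
  split_ifs <;> simp

theorem ge_succ (Z : Finset ℤ) (θ : ℤ) : ge Z θ = ge Z (θ + 1) + iN Z θ := by
  unfold ge
  rw [← filter_eq_card, ← Finset.card_union_of_disjoint, ← Finset.filter_or]
  · congr 1
    apply Finset.filter_congr
    intro z _; omega
  · rw [Finset.disjoint_filter]; intro z _; omega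

theorem lo_succ (Z : Finset ℤ) (θ : ℤ) : lo Z (θ + 1) = lo Z θ + iN Z θ := by
  unfold lo
  rw [← filter_eq_card, ← Finset.card_union_of_disjoint, ← Finset.filter_or]
  · congr 1
    apply Finset.filter_congr
    intro z _; omega
  · rw [Finset.disjoint_filter]; intro z _; omega

theorem ge_image {Z M : Finset ℤ} (hM : M ⊆ Z) (hi : Set.InjOn (ev M) (Z : Set ℤ)) (θ : ℤ) :
    ge (Z.image (ev M)) θ = ge Z θ + iN M (θ - 2) + iN M (θ - 1) := by
  unfold ge
  rw [Finset.filter_image, Finset.card_image_of_injOn (hi.mono (by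
    exact_mod_cast Finset.filter_subset _ _))]
  rw [← filter_eq_card, ← filter_eq_card, ← Finset.card_union_of_disjoint,
    ← Finset.card_union_of_disjoint]
  · congr 1
    ext z
    simp only [Finset.mem_union, Finset.mem_filter]
    unfold ev
    by_cases h : z ∈ M
    · have := hM h
      simp only [h, this, if_true, true_and]; omega
    · simp only [h, if_false, false_and, or_false]
  · rw [Finset.disjoint_left]
    intro z; simp only [Finset.mem_union, Finset.mem_filter]; omega
  · rw [Finset.disjoint_left]
    intro z; simp only [Finset.mem_filter]; omega

theorem SS_ge {Z M : Finset ℤ} (hM : M ⊆ Z) (θ : ℤ) : SS Z M (ge Z θ) = lo M θ := by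
  unfold SS lo
  congr 1
  apply Finset.filter_congr
  intro z hz
  unfold ge rk
  constructor
  · intro h
    by_contra hc
    have : (Z.filter fun w => z < w).card < (Z.filter fun w => θ ≤ w).card := by
      apply Finset.card_lt_card
      rw [Finset.ssubset_iff_of_subset]
      · exact ⟨z, by simp only [Finset.mem_filter]; exact ⟨hM hz, by omega⟩, by simp⟩
      · intro w; simp only [Finset.mem_filter]; exact fun h => ⟨h.1, by omega⟩
    omega
  · intro h
    apply Finset.card_le_card
    intro w; simp only [Finset.mem_filter]; exact fun h => ⟨h.1, by omega⟩

theorem exists_ge {Z : Finset ℤ} {k : ℕ} (hk : k < Z.card) : ∃ θ, ge Z θ = k := by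
  obtain ⟨z, hz, h⟩ := exists_rk hk
  refine ⟨z + 1, ?_⟩
  rw [← h]
  unfold ge rk
  congr 1

section
variable {Q M1 M2 : Finset ℤ}

theorem lo_site (M : Finset ℤ) (s : ℤ) :
    lo M (2 * (s + 1)) = lo M (2 * s) + (iN M (2 * s) + iN M (2 * s + 1)) := by
  rw [show 2 * (s + 1) = 2 * s + 1 + 1 by ring, lo_succ, lo_succ]; omega

theorem num_of (hM1 : M1 ⊆ Q) (hi : Set.InjOn (ev M1) (Q : Set ℤ)) (hM2 : M2 ⊆ Q.image (ev M1)) (hi2 : Set.InjOn (ev M2) (Q.image (ev M1) : Set ℤ)) : NumD (fun s => lo M1 (2 * s)) (fun s => lo M2 (2 * s))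
    (fun s => EE Q M1 (2 * s)) (fun s => EE Q M1 (2 * s + 1))
    (fun s => EE (Q.image (ev M1)) M2 (2 * s)) (fun s => EE (Q.image (ev M1)) M2 (2 * s + 1))
    (fun s => iN M1 (2 * s)) (fun s => iN M2 (2 * s)) where
  ha s := by rw [lo_site, EE_odd hM1]
  hb s := by rw [lo_site, EE_odd hM2]
  hq s := by
    have := EE_out hM1 (y := 2 * s) (z := 2 * s) rfl
    rw [bar_even] at this
    have := iN_le Q (2 * s); have := iN_le Q (2 * s + 1)
    omega
  hp s := by
    have h1 := EE_out hM2 (y := 2 * (s + 1)) (z := 2 * (s + 1)) rfl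
    have h2 := EE_in hM1 hi (y := 2 * (s + 1)) (w := 2 * (s + 1)) (by omega)
    rw [elk_even] at h2
    rw [bar_even] at h1 h2
    rw [show 2 * (s + 1) - 1 = 2 * s + 1 by ring] at h2
    omega
  hp2 s := by
    have := EE_out hM2 (y := 2 * s) (z := 2 * s) rfl
    rw [bar_even] at this
    have := iN_le (Q.image (ev M1)) (2 * s); have := iN_le (Q.image (ev M1)) (2 * s + 1)
    omega
  hr s := by
    have h2 := EE_in hM2 hi2 (y := 2 * (s + 1)) (w := 2 * (s + 1)) (by omega)
    rw [elk_even, bar_even] at h2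
    rw [show 2 * (s + 1) - 1 = 2 * s + 1 by ring] at h2
    have := iN_le ((Q.image (ev M1)).image (ev M2)) (2 * (s + 1))
    have := iN_le ((Q.image (ev M1)).image (ev M2)) (2 * (s + 1) + 1)
    omega
  hi1 s := by rw [EE_odd hM1]; omega
  hi1' s := by rw [EE_odd hM1]; have := iN_le M1 (2 * s + 1); omega
  hi2 s := by rw [EE_odd hM2]; omega
  hi2' s := by rw [EE_odd hM2]; have := iN_le M2 (2 * s + 1); omega
  h1 s := iN_le _ _
  h2 s := iN_le _ _

theorem yn_of (hM1 : M1 ⊆ Q) (hi : Set.InjOn (ev M1) (Q : Set ℤ)) (hM2 : M2 ⊆ Q.image (ev M1)) (h : ∀ k, SS (Q.image (ev M1)) M2 k ≤ SS Q M1 k) :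
    YN (fun s => lo M1 (2 * s)) (fun s => lo M2 (2 * s))
    (fun s => EE Q M1 (2 * s)) (fun s => EE Q M1 (2 * s + 1))
    (fun s => iN M1 (2 * s)) (fun s => iN M2 (2 * s)) := by
  have key : ∀ θ θ', ge Q θ = ge (Q.image (ev M1)) θ' → lo M2 θ' ≤ lo M1 θ := by
    intro θ θ' e
    rw [← SS_ge hM1, ← SS_ge hM2, e]
    exact h _
  have g : ∀ s, ge (Q.image (ev M1)) (2 * (s + 1)) = ge Q (2 * (s + 1)) + EE Q M1 (2 * s + 1) := by
    intro s
    rw [ge_image hM1 hi, EE_odd hM1, show 2 * (s + 1) - 2 = 2 * s by ring,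
      show 2 * (s + 1) - 1 = 2 * s + 1 by ring]; omega
  have q : ∀ s, ge Q (2 * s) = ge Q (2 * (s + 1)) + EE Q M1 (2 * s) + EE Q M1 (2 * s + 1) := by
    intro s
    have h1 := ge_succ Q (2 * s)
    have h2 := ge_succ Q (2 * s + 1)
    rw [show 2 * s + 1 + 1 = 2 * (s + 1) by ring] at h2
    have h3 := EE_out hM1 (y := 2 * s) (z := 2 * s) rfl
    rw [bar_even] at h3
    omega
  refine ⟨fun s h0 => ?_, fun s h0 => ?_, fun s h0 h1 => ?_, fun s h0 h1 => ?_⟩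
  · exact key _ _ (by have := g s; omega)
  · exact key _ _ (by have := g s; have := q s; omega)
  · have e := EE_in hM1 hi (y := 2 * (s + 1)) (w := 2 * (s + 1)) (by omega)
    rw [elk_even, bar_even, show 2 * (s + 1) - 1 = 2 * s + 1 by ring] at e
    have := iN_le (Q.image (ev M1)) (2 * (s + 1))
    have := iN_le (Q.image (ev M1)) (2 * (s + 1) + 1)
    have := ge_succ (Q.image (ev M1)) (2 * (s + 1))
    have := g s
    rw [← lo_succ]
    exact key _ _ (by omega)
  · have e := EE_out hM1 (y := 2 * s) (z := 2 * s) rfl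
    rw [bar_even] at e
    have := iN_le Q (2 * s)
    have := iN_le Q (2 * s + 1)
    have := ge_succ Q (2 * s)
    have := g s
    have := q s
    rw [← lo_succ]
    exact key _ _ (by omega)

theorem of_yn (hM1 : M1 ⊆ Q) (hi : Set.InjOn (ev M1) (Q : Set ℤ)) (hM2 : M2 ⊆ Q.image (ev M1)) (Y : YN (fun s => lo M1 (2 * s)) (fun s => lo M2 (2 * s))
    (fun s => EE Q M1 (2 * s)) (fun s => EE Q M1 (2 * s + 1))
    (fun s => iN M1 (2 * s)) (fun s => iN M2 (2 * s))) :
    ∀ k, SS (Q.image (ev M1)) M2 k ≤ SS Q M1 k := by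
  have A1 : ∀ s, EE Q M1 (2 * s + 1) = 0 → lo M2 (2 * (s + 1)) ≤ lo M1 (2 * (s + 1)) := Y.A1
  have A2 := Y.A2
  have B := Y.B
  have E := Y.E
  have g : ∀ s, ge (Q.image (ev M1)) (2 * (s + 1)) = ge Q (2 * (s + 1)) + EE Q M1 (2 * s + 1) := by
    intro s
    rw [ge_image hM1 hi, EE_odd hM1, show 2 * (s + 1) - 2 = 2 * s by ring,
      show 2 * (s + 1) - 1 = 2 * s + 1 by ring]; omega
  have q : ∀ s, ge Q (2 * s) = ge Q (2 * (s + 1)) + EE Q M1 (2 * s) + EE Q M1 (2 * s + 1) := by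
    intro s
    have h1 := ge_succ Q (2 * s)
    have h2 := ge_succ Q (2 * s + 1)
    rw [show 2 * s + 1 + 1 = 2 * (s + 1) by ring] at h2
    have h3 := EE_out hM1 (y := 2 * s) (z := 2 * s) rfl
    rw [bar_even] at h3
    omega
  have pin : ∀ s, EE Q M1 (2 * (s + 1)) + EE Q M1 (2 * s + 1) =
      iN (Q.image (ev M1)) (2 * (s + 1)) + iN (Q.image (ev M1)) (2 * (s + 1) + 1) := by
    intro s
    have e := EE_in hM1 hi (y := 2 * (s + 1)) (w := 2 * (s + 1)) (by omega)
    rwa [elk_even, bar_even, show 2 * (s + 1) - 1 = 2 * s + 1 by ring] at e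
  have l1 := fun s => iN_le (Q.image (ev M1)) s
  have fin : ∀ θ θ', ge Q θ = ge (Q.image (ev M1)) θ' → lo M2 θ' ≤ lo M1 θ →
      SS (Q.image (ev M1)) M2 (ge Q θ) ≤ SS Q M1 (ge Q θ) := by
    intro θ θ' e hl
    rwa [SS_ge hM1, e, SS_ge hM2]
  have even : ∀ s, SS (Q.image (ev M1)) M2 (ge Q (2 * (s + 1))) ≤ SS Q M1 (ge Q (2 * (s + 1))) := by
    intro s
    have := g s
    by_cases c1 : EE Q M1 (2 * s + 1) = 0
    · exact fin _ (2 * (s + 1)) (by omega) (A1 s c1)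
    by_cases c2 : EE Q M1 (2 * (s + 1)) = 0
    · refine fin _ (2 * (s + 1 + 1)) ?_ (A2 _ c2)
      have := g (s + 1); have := q (s + 1); omega
    have := pin s
    have := l1 (2 * (s + 1)); have := l1 (2 * (s + 1) + 1)
    refine fin _ (2 * (s + 1) + 1) ?_ ?_
    · have := ge_succ (Q.image (ev M1)) (2 * (s + 1)); omega
    · rw [lo_succ]; exact B s (by omega) (by omega)
  have even' : ∀ s, SS (Q.image (ev M1)) M2 (ge Q (2 * s)) ≤ SS Q M1 (ge Q (2 * s)) := by
    intro s
    have := even (s - 1)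
    rwa [sub_add_cancel] at this
  intro k
  by_cases hk : k < Q.card
  · obtain ⟨θ, rfl⟩ := exists_ge hk
    obtain ⟨s, rfl | rfl⟩ := even_odd θ
    · exact even' s
    · have g1 := ge_succ Q (2 * s)
      have g2 := ge_succ Q (2 * s + 1)
      rw [show 2 * s + 1 + 1 = 2 * (s + 1) by ring] at g2
      have n1 := iN_le Q (2 * s)
      have n2 := iN_le Q (2 * s + 1)
      by_cases c1 : iN Q (2 * s) = 0
      · rw [c1, add_zero] at g1; rw [← g1]; exact even' s
      by_cases c2 : iN Q (2 * s + 1) = 0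
      · rw [c2, add_zero] at g2; rw [g2]; exact even s
      have h3 := EE_out hM1 (y := 2 * s) (z := 2 * s) rfl
      rw [bar_even] at h3
      have ho := EE_odd hM1 s
      have := g s
      have := q s
      have ls := lo_succ M1 (2 * s)
      have ls2 := lo_succ M2 (2 * s)
      have ls3 := lo_site M2 s
      have ls4 := lo_site M1 s
      by_cases c3 : EE Q M1 (2 * s) = 0
      · have := pin s
        have := l1 (2 * (s + 1)); have := l1 (2 * (s + 1) + 1)
        have := ge_succ (Q.image (ev M1)) (2 * (s + 1))
        refine fin _ (2 * (s + 1) + 1) (by omega) ?_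
        have := A2 s c3
        have := lo_succ M2 (2 * (s + 1))
        have := iN_le M2 (2 * (s + 1))
        have := iN_le M1 (2 * s); have := iN_le M1 (2 * s + 1)
        omega
      by_cases c4 : EE Q M1 (2 * s + 1) = 0
      · have := pin (s - 1)
        simp only [sub_add_cancel] at this
        have := l1 (2 * s); have := l1 (2 * s + 1)
        have g5 := ge_succ (Q.image (ev M1)) (2 * s + 1)
        rw [show 2 * s + 1 + 1 = 2 * (s + 1) by ring] at g5
        refine fin _ (2 * s + 1) (by omega) ?_
        have := A1 s c4
        omega
      · refine fin _ (2 * (s + 1)) (by omega) ?_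
        have := E s (by omega) (by omega)
        omega
  · rw [SS_large hM2]
    · omega
    · rw [Finset.card_image_of_injOn hi]; omega
end


/-- blocked sites of layer `i` -/
def BadL (Z0 : Finset ℤ) (M : ℕ → Finset ℤ) (i : ℕ) (s : ℤ) : Prop :=
  Bad (fun s => lo (M i) (2 * s)) (fun s => lo (M (i + 1)) (2 * s))
    (fun s => EE (st Z0 M i) (M i) (2 * s)) (fun s => EE (st Z0 M i) (M i) (2 * s + 1)) s

section avoid
variable {n : ℕ} {Z0 Zn : Finset ℤ} {M : ℕ → Finset ℤ} {i : ℕ}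


theorem badL_mp (hv : Valid n Z0 M) (hY : Yam n Z0 M) (hin : i + 1 < n) {s : ℤ} (h : BadL Z0 M i s) :
    EE (st Z0 M (i + 1)) (M (i + 1)) (2 * s + 1) = 1 :=
  bad_mp (num_of (hv.sub i) (hv.inj i) (hv.sub (i + 1)) (hv.inj (i + 1)))
    (yn_of (hv.sub i) (hv.inj i) (hv.sub (i + 1)) (hY i hin)) h

theorem badL_dn (hv : Valid n Z0 M) (hY : Yam n Z0 M) (hin : i + 1 < n) {s : ℤ} (h : BadL Z0 M i (s + 1)) :
    (EE (st Z0 M i) (M i) (2 * s + 1) = 0 ∧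
      EE (st Z0 M (i + 1)) (M (i + 1)) (2 * (s + 1)) = 0) ∨
    (BadL Z0 M i s) := by
  rcases bad_dn (num_of (hv.sub i) (hv.inj i) (hv.sub (i + 1)) (hv.inj (i + 1)))
    (yn_of (hv.sub i) (hv.inj i) (hv.sub (i + 1)) (hY i hin)) h with h | h
  · exact Or.inl ⟨h.1, h.2.2⟩
  · exact Or.inr h.1

theorem badL_up (hv : Valid n Z0 M) (hY : Yam n Z0 M) (hin : i + 1 < n) {s : ℤ} (h : BadL Z0 M i s) :
    EE (st Z0 M (i + 1)) (M (i + 1)) (2 * (s + 1)) = 1 ∧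
    ((EE (st Z0 M i) (M i) (2 * (s + 1)) = 0 ∧
      EE (st Z0 M (i + 1)) (M (i + 1)) (2 * (s + 1) + 1) = 0) ∨
    (BadL Z0 M i (s + 1))) := by
  rcases bad_up (num_of (hv.sub i) (hv.inj i) (hv.sub (i + 1)) (hv.inj (i + 1)))
    (yn_of (hv.sub i) (hv.inj i) (hv.sub (i + 1)) (hY i hin)) h with h | h
  · exact ⟨h.2.2, Or.inl ⟨h.1, h.2.1⟩⟩
  · exact ⟨h.2.2, Or.inr h.1⟩

theorem badL_two {y : ℤ} (h : BadL Z0 M i (y / 2)) :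
    EE (st Z0 M i) (M i) y + EE (st Z0 M i) (M i) (bar y) = 2 := by
  obtain ⟨h1, h2, -⟩ := h
  simp only at h1 h2
  obtain ⟨s, rfl | rfl⟩ := even_odd y
  · rw [show 2 * s / 2 = s by omega] at *
    rw [bar_even]; omega
  · rw [show (2 * s + 1) / 2 = s by omega] at *
    rw [bar_odd]; omega

theorem badL_elk (hv : Valid n Z0 M) (hY : Yam n Z0 M) (hin : i + 1 < n) {y : ℤ} (h1 : 1 ≤ EE (st Z0 M (i + 1)) (M (i + 1)) y)
    (h : BadL Z0 M i (y / 2) ∨ BadL Z0 M i (y / 2 - 1)) :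
    1 ≤ EE (st Z0 M (i + 1)) (M (i + 1)) (elk y) := by
  obtain ⟨s, rfl | rfl⟩ := even_odd y
  · rw [show 2 * s / 2 = s by omega] at h
    rw [elk_even]
    have hb : BadL Z0 M i (s - 1) := by
      rcases h with h | h
      · have h' := h
        rw [← sub_add_cancel s 1] at h'
        rcases badL_dn hv hY hin h' with h3 | h3
        · rw [sub_add_cancel] at h3; omega
        · exact h3
      · exact h
    have := badL_mp hv hY hin hb
    rw [show 2 * (s - 1) + 1 = 2 * s - 1 by ring] at this
    omega
  · rw [show (2 * s + 1) / 2 = s by omega] at h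
    rw [show 2 * s + 1 = 2 * (s + 1) - 1 by ring, elk_odd]
    have hb : BadL Z0 M i s := by
      rcases h with h | h
      · exact h
      · rcases (badL_up hv hY hin h).2 with h3 | h3
        · rw [sub_add_cancel] at h3; omega
        · rwa [sub_add_cancel] at h3
    have := (badL_up hv hY hin hb).1
    omega

theorem FR_avoid (hv : Valid n Z0 M) (hY : Yam n Z0 M) (hin : i + 1 < n) {t : ℕ} {y : ℤ} (h : FR n Z0 Zn M t y) :
    ¬ (t = i ∧ BadL Z0 M i (y / 2)) ∧
    ¬ (t = i + 1 ∧ (BadL Z0 M i (y / 2) ∨ BadL Z0 M i (y / 2 - 1))) := by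
  unfold FR at h
  have hi0 : i < n := by omega
  induction h with
  | start0 y h1 h2 h3 =>
    refine ⟨?_, by omega⟩
    rintro ⟨rfl, hb⟩
    have := badL_two hb
    rw [EF_lt (by omega), EF_lt (by omega)] at h2
    omega
  | startn t y h0 h1 h2 h3 =>
    refine ⟨by omega, ?_⟩
    rintro ⟨rfl, hb⟩
    rw [EF_lt hin] at h1 h2
    rw [EF_lt hin] at h2
    have := badL_elk hv hY hin h1 hb
    omega
  | slink t y h h2 ih =>
    rw [bar_div]; exact ih
  | elink t y h h2 ih =>
    constructor
    · rintro ⟨rfl, hb⟩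
      apply ih.1
      refine ⟨rfl, ?_⟩
      have h1 := h.pos
      rw [EF_lt hi0] at h1 h2
      have : ∃ s, y = 2 * (s + 1) ∨ y = 2 * (s + 1) - 1 := ⟨(y + 1) / 2 - 1, by omega⟩
      obtain ⟨s, rfl | rfl⟩ := this
      · rw [elk_even, show (2 * (s + 1) - 1) / 2 = s by omega] at hb
        rw [show 2 * (s + 1) / 2 = s + 1 by omega]
        rcases (badL_up hv hY hin hb).2 with h3 | h3
        · omega
        · exact h3
      · rw [elk_odd, show 2 * (s + 1) / 2 = s + 1 by omega] at hb
        rw [show (2 * (s + 1) - 1) / 2 = s by omega]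
        rcases badL_dn hv hY hin hb with h3 | h3
        · rw [show 2 * (s + 1) - 1 = 2 * s + 1 by ring] at h1
          omega
        · exact h3
    · rintro ⟨rfl, hb⟩
      apply ih.2
      refine ⟨rfl, ?_⟩
      have h1 := h.pos
      rw [EF_lt hin] at h1 h2
      have : ∃ s, y = 2 * (s + 1) ∨ y = 2 * (s + 1) - 1 := ⟨(y + 1) / 2 - 1, by omega⟩
      obtain ⟨s, rfl | rfl⟩ := this
      · rw [elk_even, show (2 * (s + 1) - 1) / 2 = s by omega] at hb
        rw [show 2 * (s + 1) / 2 = s + 1 by omega, add_sub_cancel_right]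
        rw [elk_even] at h2
        rcases hb with hb | hb
        · exact Or.inr hb
        · rcases (badL_up hv hY hin hb).2 with h3 | h3
          · rw [sub_add_cancel] at h3
            rw [show 2 * (s + 1) - 1 = 2 * s + 1 by ring] at h2
            omega
          · rw [sub_add_cancel] at h3
            exact Or.inr h3
      · rw [elk_odd, show 2 * (s + 1) / 2 = s + 1 by omega, add_sub_cancel_right] at hb
        rw [show (2 * (s + 1) - 1) / 2 = s by omega]
        rw [elk_odd] at h2
        rcases hb with hb | hb
        · rcases badL_dn hv hY hin hb with h3 | h3
          · omega
          · exact Or.inl h3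
        · exact Or.inl hb
  | up t y y' h h2 h3 h4 ih =>
    have ht := EF_pos h4
    have h1 := h.pos
    rw [EF_lt (by omega)] at h1 h2
    rw [EF_lt (by omega)] at h2
    constructor
    · rintro ⟨rfl, hb⟩
      have e := badL_two hb
      rw [EE_out (hv.sub (t + 1)) (z := y') rfl] at e
      rw [EE_in (hv.sub t) (hv.inj t) h3] at h2
      have : iN (st Z0 M (t + 1)) y' + iN (st Z0 M (t + 1)) (bar y') = 1 := h2
      omega
    · rintro ⟨e, hb⟩
      obtain rfl : t = i := by omega
      apply ih.1
      refine ⟨rfl, ?_⟩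
      rw [h3] at hb
      have : ∃ s, y = 2 * (s + 1) ∨ y = 2 * (s + 1) - 1 := ⟨(y + 1) / 2 - 1, by omega⟩
      obtain ⟨s, rfl | rfl⟩ := this
      · rw [show (2 * (s + 1) + 1) / 2 = s + 1 by omega, add_sub_cancel_right] at hb
        rw [show 2 * (s + 1) / 2 = s + 1 by omega]
        rcases hb with hb | hb
        · exact hb
        · have := hb.2.1
          rw [elk_even, show 2 * (s + 1) - 1 = 2 * s + 1 by ring] at h2
          simp only at this
          omega
      · rw [show (2 * (s + 1) - 1 + 1) / 2 = s + 1 by omega, add_sub_cancel_right] at hb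
        rw [show (2 * (s + 1) - 1) / 2 = s by omega]
        rcases hb with hb | hb
        · have := hb.1
          rw [elk_odd] at h2
          simp only at this
          omega
        · exact hb
  | down t y y' h h1 h2 h3 ih =>
    have ht := EF_pos h.pos
    have h4 := h.pos
    rw [EF_lt (by omega)] at h1 h2
    rw [EF_lt (by omega)] at h2
    constructor
    · rintro ⟨rfl, hb⟩
      apply ih.2
      refine ⟨rfl, ?_⟩
      rw [h3]
      have : y / 2 = (y + 1) / 2 ∨ y / 2 = (y + 1) / 2 - 1 := by omega
      rcases this with e | e
      · rw [e] at hb; exact Or.inl hb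
      · rw [e] at hb; exact Or.inr hb
    · rintro ⟨rfl, hb⟩
      have := badL_elk hv hY hin h1 hb
      omega

end avoid

theorem lo_fl {Z M : Finset ℤ} {G : ℤ → Prop} (hM : M ⊆ Z) (hc : Coh Z G) (s : ℤ) :
    lo (M.image (fl G)) (2 * s) = lo M (2 * s) := by
  unfold lo
  rw [Finset.filter_image, Finset.card_image_of_injOn ((fl_injOn hc).mono (by
    exact_mod_cast (Finset.filter_subset _ _).trans hM))]
  congr 1
  apply Finset.filter_congr
  intro z hz
  have := fl_div G z
  omega

/-- if the flip creates an element at position `2s` then the flip is active there -/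
theorem fl_new {M : Finset ℤ} {F : ℤ → Prop} {w : ℤ}
    (h1 : w ∈ M.image (fl fun w => F (ey M w))) (h2 : w ∉ M) :
    bar w ∈ M ∧ F (ey M (bar w)) := by
  obtain ⟨v, hv, e⟩ := Finset.mem_image.1 h1
  by_cases g : F (ey M v)
  · rw [fl_pos (G := fun w => F (ey M w)) g] at e
    rw [← e, bar_bar]; exact ⟨hv, g⟩
  · rw [fl_neg (G := fun w => F (ey M w)) g] at e
    exact absurd (e ▸ hv) h2

theorem fl_old {M : Finset ℤ} {F : ℤ → Prop} {w : ℤ}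
    (h1 : w ∉ M.image (fl fun w => F (ey M w))) (h2 : w ∈ M) : F (ey M w) := by
  by_contra g
  exact h1 (Finset.mem_image.2 ⟨w, h2, fl_neg (G := fun w => F (ey M w)) g⟩)

theorem flp_yam {n : ℕ} {Z0 Zn : Finset ℤ} {M : ℕ → Finset ℤ} (hv : Valid n Z0 M)
    (hY : Yam n Z0 M) :
    Yam n (Z0.image (fl fun w => FR n Z0 Zn M 0 (ey (M 0) w))) (flp (FR n Z0 Zn M) M) := by
  intro i hin
  have hF := FR_clo n Z0 Zn M
  have hv' := flp_valid hv hF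
  have hi0 : i < n := by omega
  have N := num_of (hv.sub i) (hv.inj i) (hv.sub (i + 1)) (hv.inj (i + 1))
  have Y := yn_of (hv.sub i) (hv.inj i) (hv.sub (i + 1)) (hY i hin)
  apply of_yn (hv'.sub i) (hv'.inj i) (hv'.sub (i + 1))
  have l1 : (fun s => lo (flp (FR n Z0 Zn M) M i) (2 * s)) = fun s => lo (M i) (2 * s) :=
    funext fun s => lo_fl (hv.sub i) (flp_coh hF hi0) s
  have l2 : (fun s => lo (flp (FR n Z0 Zn M) M (i + 1)) (2 * s)) = fun s => lo (M (i + 1)) (2 * s) :=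
    funext fun s => lo_fl (hv.sub (i + 1)) (flp_coh hF hin) s
  rw [l1, l2]
  simp only [flp_EE hv hF hi0]
  refine ⟨Y.A1, Y.A2, fun s h0 h1 => ?_, fun s h0 h1 => ?_⟩
  · by_contra hc
    have B := Y.B s h0 h1
    have A1 := Y.A1 (s + 1)
    have a1 := N.ha (s + 1)
    have b1 := N.hb (s + 1)
    have q1 := N.hq (s + 1)
    have n1 := iN_le (flp (FR n Z0 Zn M) M (i + 1)) (2 * (s + 1))
    have c1 : iN (M (i + 1)) (2 * (s + 1)) = 0 := by omega
    have c2 : iN (flp (FR n Z0 Zn M) M (i + 1)) (2 * (s + 1)) = 1 := by omega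
    have m1 : 2 * (s + 1) ∉ M (i + 1) := by rw [iN_iff]; omega
    obtain ⟨m3, m4⟩ := fl_new (F := FR n Z0 Zn M (i + 1)) (iN_iff.2 c2) m1
    rw [bar_even] at m3 m4
    have e : ey (M (i + 1)) (2 * (s + 1) + 1) = 2 * (s + 1) + 1 := by
      unfold ey; rw [if_pos m3]; omega
    rw [e] at m4
    apply (FR_avoid hv hY hin m4).2
    refine ⟨rfl, Or.inl ?_⟩
    rw [show (2 * (s + 1) + 1) / 2 = s + 1 by omega]
    have o := EE_odd (hv.sub (i + 1)) (s + 1)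
    rw [iN_pos m3, c1] at o
    have o' : EE (Finset.image (ev (M i)) (st Z0 M i)) (M (i + 1)) (2 * (s + 1) + 1) = 0 + 1 := o
    refine ⟨h0, ?_, ?_⟩ <;> simp only <;> omega
  · by_contra hc
    have E := Y.E s h0 h1
    have n1 := iN_le (M i) (2 * s)
    have c1 : iN (flp (FR n Z0 Zn M) M i) (2 * s) = 0 := by omega
    have c2 : iN (M i) (2 * s) = 1 := by omega
    have m1 : 2 * s ∉ flp (FR n Z0 Zn M) M i := by rw [iN_iff]; omega
    have m2 := iN_iff.2 c2
    have m4 := fl_old (F := FR n Z0 Zn M i) m1 m2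
    have e : ey (M i) (2 * s) = 2 * s + 1 := by
      unfold ey; rw [if_pos m2]; omega
    rw [e] at m4
    apply (FR_avoid hv hY hin m4).1
    refine ⟨rfl, ?_⟩
    rw [show (2 * s + 1) / 2 = s by omega]
    refine ⟨h0, h1, ?_⟩
    simp only; omega

theorem CF_fold (N : ℕ) (Z0 Zn : Finset ℤ) :
    IsSchurNonneg N (CF N (xt (xv N)) (fold Z0) (fold Zn) - CF N (xt (xv N)) Z0 Zn) := by
  rcases Nat.eq_zero_or_pos N with hN | hN
  · subst hN
    apply CF_compare 0 Z0 Zn (fold Z0) (fold Zn) id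
    · intro M hv hn hY
      have he : ∀ t, M t = ∅ := fun t => hv.triv t (Nat.zero_le _)
      refine ⟨⟨fun t => ?_, fun t => ?_, fun t _ => he t⟩, ?_, fun t ht => by omega, fun t => rfl⟩
      · simp [he]
      · simp only [id, he]
        intro a _ b _ e
        simpa [ev_empty] using e
      · have : Z0 = Zn := hn
        rw [this]; rfl
    · intro M M' _ _ _ _ h; exact h
  · apply CF_compare N Z0 Zn (fold Z0) (fold Zn) (fun M => flp (FR N Z0 Zn M) M)
    · intro M hv hn hY
      have hF := FR_clo N Z0 Zn M
      have h1 := flp_valid hv hF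
      have h2 := flp_yam (Zn := Zn) hv hY
      rw [FR_fold0 hv hn hN] at h1 h2
      exact ⟨h1, FR_foldn hv hn hN, h2, flp_card hv hF⟩
    · intro M M' hv hn hv' hn' h
      exact FR_inj hv hn hv' hn' hN h


theorem Hn_iter {R : Type*} [CommRing R] (n : ℕ) (X : ℕ → R) (m : ℤ) (p : ℕ) :
    Hn (n + 1) X m = ∑ q ∈ Finset.range p, X 0 ^ q * Hn n (fun t => X (t + 1)) (m - q)
      + X 0 ^ p * Hn (n + 1) X (m - p) := by
  induction p with
  | zero => simp
  | succ p ih =>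
    rw [ih, Finset.sum_range_succ, Hn_succ n X (m - p)]
    push_cast
    rw [show m - (p + 1 : ℤ) = m - p - 1 by ring]
    ring

/-- transposed Jacobi–Trudi determinant -/
noncomputable def Dt {R : Type*} [CommRing R] (n : ℕ) (X : ℕ → R) {k : ℕ} (lam kap : Fin k → ℕ) : R :=
  Matrix.det (Matrix.of fun j i : Fin k => Hn n X (((lam i : ℤ) - (i : ℤ)) - ((kap j : ℤ) - (j : ℤ))))

/-- upper bound for horizontal strips -/
def ub (W : ℕ) (mu : ℕ → ℕ) (j : ℕ) : ℕ := if j = 0 then W else mu (j - 1)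

theorem Dt_row {R : Type*} [CommRing R] (n : ℕ) (X : ℕ → R) (a : ℤ) (j m u : ℕ) (hu : m ≤ u) :
    Hn (n + 1) X (a - ((m : ℤ) - j)) =
      ∑ q ∈ Finset.Ico m (u + 1), X 0 ^ (q - m) * Hn n (fun t => X (t + 1)) (a - ((q : ℤ) - j))
      + X 0 ^ (u + 1 - m) * Hn (n + 1) X (a - ((u : ℤ) + 1 - j)) := by
  rw [Hn_iter n X _ (u + 1 - m), Finset.sum_Ico_eq_sum_range]
  congr 1
  · apply Finset.sum_congr rfl
    intro q _
    rw [Nat.add_sub_cancel_left]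
    congr 2
    push_cast; ring
  · congr 2
    rw [Nat.cast_sub (by omega)]
    push_cast; ring

theorem Dt_succ {R : Type*} [CommRing R] (n : ℕ) (X : ℕ → R) {k : ℕ} (lam : Fin k → ℕ) (mu : ℕ → ℕ)
    (W : ℕ) (hmu : Antitone mu) (hW : mu 0 ≤ W) (hl : ∀ i, lam i ≤ W) :
    Dt (n + 1) X lam (fun j => mu j) = ∑ kap ∈ Fintype.piFinset
      (fun j : Fin k => Finset.Ico (mu j) (ub W mu j + 1)),
        X 0 ^ (∑ j, (kap j - mu j)) * Dt n (fun t => X (t + 1)) lam kap := by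
  have key : Dt (n + 1) X lam (fun j => mu j) = Matrix.det (Matrix.of fun j i : Fin k =>
      ∑ q ∈ Finset.Ico (mu j) (ub W mu j + 1), X 0 ^ (q - mu j) *
        Hn n (fun t => X (t + 1)) (((lam i : ℤ) - (i : ℤ)) - ((q : ℤ) - (j : ℤ)))) := by
    unfold Dt
    cases k with
    | zero => simp
    | succ k =>
      apply Matrix.det_eq_of_forall_row_eq_smul_add_pred (fun i => X 0 ^ (mu i + 1 - mu (i + 1)))
      · intro i
        simp only [Matrix.of_apply]
        rw [Dt_row n X _ _ (mu (0 : Fin (k + 1))) (ub W mu (0 : Fin (k + 1))) (by simpa [ub] using hW)]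
        rw [add_eq_left]
        have : Hn (n + 1) X ((lam i : ℤ) - (i : ℤ) -
            ((ub W mu (0 : Fin (k + 1)) : ℤ) + 1 - ((0 : Fin (k + 1)) : ℕ))) = 0 := by
          apply HH_neg
          have := hl i
          simp [ub]
          omega
        rw [this, mul_zero]
      · intro j i
        simp only [Matrix.of_apply]
        have hub : ub W mu (j.succ : Fin (k + 1)) = mu j := by simp [ub]
        rw [Dt_row n X _ _ (mu (j.succ : Fin (k + 1))) (mu j) (hmu (by simp)), hub]
        congr 1
        simp
  rw [key]
  let f : MultilinearMap R (fun _ : Fin k => Fin k → R) R :=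
    (Matrix.detRowAlternating (R := R) (n := Fin k)).toMultilinearMap
  have e1 : ∀ A : Fin k → Fin k → R, Matrix.det (Matrix.of A) = f A := fun _ => rfl
  rw [e1]
  have e2 : (fun j i : Fin k =>
      ∑ q ∈ Finset.Ico (mu j) (ub W mu j + 1), X 0 ^ (q - mu j) *
        Hn n (fun t => X (t + 1)) (((lam i : ℤ) - (i : ℤ)) - ((q : ℤ) - (j : ℤ)))) =
      fun j : Fin k => ∑ q ∈ Finset.Ico (mu j) (ub W mu j + 1), X 0 ^ (q - mu j) •
        (fun i : Fin k => Hn n (fun t => X (t + 1)) (((lam i : ℤ) - (i : ℤ)) - ((q : ℤ) - (j : ℤ)))) := by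
    funext j i
    simp [Finset.sum_apply]
  rw [e2, MultilinearMap.map_sum_finset f (fun (j : Fin k) (q : ℕ) => X 0 ^ (q - mu j) •
        (fun i : Fin k => Hn n (fun t => X (t + 1)) (((lam i : ℤ) - (i : ℤ)) - ((q : ℤ) - (j : ℤ)))))]
  apply Finset.sum_congr rfl
  intro kap _
  rw [MultilinearMap.map_smul_univ, Finset.prod_pow_eq_pow_sum, smul_eq_mul]
  rfl

theorem Dt_zero {R : Type*} [CommRing R] (X : ℕ → R) {k : ℕ} (lam mu : Fin k → ℕ)
    (hl : Antitone lam) (hm : Antitone mu) : Dt 0 X lam mu = if lam = mu then 1 else 0 := by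
  unfold Dt
  simp only [Hn_zero]
  split_ifs with h
  · subst h
    convert Matrix.det_one (n := Fin k) (R := R)
    ext j i
    simp only [Matrix.of_apply, Matrix.one_apply]
    congr 1
    apply propext
    constructor
    · intro e
      rcases lt_trichotomy i j with h | h | h
      · have := hl h.le; have : (i : ℕ) < j := h; omega
      · exact h.symm
      · have := hl h.le; have : (j : ℕ) < i := h; omega
    · rintro rfl; ring
  · have hne : ∃ i, lam i ≠ mu i := by
      by_contra hc; push Not at hc; exact h (funext hc)
    obtain ⟨i, hi, hmin⟩ := WellFounded.has_min (wellFounded_lt (α := Fin k)) {i | lam i ≠ mu i} hne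
    have heq : ∀ l, l < i → lam l = mu l := by
      intro l hl
      by_contra hc
      exact hmin l hc hl
    rcases lt_or_gt_of_ne hi with hlt | hgt
    · apply Matrix.det_eq_zero_of_row_eq_zero i
      intro l
      simp only [Matrix.of_apply]
      rw [if_neg]
      intro e
      rcases lt_or_ge l i with h' | h'
      · have := heq l h'; have := hm h'.le; have : (l : ℕ) < i := h'; omega
      · have := hl h'; have : (i : ℕ) ≤ l := h'; omega
    · apply Matrix.det_eq_zero_of_column_eq_zero i
      intro l
      simp only [Matrix.of_apply]
      rw [if_neg]
      intro e
      rcases lt_or_ge l i with h' | h'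
      · have := heq l h'; have := hl h'.le; have : (l : ℕ) < i := h'; omega
      · have := hm h'; have : (i : ℕ) ≤ l := h'; omega


/-- conjugate partition -/
def cj (k : ℕ) (mu : ℕ → ℕ) (c : ℕ) : ℕ := ((Finset.range k).filter (fun i => c < mu i)).card

theorem lt_cj {k : ℕ} {mu : ℕ → ℕ} (hmu : Antitone mu) (i c : ℕ) :
    i < cj k mu c ↔ i < k ∧ c < mu i := by
  unfold cj
  constructor
  · intro h
    by_contra hn
    have : (Finset.range k).filter (fun i => c < mu i) ⊆ Finset.range i := by
      intro x hx
      simp only [Finset.mem_filter, Finset.mem_range] at hx ⊢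
      by_contra hxi
      push Not at hxi
      exact hn ⟨by omega, lt_of_lt_of_le hx.2 (hmu hxi)⟩
    have := Finset.card_le_card this
    rw [Finset.card_range] at this
    omega
  · rintro ⟨h1, h2⟩
    have : Finset.range (i + 1) ⊆ (Finset.range k).filter (fun i => c < mu i) := by
      intro x hx
      simp only [Finset.mem_filter, Finset.mem_range] at hx ⊢
      exact ⟨by omega, lt_of_lt_of_le h2 (hmu (by omega))⟩
    have := Finset.card_le_card this
    rw [Finset.card_range] at this
    omega

theorem cj_anti (k : ℕ) (mu : ℕ → ℕ) : Antitone (cj k mu) := by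
  intro a b hab
  apply Finset.card_le_card
  intro x hx
  simp only [Finset.mem_filter, Finset.mem_range] at hx ⊢
  exact ⟨hx.1, by omega⟩

theorem cj_le (k : ℕ) (mu : ℕ → ℕ) (c : ℕ) : cj k mu c ≤ k := by
  unfold cj
  exact (Finset.card_filter_le _ _).trans (by simp)

theorem nat_eq_of_lt {a b : ℕ} (h : ∀ i, i < a ↔ i < b) : a = b := by
  have h1 := h a
  have h2 := h b
  omega

theorem cj_sum (k W : ℕ) (mu : ℕ → ℕ) (h : ∀ i, mu i ≤ W) :
    ∑ c ∈ Finset.range W, cj k mu c = ∑ i ∈ Finset.range k, mu i := by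
  unfold cj
  simp only [Finset.card_filter]
  rw [Finset.sum_comm]
  apply Finset.sum_congr rfl
  intro i _
  rw [← Finset.card_filter]
  have : (Finset.range W).filter (fun c => c < mu i) = Finset.range (mu i) := by
    ext c
    have := h i
    simp only [Finset.mem_filter, Finset.mem_range]
    omega
  rw [this, Finset.card_range]

/-- particle position of a column -/
def pz (h : ℕ → ℕ) (c : ℕ) : ℤ := 2 * ((h c : ℤ) - c)

theorem pz_inj {h : ℕ → ℕ} (hh : Antitone h) : Function.Injective (pz h) := by
  have : StrictAnti (pz h) := by
    intro a b hab
    have := hh hab.le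
    unfold pz
    omega
  exact this.injective

/-- particles of columns -/
def Zs (W : ℕ) (h : ℕ → ℕ) : Finset ℤ := (Finset.range W).image (pz h)

/-- set of moving particles -/
def Emv (W : ℕ) (h h' : ℕ → ℕ) : Finset ℤ :=
  ((Finset.range W).filter (fun c => h c < h' c)).image (pz h)

theorem mem_Emv {W : ℕ} {h : ℕ → ℕ} (h' : ℕ → ℕ) (hh : Antitone h) {c : ℕ} (hc : c < W) :
    pz h c ∈ Emv W h h' ↔ h c < h' c := by
  unfold Emv
  rw [Finset.mem_image]
  constructor
  · rintro ⟨d, hd, e⟩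
    rw [pz_inj hh e] at hd
    exact (Finset.mem_filter.1 hd).2
  · intro hc'
    exact ⟨c, Finset.mem_filter.2 ⟨Finset.mem_range.2 hc, hc'⟩, rfl⟩

theorem ev_Emv {W : ℕ} {h h' : ℕ → ℕ} (hh : Antitone h) {c : ℕ} (hc : c < W)
    (h1 : h c ≤ h' c) (h2 : h' c ≤ h c + 1) : ev (Emv W h h') (pz h c) = pz h' c := by
  unfold ev
  simp only [mem_Emv h' hh hc]
  unfold pz
  split_ifs <;> omega

theorem image_Emv {W : ℕ} {h h' : ℕ → ℕ} (hh : Antitone h)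
    (h1 : ∀ c, h c ≤ h' c) (h2 : ∀ c, h' c ≤ h c + 1) :
    (Zs W h).image (ev (Emv W h h')) = Zs W h' := by
  unfold Zs
  rw [Finset.image_image]
  apply Finset.image_congr
  intro c hc
  have hc : c < W := by simpa using hc
  exact ev_Emv hh hc (h1 c) (h2 c)

theorem Emv_mem {W : ℕ} {h h' : ℕ → ℕ} (hh : Antitone h) (hh' : Antitone h')
    (h1 : ∀ c, h c ≤ h' c) (h2 : ∀ c, h' c ≤ h c + 1) :
    Emv W h h' ∈ mvs (Zs W h) := by
  rw [mem_mvs]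
  refine ⟨Finset.image_subset_image (Finset.filter_subset _ _), ?_⟩
  intro x hx y hy e
  simp only [Zs, Finset.coe_image, Set.mem_image, Finset.mem_coe, Finset.mem_range] at hx hy
  obtain ⟨a, ha, rfl⟩ := hx
  obtain ⟨b, hb, rfl⟩ := hy
  rw [ev_Emv hh ha (h1 a) (h2 a), ev_Emv hh hb (h1 b) (h2 b)] at e
  rw [pz_inj hh' e]

theorem Emv_card {W : ℕ} {h h' : ℕ → ℕ} (hh : Antitone h)
    (h1 : ∀ c, h c ≤ h' c) (h2 : ∀ c, h' c ≤ h c + 1) :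
    (Emv W h h').card + ∑ c ∈ Finset.range W, h c = ∑ c ∈ Finset.range W, h' c := by
  unfold Emv
  rw [Finset.card_image_of_injective _ (pz_inj hh), Finset.card_filter, ← Finset.sum_add_distrib]
  apply Finset.sum_congr rfl
  intro c _
  have := h1 c
  have := h2 c
  split_ifs <;> omega

theorem Emv_surj {W : ℕ} {h : ℕ → ℕ} (hh : Antitone h) {A : Finset ℤ}
    (hA : A ∈ mvs (Zs W h)) : ∃ h' : ℕ → ℕ, Antitone h' ∧ (∀ c, h c ≤ h' c) ∧
      (∀ c, h' c ≤ h c + 1) ∧ (∀ c, W ≤ c → h' c = h c) ∧ A = Emv W h h' := by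
  rw [mem_mvs] at hA
  obtain ⟨hs, hi⟩ := hA
  have hlt : ∀ c, pz h c ∈ A → c < W := by
    intro c hc
    have := hs hc
    simp only [Zs, Finset.mem_image, Finset.mem_range] at this
    obtain ⟨d, hd, e⟩ := this
    rw [← pz_inj hh e]; exact hd
  refine ⟨fun c => if pz h c ∈ A then h c + 1 else h c, ?_, ?_, ?_, ?_, ?_⟩
  · apply antitone_nat_of_succ_le
    intro c
    have h0 := hh (Nat.le_succ c)
    simp only [Nat.succ_eq_add_one] at h0
    by_cases h1 : pz h (c + 1) ∈ A
    · by_cases h2 : pz h c ∈ A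
      · simp only [h1, h2, if_true]; omega
      · simp only [h1, h2, if_true, if_false]
        by_contra hn
        have hc := hlt _ h1
        have e : ev A (pz h (c + 1)) = ev A (pz h c) := by
          unfold ev
          rw [if_pos h1, if_neg h2]
          unfold pz
          push_cast
          omega
        have := hi (by simp only [Zs, Finset.coe_image, Set.mem_image, Finset.mem_coe, Finset.mem_range]; exact ⟨_, hc, rfl⟩)
          (by simp only [Zs, Finset.coe_image, Set.mem_image, Finset.mem_coe, Finset.mem_range]; exact ⟨c, by omega, rfl⟩) e
        have := pz_inj hh this
        omega
    · simp only [h1, if_false]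
      split_ifs <;> omega
  · intro c; dsimp only; split_ifs <;> omega
  · intro c; dsimp only; split_ifs <;> omega
  · intro c hc
    dsimp only
    rw [if_neg]
    intro h1
    have := hlt c h1
    omega
  · ext z
    constructor
    · intro hz
      have := hs hz
      simp only [Zs, Finset.mem_image, Finset.mem_range] at this
      obtain ⟨d, hd, rfl⟩ := this
      rw [mem_Emv _ hh hd, if_pos hz]
      omega
    · intro hz
      unfold Emv at hz
      simp only [Finset.mem_image, Finset.mem_filter] at hz
      obtain ⟨d, ⟨_, hd⟩, rfl⟩ := hz
      by_contra hn
      rw [if_neg hn] at hd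
      omega

/-- extension by zero -/
def ex {k : ℕ} (kap : Fin k → ℕ) (i : ℕ) : ℕ := if h : i < k then kap ⟨i, h⟩ else 0

theorem ex_fin {k : ℕ} (kap : Fin k → ℕ) (i : Fin k) : ex kap i = kap i := by
  simp [ex]


theorem Zs_inj {W : ℕ} {h h' : ℕ → ℕ} (hh : Antitone h) (hh' : Antitone h')
    (e : Zs W h = Zs W h') : ∀ c, c < W → h c = h' c := by
  have sm : ∀ g : ℕ → ℕ, Antitone g → StrictMono (fun c : Fin W => - pz g c) := by
    intro g hg a b hab
    have := hg (show (a : ℕ) ≤ b from hab.le)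
    have : (a : ℕ) < b := hab
    simp only [pz]
    omega
  have rg : ∀ g : ℕ → ℕ, Set.range (fun c : Fin W => - pz g c) = (fun z => - z) '' (Zs W g : Set ℤ) := by
    intro g
    ext z
    simp only [Set.mem_range, Set.mem_image, Zs, Finset.coe_image, Finset.coe_range, Set.mem_Iio]
    constructor
    · rintro ⟨c, rfl⟩
      exact ⟨_, ⟨c, c.2, rfl⟩, rfl⟩
    · rintro ⟨_, ⟨c, hc, rfl⟩, rfl⟩
      exact ⟨⟨c, hc⟩, rfl⟩
  have := ((sm h hh).range_inj (sm h' hh')).1 (by rw [rg, rg, e])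
  intro c hc
  have := congrFun this ⟨c, hc⟩
  simp only [pz] at this
  omega

theorem cj_ge {k W : ℕ} {mu : ℕ → ℕ} (hm : ∀ i, mu i ≤ W) (c : ℕ) (hc : W ≤ c) : cj k mu c = 0 := by
  unfold cj
  rw [Finset.card_eq_zero, Finset.filter_eq_empty_iff]
  intro i _
  have := hm i
  omega

theorem cj_eq_imp {k W : ℕ} {mu ka : ℕ → ℕ} (hmu : Antitone mu) (hka : Antitone ka)
    (hm : ∀ i, mu i ≤ W) (hk : ∀ i, ka i ≤ W) (h : ∀ c, c < W → cj k mu c = cj k ka c) :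
    ∀ i, i < k → mu i = ka i := by
  intro i hi
  apply nat_eq_of_lt
  intro c
  have h1 := lt_cj (k := k) hmu i c
  have h2 := lt_cj (k := k) hka i c
  have := hm i
  have := hk i
  by_cases hc : c < W
  · rw [h c hc] at h1
    simp only [hi, true_and] at h1 h2
    rw [← h1, h2]
  · omega

theorem DtCF {R : Type*} [CommRing R] (n : ℕ) (X : ℕ → R) (k W : ℕ) (lam mu : ℕ → ℕ)
    (hlam : Antitone lam) (hmu : Antitone mu) (hl : ∀ i, lam i ≤ W) (hm : ∀ i, mu i ≤ W) :
    Dt n X (fun i : Fin k => lam i) (fun j : Fin k => mu j) =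
      CF n X (Zs W (cj k mu)) (Zs W (cj k lam)) := by
  induction n generalizing X mu with
  | zero =>
    rw [Dt_zero, CF_zero]
    · apply if_congr _ rfl rfl
      constructor
      · intro h
        have : cj k mu = cj k lam := by
          funext c
          unfold cj
          congr 1
          apply Finset.filter_congr
          intro i hi
          have := congrFun h ⟨i, Finset.mem_range.1 hi⟩
          simp only at this
          rw [this]
        rw [this]
      · intro h
        have := cj_eq_imp hmu hlam hm hl (Zs_inj (cj_anti k mu) (cj_anti k lam) h)
        funext i
        exact (this i i.2).symm
    · intro a b hab; exact hlam hab
    · intro a b hab; exact hmu hab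
  | succ n ih =>
    rw [Dt_succ n X _ mu W hmu (hm 0) (fun i => hl i), CF_succ]
    have hmem : ∀ kap : Fin k → ℕ, kap ∈ Fintype.piFinset
        (fun j : Fin k => Finset.Ico (mu j) (ub W mu j + 1)) ↔
        ∀ i, i < k → mu i ≤ ex kap i ∧ ex kap i ≤ ub W mu i := by
      intro kap
      simp only [Fintype.mem_piFinset, Finset.mem_Ico]
      constructor
      · intro h i hi
        have := h ⟨i, hi⟩
        simp only [ex, hi, dif_pos]
        simp only at this
        omega
      · intro h i
        have := h i i.2
        rw [ex_fin] at this
        omega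
    have hub : ∀ i, ub W mu i ≤ W := by
      intro i; unfold ub; split_ifs
      · exact le_rfl
      · exact hm _
    have hexW : ∀ kap ∈ Fintype.piFinset
        (fun j : Fin k => Finset.Ico (mu j) (ub W mu j + 1)), ∀ i, ex kap i ≤ W := by
      intro kap hk i
      rw [hmem] at hk
      by_cases hi : i < k
      · exact (hk i hi).2.trans (hub i)
      · simp [ex, hi]
    have hexA : ∀ kap ∈ Fintype.piFinset
        (fun j : Fin k => Finset.Ico (mu j) (ub W mu j + 1)), Antitone (ex kap) := by
      intro kap hk
      rw [hmem] at hk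
      apply antitone_nat_of_succ_le
      intro i
      by_cases hi : i + 1 < k
      · have h1 := (hk (i + 1) hi).2
        have h2 := (hk i (by omega)).1
        simp only [ub, Nat.add_sub_cancel] at h1
        simp at h1
        omega
      · simp [ex, hi]
    have hb1 : ∀ kap ∈ Fintype.piFinset
        (fun j : Fin k => Finset.Ico (mu j) (ub W mu j + 1)), ∀ c, cj k mu c ≤ cj k (ex kap) c := by
      intro kap hk c
      have hA := hexA kap hk
      rw [hmem] at hk
      by_contra hn
      push Not at hn
      have h1 := (lt_cj hmu _ _).1 hn
      have h2 := (hk _ h1.1).1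
      have := (lt_cj hA (cj k (ex kap) c) c).2 ⟨h1.1, by omega⟩
      omega
    have hb2 : ∀ kap ∈ Fintype.piFinset
        (fun j : Fin k => Finset.Ico (mu j) (ub W mu j + 1)), ∀ c, cj k (ex kap) c ≤ cj k mu c + 1 := by
      intro kap hk c
      have hA := hexA kap hk
      rw [hmem] at hk
      by_contra hn
      push Not at hn
      have h1 := (lt_cj hA _ _).1 hn
      have h2 := (hk _ h1.1).2
      simp [ub] at h2
      have := (lt_cj (k := k) hmu (cj k mu c) c).2 ⟨by omega, by omega⟩
      omega
    apply Finset.sum_of_injOn (fun kap => Emv W (cj k mu) (cj k (ex kap)))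
    · intro ka hka kb hkb e
      have hka' := Finset.mem_coe.1 hka
      have hkb' := Finset.mem_coe.1 hkb
      have : ∀ c, c < W → cj k (ex ka) c = cj k (ex kb) c := by
        intro c hc
        have e1 := mem_Emv (cj k (ex ka)) (cj_anti k mu) hc
        have e2 := mem_Emv (cj k (ex kb)) (cj_anti k mu) hc
        simp only at e
        rw [e, e2] at e1
        have := hb1 ka hka' c
        have := hb2 ka hka' c
        have := hb1 kb hkb' c
        have := hb2 kb hkb' c
        omega
      funext i
      rw [← ex_fin ka, ← ex_fin kb]
      exact cj_eq_imp (hexA ka hka') (hexA kb hkb') (hexW ka hka') (hexW kb hkb') this i i.2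
    · intro ka hka
      have hka' := Finset.mem_coe.1 hka
      exact Emv_mem (cj_anti _ _) (cj_anti _ _) (hb1 ka hka') (hb2 ka hka')
    · intro A hA hn
      obtain ⟨h', h1, h2, h3, h4, rfl⟩ := Emv_surj (cj_anti k mu) hA
      rw [image_Emv (cj_anti k mu) h2 h3]
      by_cases hk : h' 0 ≤ k
      · exfalso
        apply hn
        have hex : ex (fun i : Fin k => cj W h' i) = cj W h' := by
          funext i
          unfold ex
          split_ifs with hi
          · rfl
          · symm
            unfold cj
            rw [Finset.card_eq_zero, Finset.filter_eq_empty_iff]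
            intro c _
            have := h1 (Nat.zero_le c)
            omega
        have hcc : cj k (cj W h') = h' := by
          funext c
          apply nat_eq_of_lt
          intro i
          rw [lt_cj (cj_anti W h'), lt_cj h1]
          have := h1 (Nat.zero_le c)
          constructor
          · rintro ⟨_, _, h⟩; exact h
          · intro h
            refine ⟨by omega, ?_, h⟩
            by_contra hc
            push Not at hc
            rw [h4 c hc, cj_ge hm c hc] at h
            omega
        refine ⟨fun i => cj W h' i, ?_, ?_⟩
        · rw [Finset.mem_coe, hmem, hex]
          intro i hi
          constructor
          · by_contra hlt
            push Not at hlt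
            have a1 := (lt_cj hmu i (cj W h' i)).2 ⟨hi, hlt⟩
            have a2 := h2 (cj W h' i)
            have a3 := (lt_cj (k := W) h1 (cj W h' i) i).2 ⟨by have := hm i; omega, by omega⟩
            omega
          · unfold ub
            split_ifs with h0
            · exact cj_le _ _ _
            · by_contra hlt
              push Not at hlt
              have a1 := (lt_cj h1 _ _).1 hlt
              have a2 := h3 (mu (i - 1))
              have a3 := (lt_cj (k := k) hmu (i - 1) (mu (i - 1))).1 (by omega)
              omega
        · simp only [hex, hcc]
      · have hW : 0 < W := by
          by_contra hW
          have := h4 0 (by omega)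
          have := cj_le k mu 0
          omega
        rw [CF_bound n _ _ _ (2 * k) _ (pz h' 0), mul_zero]
        · exact Finset.mem_image_of_mem _ (Finset.mem_range.2 hW)
        · simp only [pz]; omega
        · intro z hz
          simp only [Zs, Finset.mem_image] at hz
          obtain ⟨c, _, rfl⟩ := hz
          have := cj_le k lam c
          simp only [pz]; omega
    · intro ka hka
      have e1 := image_Emv (W := W) (cj_anti k mu) (hb1 ka hka) (hb2 ka hka)
      have e2 := Emv_card (W := W) (cj_anti k mu) (hb1 ka hka) (hb2 ka hka)
      rw [cj_sum k W mu hm, cj_sum k W _ (hexW ka hka)] at e2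
      rw [e1]
      have e3 := ih (fun t => X (t + 1)) (ex ka) (hexA ka hka) (hexW ka hka)
      simp only [ex_fin] at e3
      rw [← e3]
      congr 2
      have e4 : ∑ j : Fin k, (ka j - mu j) + ∑ j : Fin k, mu j = ∑ j : Fin k, ka j := by
        rw [← Finset.sum_add_distrib]
        apply Finset.sum_congr rfl
        intro j _
        have := ((hmem ka).1 hka j j.2).1
        rw [ex_fin] at this
        omega
      have e5 : ∑ j : Fin k, ka j = ∑ i ∈ Finset.range k, ex ka i := by
        rw [← Fin.sum_univ_eq_sum_range]
        simp only [ex_fin]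
      rw [e5, Fin.sum_univ_eq_sum_range] at e4
      omega

theorem skew_CF (N k W : ℕ) (lam mu : ℕ → ℕ)
    (hlam : Antitone lam) (hmu : Antitone mu) (hl : ∀ i, lam i ≤ W) (hm : ∀ i, mu i ≤ W) :
    skewSchur N k lam mu = CF N (xt (xv N)) (Zs W (cj k mu)) (Zs W (cj k lam)) := by
  rw [← DtCF N _ k W lam mu hlam hmu hl hm, skewSchur, Dt, ← Matrix.det_transpose]
  congr 1
  ext1 j i
  simp only [Matrix.transpose_apply, Matrix.of_apply, homog_eq, Hn, xt_lt]
  unfold xv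
  congr 1
  ring


/-- count of large entries -/
def cg (W : ℕ) (a : ℕ → ℤ) (x : ℤ) : ℕ := ((Finset.range W).filter (fun j => x ≤ a j)).card

theorem lt_cg {W : ℕ} {a : ℕ → ℤ} (ha : StrictAnti a) (i : ℕ) (x : ℤ) :
    i < cg W a x ↔ i < W ∧ x ≤ a i := by
  unfold cg
  constructor
  · intro h
    by_contra hn
    have : (Finset.range W).filter (fun j => x ≤ a j) ⊆ Finset.range i := by
      intro y hy
      simp only [Finset.mem_filter, Finset.mem_range] at hy ⊢
      by_contra hxi
      push Not at hxi
      exact hn ⟨by omega, hy.2.trans (ha.antitone hxi)⟩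
    have := Finset.card_le_card this
    rw [Finset.card_range] at this
    omega
  · rintro ⟨h1, h2⟩
    have : Finset.range (i + 1) ⊆ (Finset.range W).filter (fun j => x ≤ a j) := by
      intro y hy
      simp only [Finset.mem_filter, Finset.mem_range] at hy ⊢
      exact ⟨by omega, h2.trans (ha.antitone (by omega))⟩
    have := Finset.card_le_card this
    rw [Finset.card_range] at this
    omega

theorem cg_self {W : ℕ} {a : ℕ → ℤ} (ha : StrictAnti a) {j : ℕ} (hj : j < W) :
    cg W a (a j) = j + 1 := by
  have h1 := (lt_cg (W := W) ha j (a j)).2 ⟨hj, le_rfl⟩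
  have h2 := (lt_cg (W := W) ha (j + 1) (a j)).1.mt (by
    have := ha (Nat.lt_succ_self j)
    simp only [Nat.succ_eq_add_one] at this
    omega)
  omega

theorem cg_self1 {W : ℕ} {a : ℕ → ℤ} (ha : StrictAnti a) {j : ℕ} (hj : j < W) :
    cg W a (a j + 1) = j := by
  have h2 := (lt_cg (W := W) ha j (a j + 1)).1.mt (by omega)
  rcases Nat.eq_zero_or_pos j with h | h
  · omega
  · have h1 := (lt_cg (W := W) ha (j - 1) (a j + 1)).2 ⟨by omega, by
      have := ha (show j - 1 < j by omega)
      omega⟩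
    omega

theorem cg_not {W : ℕ} {a : ℕ → ℤ} {x : ℤ} (hx : ∀ j, j < W → a j ≠ x) :
    cg W a (x + 1) = cg W a x := by
  unfold cg
  congr 1
  apply Finset.filter_congr
  intro j hj
  have := hx j (Finset.mem_range.1 hj)
  omega

/-- even particles -/
def Zw (W : ℕ) (a : ℕ → ℤ) : Finset ℤ := (Finset.range W).image (fun c => 2 * a c)

/-- two-coloured particles -/
def Zof (W : ℕ) (a b : ℕ → ℤ) : Finset ℤ := Zw W a ∪ (Zw W b).image (· + 1)

theorem mem_Zof_even {W : ℕ} {a b : ℕ → ℤ} {s : ℤ} : 2 * s ∈ Zof W a b ↔ ∃ j, j < W ∧ a j = s := by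
  simp only [Zof, Zw, Finset.mem_union, Finset.mem_image, Finset.mem_range]
  constructor
  · rintro (⟨j, hj, e⟩ | ⟨_, ⟨j, hj, rfl⟩, e⟩)
    · exact ⟨j, hj, by omega⟩
    · omega
  · rintro ⟨j, hj, e⟩
    exact Or.inl ⟨j, hj, by omega⟩

theorem mem_Zof_odd {W : ℕ} {a b : ℕ → ℤ} {s : ℤ} : 2 * s + 1 ∈ Zof W a b ↔ ∃ j, j < W ∧ b j = s := by
  simp only [Zof, Zw, Finset.mem_union, Finset.mem_image, Finset.mem_range]
  constructor
  · rintro (⟨j, hj, e⟩ | ⟨_, ⟨j, hj, rfl⟩, e⟩)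
    · omega
    · exact ⟨j, hj, by omega⟩
  · rintro ⟨j, hj, e⟩
    exact Or.inr ⟨2 * b j, ⟨j, hj, rfl⟩, by omega⟩

theorem dl_Zof {W : ℕ} {a b : ℕ → ℤ} (ha : StrictAnti a) (hb : StrictAnti b) (x : ℤ) :
    dl (Zof W a b) x = (cg W a x : ℤ) - cg W b x := by
  unfold dl Zof
  rw [Finset.filter_union, Finset.sum_union]
  · have e1 : (Zw W a).filter (fun z => 2 * x ≤ z) =
        ((Finset.range W).filter (fun j => x ≤ a j)).image (fun c => 2 * a c) := by
      unfold Zw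
      rw [Finset.filter_image]
      congr 1
      apply Finset.filter_congr
      intro j _
      omega
    have e2 : ((Zw W b).image (· + 1)).filter (fun z => 2 * x ≤ z) =
        ((Finset.range W).filter (fun j => x ≤ b j)).image (fun c => 2 * b c + 1) := by
      unfold Zw
      rw [Finset.image_image, Finset.filter_image]
      congr 1
      apply Finset.filter_congr
      intro j _
      simp only [Function.comp]
      omega
    rw [e1, e2, Finset.sum_image, Finset.sum_image]
    · have s1 : ∀ y : ℤ, sg (2 * y) = 1 := by intro y; unfold sg; simp
      have s2 : ∀ y : ℤ, sg (2 * y + 1) = -1 := by intro y; unfold sg; simp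
      simp only [s1, s2, Finset.sum_const, cg]
      simp
      ring
    · intro i _ j _ e
      exact hb.injective (by simp only at e; omega)
    · intro i _ j _ e
      exact ha.injective (by simp only at e; omega)
  · rw [Finset.disjoint_left]
    intro z h1 h2
    simp only [Zw, Finset.mem_filter, Finset.mem_image] at h1 h2
    obtain ⟨⟨i, _, e1⟩, _⟩ := h1
    obtain ⟨⟨_, ⟨j, _, rfl⟩, e2⟩, _⟩ := h2
    omega


theorem fold_Zof {W : ℕ} {a b : ℕ → ℤ} (ha : StrictAnti a) (hb : StrictAnti b) :
    fold (Zof W a b) = Zof W (fun j => max (a j) (b j)) (fun j => min (a j) (b j)) := by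
  set Z := Zof W a b with hZ
  set G : ℤ → Prop := fun w => bar w ∉ Z ∧ vlev Z (w / 2) < 0 with hG
  have mE : ∀ s, 2 * s ∈ Z ↔ ∃ j, j < W ∧ a j = s := fun s => mem_Zof_even
  have mO : ∀ s, 2 * s + 1 ∈ Z ↔ ∃ j, j < W ∧ b j = s := fun s => mem_Zof_odd
  have F1 : ∀ w, bar w ∈ Z → fl G w = w := fun w h => fl_neg (fun h' => h'.1 h)
  have vE : ∀ j, j < W → (2 * a j + 1 ∉ Z) → (vlev Z ((2 * a j) / 2) < 0 ↔ a j < b j) := by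
    intro j hj hn
    have hne : ∀ i, i < W → b i ≠ a j := fun i hi e => hn ((mO _).2 ⟨i, hi, e⟩)
    rw [show 2 * a j / 2 = a j by omega]
    unfold vlev
    rw [hZ, dl_Zof ha hb, dl_Zof ha hb, cg_self ha hj, cg_self1 ha hj, cg_not hne]
    have h1 := lt_cg (W := W) hb j (a j)
    have h2 := hne j hj
    constructor
    · intro h
      have := (h1.1 (by omega)).2
      omega
    · intro h
      have := h1.2 ⟨hj, by omega⟩
      omega
  have vO : ∀ j, j < W → (2 * b j ∉ Z) → (vlev Z ((2 * b j + 1) / 2) < 0 ↔ a j < b j) := by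
    intro j hj hn
    have hne : ∀ i, i < W → a i ≠ b j := fun i hi e => hn ((mE _).2 ⟨i, hi, e⟩)
    rw [show (2 * b j + 1) / 2 = b j by omega]
    unfold vlev
    rw [hZ, dl_Zof ha hb, dl_Zof ha hb, cg_self hb hj, cg_self1 hb hj, cg_not hne]
    have h1 := lt_cg (W := W) ha j (b j)
    have h2 := hne j hj
    constructor
    · intro h
      have := mt h1.2 (by omega)
      by_contra hc
      exact this ⟨hj, by omega⟩
    · intro h
      have := mt h1.1 (by omega)
      omega
  -- evaluation on particles
  have fE1 : ∀ j, j < W → 2 * a j + 1 ∉ Z → a j < b j → fl G (2 * a j) = 2 * a j + 1 := by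
    intro j hj hn h
    rw [fl_pos, bar_even]
    refine ⟨by rwa [bar_even], (vE j hj hn).2 h⟩
  have fE2 : ∀ j, j < W → ¬ a j < b j → fl G (2 * a j) = 2 * a j := by
    intro j hj h
    apply fl_neg
    rintro ⟨h1, h2⟩
    rw [bar_even] at h1
    exact h ((vE j hj h1).1 h2)
  have fO1 : ∀ j, j < W → 2 * b j ∉ Z → a j < b j → fl G (2 * b j + 1) = 2 * b j := by
    intro j hj hn h
    rw [fl_pos, bar_odd]
    refine ⟨by rwa [bar_odd], (vO j hj hn).2 h⟩
  have fO2 : ∀ j, j < W → ¬ a j < b j → fl G (2 * b j + 1) = 2 * b j + 1 := by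
    intro j hj h
    apply fl_neg
    rintro ⟨h1, h2⟩
    rw [bar_odd] at h1
    exact h ((vO j hj h1).1 h2)
  have common : ∀ i j, i < W → j < W → a i = b j →
      (∃ l, l < W ∧ max (a l) (b l) = a i) ∧ (∃ l, l < W ∧ min (a l) (b l) = a i) := by
    intro i j hi hj e
    rcases lt_trichotomy i j with h | h | h
    · have h1 := ha h
      have h2 := hb h
      exact ⟨⟨j, hj, by omega⟩, ⟨i, hi, by omega⟩⟩
    · subst h
      exact ⟨⟨i, hi, by omega⟩, ⟨i, hi, by omega⟩⟩
    · have h1 := ha h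
      have h2 := hb h
      exact ⟨⟨i, hi, by omega⟩, ⟨j, hj, by omega⟩⟩
  ext z
  unfold fold
  rw [Finset.mem_image]
  constructor
  · rintro ⟨w, hw, rfl⟩
    change fl G w ∈ _
    obtain ⟨s, rfl | rfl⟩ := even_odd w
    · obtain ⟨j, hj, rfl⟩ := (mE s).1 hw
      by_cases hn : 2 * a j + 1 ∈ Z
      · rw [F1 _ (by rwa [bar_even]), mem_Zof_even]
        obtain ⟨i, hi, e⟩ := (mO _).1 hn
        exact (common j i hj hi e.symm).1
      · by_cases h : a j < b j
        · rw [fE1 j hj hn h, mem_Zof_odd]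
          exact ⟨j, hj, by omega⟩
        · rw [fE2 j hj h, mem_Zof_even]
          exact ⟨j, hj, by omega⟩
    · obtain ⟨j, hj, rfl⟩ := (mO s).1 hw
      by_cases hn : 2 * b j ∈ Z
      · rw [F1 _ (by rwa [bar_odd]), mem_Zof_odd]
        obtain ⟨i, hi, e⟩ := (mE _).1 hn
        rw [← e]
        exact (common i j hi hj e).2
      · by_cases h : a j < b j
        · rw [fO1 j hj hn h, mem_Zof_even]
          exact ⟨j, hj, by omega⟩
        · rw [fO2 j hj h, mem_Zof_odd]
          exact ⟨j, hj, by omega⟩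
  · intro hz
    change ∃ w ∈ Z, fl G w = z
    obtain ⟨s, rfl | rfl⟩ := even_odd z
    · obtain ⟨j, hj, e⟩ := mem_Zof_even.1 hz
      by_cases h : a j < b j
      · have e : b j = s := by omega
        subst e
        by_cases hn : 2 * b j ∈ Z
        · exact ⟨2 * b j, hn, F1 _ (by rw [bar_even]; exact (mO _).2 ⟨j, hj, rfl⟩)⟩
        · exact ⟨2 * b j + 1, (mO _).2 ⟨j, hj, rfl⟩, fO1 j hj hn h⟩
      · have e : a j = s := by omega
        subst e
        exact ⟨2 * a j, (mE _).2 ⟨j, hj, rfl⟩, fE2 j hj h⟩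
    · obtain ⟨j, hj, e⟩ := mem_Zof_odd.1 hz
      by_cases h : a j < b j
      · have e : a j = s := by omega
        subst e
        by_cases hn : 2 * a j + 1 ∈ Z
        · exact ⟨2 * a j + 1, hn, F1 _ (by rw [bar_odd]; exact (mE _).2 ⟨j, hj, rfl⟩)⟩
        · exact ⟨2 * a j, (mE _).2 ⟨j, hj, rfl⟩, fE1 j hj hn h⟩
      · have e : b j = s := by omega
        subst e
        exact ⟨2 * b j + 1, (mO _).2 ⟨j, hj, rfl⟩, fO2 j hj h⟩

/-- generating function of one colour -/
noncomputable def Cw (N W : ℕ) (a0 a : ℕ → ℤ) : MvPolynomial (Fin N) ℤ :=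
  CF N (xt (xv N)) (Zw W a0) (Zw W a)

theorem Cw_shift (N W : ℕ) (a0 a a0' a' : ℕ → ℤ) (c : ℤ) (h0 : ∀ j, a0' j = a0 j + c)
    (h : ∀ j, a' j = a j + c) : Cw N W a0' a' = Cw N W a0 a := by
  have : ∀ f f' : ℕ → ℤ, (∀ j, f' j = f j + c) → Zw W f' = (Zw W f).image (· + 2 * c) := by
    intro f f' hf
    unfold Zw
    rw [Finset.image_image]
    apply Finset.image_congr
    intro j _
    simp only [Function.comp, hf]
    ring
  unfold Cw
  rw [this a0 a0' h0, this a a' h, CF_shift]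

theorem CF_Zof (N W : ℕ) (a0 b0 a b : ℕ → ℤ) :
    CF N (xt (xv N)) (Zof W a0 b0) (Zof W a b) = Cw N W a0 a * Cw N W b0 b := by
  have h0 : ∀ f : ℕ → ℤ, ∀ z ∈ Zw W f, z % 2 = 0 := by
    intro f z hz
    simp only [Zw, Finset.mem_image] at hz
    obtain ⟨j, _, rfl⟩ := hz
    omega
  have h1 : ∀ f : ℕ → ℤ, ∀ z ∈ (Zw W f).image (· + 1), z % 2 = 1 := by
    intro f z hz
    simp only [Finset.mem_image] at hz
    obtain ⟨y, hy, rfl⟩ := hz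
    have := h0 f y hy
    omega
  unfold Zof Cw
  rw [CF_mul _ _ _ _ _ _ (h0 _) (h1 _) (h0 _) (h1 _), CF_shift]

theorem strictAnti_max {a b : ℕ → ℤ} (ha : StrictAnti a) (hb : StrictAnti b) (c : ℤ) :
    StrictAnti (fun j => max (a j) (b j + c)) := by
  intro i j h
  have := ha h
  have := hb h
  simp only
  omega

theorem strictAnti_min {a b : ℕ → ℤ} (ha : StrictAnti a) (hb : StrictAnti b) (c : ℤ) :
    StrictAnti (fun j => min (a j) (b j + c) - c) := by
  intro i j h
  have := ha h
  have := hb h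
  simp only
  omega

theorem step_le (N W : ℕ) {a0 b0 a b : ℕ → ℤ} (ha0 : StrictAnti a0) (hb0 : StrictAnti b0)
    (ha : StrictAnti a) (hb : StrictAnti b) (c : ℤ) :
    IsSchurNonneg N (Cw N W (fun j => max (a0 j) (b0 j + c)) (fun j => max (a j) (b j + c)) *
      Cw N W (fun j => min (a0 j) (b0 j + c) - c) (fun j => min (a j) (b j + c) - c)
      - Cw N W a0 a * Cw N W b0 b) := by
  have hb0' : StrictAnti (fun j => b0 j + c) := fun i j h => by have := hb0 h; simp only; omega
  have hb' : StrictAnti (fun j => b j + c) := fun i j h => by have := hb h; simp only; omega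
  have := CF_fold N (Zof W a0 (fun j => b0 j + c)) (Zof W a (fun j => b j + c))
  rw [fold_Zof ha0 hb0', fold_Zof ha hb', CF_Zof, CF_Zof] at this
  rw [Cw_shift N W b0 b (fun j => b0 j + c) (fun j => b j + c) c (fun _ => rfl) (fun _ => rfl)] at this
  rwa [Cw_shift N W (fun j => min (a0 j) (b0 j + c)) (fun j => min (a j) (b j + c))
    (fun j => min (a0 j) (b0 j + c) - c) (fun j => min (a j) (b j + c) - c) (-c)
    (fun _ => by ring) (fun _ => by ring)]

theorem iter_le (N W w : ℕ) : ∀ (m : ℤ) (a0 b0 a b : ℕ → ℤ), StrictAnti a0 → StrictAnti b0 →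
    StrictAnti a → StrictAnti b →
    (∀ j, m ≤ a0 j - b0 j ∧ a0 j - b0 j ≤ m + 1 + w) →
    (∀ j, m ≤ a j - b j ∧ a j - b j ≤ m + 1 + w) →
    IsSchurNonneg N (Cw N W (fun j => (a0 j + b0 j + 1) / 2) (fun j => (a j + b j + 1) / 2) *
      Cw N W (fun j => (a0 j + b0 j) / 2) (fun j => (a j + b j) / 2)
      - Cw N W a0 a * Cw N W b0 b) := by
  induction w with
  | zero =>
    intro m a0 b0 a b _ _ _ _ h0 h
    simp only [Nat.cast_zero, add_zero] at h0 h
    rcases Int.emod_two_eq_zero_or_one m with hm | hm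
    · rw [Cw_shift N W a0 a (fun j => (a0 j + b0 j + 1) / 2) (fun j => (a j + b j + 1) / 2) (-(m / 2)) (fun j => by have := h0 j; omega)
        (fun j => by have := h j; omega),
        Cw_shift N W b0 b (fun j => (a0 j + b0 j) / 2) (fun j => (a j + b j) / 2) (m / 2) (fun j => by have := h0 j; omega)
        (fun j => by have := h j; omega), sub_self]
      exact isn_zero N
    · rw [Cw_shift N W b0 b (fun j => (a0 j + b0 j + 1) / 2) (fun j => (a j + b j + 1) / 2) ((m + 1) / 2) (fun j => by have := h0 j; omega)
        (fun j => by have := h j; omega),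
        Cw_shift N W a0 a (fun j => (a0 j + b0 j) / 2) (fun j => (a j + b j) / 2) (-((m + 1) / 2)) (fun j => by have := h0 j; omega)
        (fun j => by have := h j; omega), mul_comm, sub_self]
      exact isn_zero N
  | succ w ih =>
    intro m a0 b0 a b ha0 hb0 ha hb h0 h
    have s1 := step_le N W ha0 hb0 ha hb (m + 1)
    have s2 := ih (m + 1) _ _ _ _ (strictAnti_max ha0 hb0 (m + 1)) (strictAnti_min ha0 hb0 (m + 1))
      (strictAnti_max ha hb (m + 1)) (strictAnti_min ha hb (m + 1))
      (fun j => by have := h0 j; push_cast at this; omega)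
      (fun j => by have := h j; push_cast at this; omega)
    have e : ∀ x y : ℤ, max x (y + (m + 1)) + (min x (y + (m + 1)) - (m + 1)) = x + y := by
      intro x y; omega
    simp only [e] at s2
    have := isn_add s2 s1
    rwa [sub_add_sub_cancel] at this

theorem cj_count (n : ℕ) (f : ℕ → ℕ) (c : ℕ) :
    cj n f c = Multiset.countP (fun x => c < x) ((Finset.range n).val.map f) := by
  rw [Multiset.countP_map]
  rfl

theorem cj_union {k : ℕ} {sigma lam nu : ℕ → ℕ} (h : (Finset.range (2 * k)).val.map sigma
      = (Finset.range k).val.map lam + (Finset.range k).val.map nu) (c : ℕ) :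
    cj (2 * k) sigma c = cj k lam c + cj k nu c := by
  rw [cj_count, cj_count, cj_count, h, Multiset.countP_add]

theorem cj_even {k : ℕ} {sigma : ℕ → ℕ} (hs : Antitone sigma) (c : ℕ) :
    cj k (fun j => sigma (2 * j)) c = (cj (2 * k) sigma c + 1) / 2 := by
  apply nat_eq_of_lt
  intro i
  have h1 := lt_cj (k := k) (mu := fun j => sigma (2 * j)) (fun x y h => hs (by omega)) i c
  have h2 := lt_cj (k := 2 * k) hs (2 * i) c
  rw [h1, show i < (cj (2 * k) sigma c + 1) / 2 ↔ 2 * i < cj (2 * k) sigma c by omega, h2]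
  simp

theorem cj_odd {k : ℕ} {sigma : ℕ → ℕ} (hs : Antitone sigma) (c : ℕ) :
    cj k (fun j => sigma (2 * j + 1)) c = cj (2 * k) sigma c / 2 := by
  apply nat_eq_of_lt
  intro i
  have h1 := lt_cj (k := k) (mu := fun j => sigma (2 * j + 1)) (fun x y h => hs (by omega)) i c
  have h2 := lt_cj (k := 2 * k) hs (2 * i + 1) c
  rw [h1, show i < cj (2 * k) sigma c / 2 ↔ 2 * i + 1 < cj (2 * k) sigma c by omega, h2]
  simp only [and_congr_left_iff]
  intro _
  omega

/-- column coordinates -/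
def cl (k : ℕ) (mu : ℕ → ℕ) (c : ℕ) : ℤ := (cj k mu c : ℤ) - c

theorem cl_anti (k : ℕ) (mu : ℕ → ℕ) : StrictAnti (cl k mu) := by
  intro i j h
  have := cj_anti k mu h.le
  unfold cl
  omega

theorem skew_Cw (N k W : ℕ) (lam mu : ℕ → ℕ)
    (hlam : Antitone lam) (hmu : Antitone mu) (hl : ∀ i, lam i ≤ W) (hm : ∀ i, mu i ≤ W) :
    skewSchur N k lam mu = Cw N W (cl k mu) (cl k lam) := skew_CF N k W lam mu hlam hmu hl hm

/-- For any two skew shapes `λ/μ` and `ν/ρ`,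
`s_{sort₁(λ,ν)/sort₁(μ,ρ)} s_{sort₂(λ,ν)/sort₂(μ,ρ)} ≥_s s_{λ/μ} s_{ν/ρ}`.
Here `σ` is the weakly decreasing rearrangement of all parts of `λ` and `ν`
together, `τ` the one of all parts of `μ` and `ρ`, so that
`sort₁(λ,ν) = (σ_1, σ_3, …)`, `sort₂(λ,ν) = (σ_2, σ_4, …)`, and similarly for τ. -/
theorem schur_nonneg_sort_skew (k : ℕ) (lam mu nu rho : ℕ → ℕ)
    (hlam : Antitone lam) (hmu : Antitone mu) (hnu : Antitone nu) (hrho : Antitone rho)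
    (hlamk : ∀ j, k ≤ j → lam j = 0) (hmuk : ∀ j, k ≤ j → mu j = 0)
    (hnuk : ∀ j, k ≤ j → nu j = 0) (hrhok : ∀ j, k ≤ j → rho j = 0)
    (hml : ∀ i, mu i ≤ lam i) (hrn : ∀ i, rho i ≤ nu i)
    (sigma tau : ℕ → ℕ) (hsigma : Antitone sigma) (htau : Antitone tau)
    (hsigmak : ∀ j, 2 * k ≤ j → sigma j = 0) (htauk : ∀ j, 2 * k ≤ j → tau j = 0)
    (hsigmaUnion : (Finset.range (2 * k)).val.map sigma
      = (Finset.range k).val.map lam + (Finset.range k).val.map nu)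
    (htauUnion : (Finset.range (2 * k)).val.map tau
      = (Finset.range k).val.map mu + (Finset.range k).val.map rho)
    (N : ℕ) :
    IsSchurNonneg N
      (skewSchur N k (fun j => sigma (2 * j)) (fun j => tau (2 * j))
          * skewSchur N k (fun j => sigma (2 * j + 1)) (fun j => tau (2 * j + 1))
        - skewSchur N k lam mu * skewSchur N k nu rho) := by
  obtain ⟨W, hW⟩ : ∃ W, W = lam 0 + mu 0 + nu 0 + rho 0 + sigma 0 + tau 0 := ⟨_, rfl⟩
  have bd : ∀ f : ℕ → ℕ, Antitone f → f 0 ≤ W → ∀ i, f i ≤ W := fun f hf h i =>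
    (hf (Nat.zero_le i)).trans h
  have h1 := bd lam hlam (by omega)
  have h2 := bd mu hmu (by omega)
  have h3 := bd nu hnu (by omega)
  have h4 := bd rho hrho (by omega)
  have h5 := bd sigma hsigma (by omega)
  have h6 := bd tau htau (by omega)
  rw [skew_Cw N k W lam mu hlam hmu h1 h2, skew_Cw N k W nu rho hnu hrho h3 h4,
    skew_Cw N k W _ _ (fun x y h => hsigma (by omega)) (fun x y h => htau (by omega))
      (fun i => h5 _) (fun i => h6 _),
    skew_Cw N k W (fun j => sigma (2 * j + 1)) (fun j => tau (2 * j + 1))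
      (fun x y h => hsigma (by omega)) (fun x y h => htau (by omega))
      (fun i => h5 _) (fun i => h6 _)]
  have key := iter_le N W (2 * k) (-k) (cl k mu) (cl k rho) (cl k lam) (cl k nu)
    (cl_anti _ _) (cl_anti _ _) (cl_anti _ _) (cl_anti _ _)
    (fun j => by
      have := cj_le k mu j
      have := cj_le k rho j
      unfold cl
      push_cast
      omega)
    (fun j => by
      have := cj_le k lam j
      have := cj_le k nu j
      unfold cl
      push_cast
      omega)
  have e1 : ∀ s l n : ℕ → ℕ, Antitone s → ((Finset.range (2 * k)).val.map s
      = (Finset.range k).val.map l + (Finset.range k).val.map n) →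
      cl k (fun j => s (2 * j)) = fun j => (cl k l j + cl k n j + 1) / 2 := by
    intro s l n hs hu
    funext c
    unfold cl
    rw [cj_even hs, cj_union hu]
    push_cast
    omega
  have e2 : ∀ s l n : ℕ → ℕ, Antitone s → ((Finset.range (2 * k)).val.map s
      = (Finset.range k).val.map l + (Finset.range k).val.map n) →
      cl k (fun j => s (2 * j + 1)) = fun j => (cl k l j + cl k n j) / 2 := by
    intro s l n hs hu
    funext c
    unfold cl
    rw [cj_odd hs, cj_union hu]
    push_cast
    omega
  rw [e1 sigma lam nu hsigma hsigmaUnion, e1 tau mu rho htau htauUnion,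
    e2 sigma lam nu hsigma hsigmaUnion, e2 tau mu rho htau htauUnion]
  exact key
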